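/- Fix Λ < 0, q₀ ∈ ℝ, r_+ > 0 and α with −9/4 < α < min{0, −3/2 + q₀²/(2(−Λ/3))} and (−Λ/3)r_+² > R₀, where R₀ is the unique positive root of 24a x² + (4a − 2q₀²/(−Λ/3) + 6)x + 1 = 0 with a := α + 3/2 − q₀²/(2(−Λ/3)). Set Δ := √(9/4+α), M_{e=0} := (r_+/2)(1+(−Λ/3)r_+²), M_0 := r_+(1+2(−Λ/3)r_+²), e(M) := √(2Mr_+ − r_+² − (−Λ/3)r_+⁴). Then there exist ε₀ > 0 and, for each ε ∈ [0, ε₀), a mass M_c(ε) ∈ (M_{e=0}, M_0) and functions (κ_ε, Ω²_ε, ϖ_ε, Q_ε, A_ε, φ_ε), C² on (r_+, ∞), solving the static system (i)–(vi) on all of (r_+, ∞), attaining the horizon data with M = M_c(ε), e = e(M_c(ε)), φ_ε(r_+) = ε, and satisfying the Dirichlet boundary condition lim_{r→∞} r^{3/2−Δ}φ_ε(r) = 0 (so φ_ε ≢ 0 when ε > 0). Moreover there is C > 0 such that for all ε ∈ [0, ε₀) and all r > r_+: |Ω²_εκ_ε⁻²(r) − Ω_RN²(r)| ≤ Cε²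 and |(d/dr)(Ω²_εκ_ε⁻²)(r) − (d/dr)Ω_RN²(r)| ≤ Cε², where Ω_RN² is the Reissner–Nordström–AdS potential with parameters (M_c(0), e(M_c(0)), Λ). -/

import Mathlib

open Real Set Filter

noncomputable section

/-- The Reissner–Nordström–AdS potential `Ω_RN²(r) = 1 − 2M/r + e²/r² + (−Λ/3)r²`. -/
noncomputable def RNpot (Λ M e r : ℝ) : ℝ := 1 - 2*M/r + e^2/r^2 + (-Λ/3)*r^2

/-- `(M, e, Λ)` are sub-extremal parameters with largest horizon radius `rp`. -/
def IsSubExtremal (Λ M e rp : ℝ) : Prop :=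
  0 < rp ∧ RNpot Λ M e rp = 0 ∧
  (∃ r0, 0 < r0 ∧ r0 ≠ rp ∧ RNpot Λ M e r0 = 0) ∧
  ∀ r, 0 < r → RNpot Λ M e r = 0 → r ≤ rp

/-- The static spherically symmetric Einstein–Maxwell–(charged) Klein–Gordon system
(i)–(vi) on `(r_+, ∞)` for the unknowns `(κ, Ω², ϖ, Q, A, φ)`. -/
def StaticSystem (Λ α q0 rp : ℝ) (κ Ω2 ϖ Q A φ : ℝ → ℝ) : Prop :=
  ContDiffOn ℝ 2 κ (Set.Ioi rp) ∧ ContDiffOn ℝ 2 Ω2 (Set.Ioi rp) ∧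
  ContDiffOn ℝ 2 ϖ (Set.Ioi rp) ∧ ContDiffOn ℝ 2 Q (Set.Ioi rp) ∧
  ContDiffOn ℝ 2 A (Set.Ioi rp) ∧ ContDiffOn ℝ 2 φ (Set.Ioi rp) ∧
  (∀ r ∈ Set.Ioi rp, 0 < κ r) ∧ (∀ r ∈ Set.Ioi rp, 0 < Ω2 r) ∧
  -- (i) Raychaudhuri
  (∀ r ∈ Set.Ioi rp, deriv κ r / κ r =
      r*(deriv φ r)^2 + q0^2*r*(κ r)^2*(A r/Ω2 r)^2*(φ r)^2) ∧
  -- (ii) constraint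
  (∀ r ∈ Set.Ioi rp, Ω2 r/(κ r)^2 = 1 - 2*ϖ r/r + (Q r)^2/r^2 + (-Λ/3)*r^2) ∧
  -- (iii) Vaidya mass transport
  (∀ r ∈ Set.Ioi rp, deriv ϖ r =
      (-Λ/3)*α*r^2*(φ r)^2/2 + (r^2*(deriv φ r)^2/2)*(Ω2 r/(κ r)^2)
      + q0^2*(A r)^2*r^2*(φ r)^2/(2*Ω2 r)
      + q0^2*(Q r)*r*(A r/Ω2 r)*(κ r)*(φ r)^2) ∧
  -- (iv) charge
  (∀ r ∈ Set.Ioi rp, deriv Q r = q0^2*r^2*(κ r)*(A r/Ω2 r)*(φ r)^2) ∧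
  -- (v) potential
  (∀ r ∈ Set.Ioi rp, deriv A r = Q r * κ r / r^2) ∧
  -- (vi) charged Klein–Gordon
  (∀ r ∈ Set.Ioi rp,
      deriv (fun s => s^2*(Ω2 s/(κ s)^2)*deriv φ s) r
        + r^2*(deriv κ r/κ r)*(Ω2 r/(κ r)^2)*deriv φ r
      = (-Λ/3)*α*r^2*φ r - q0^2*(A r)^2*r^2/(Ω2 r)*φ r)

/-- The horizon data at `r = r_+` with mass `M`, charge `e` and scalar field value `ε`,
attained as limits from the black hole exterior `(r_+, ∞)`. -/
def HorizonData (Λ α rp M e ε : ℝ) (κ Ω2 ϖ Q A φ : ℝ → ℝ) : Prop :=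
  ∃ Kp κp : ℝ,
    Kp = M/rp^2 - e^2/rp^3 + (-Λ/3)*rp ∧ 0 < Kp ∧
    κp = (1 - (-Λ/3)*α*rp*ε^2/(2*Kp))⁻¹ ∧
    Filter.Tendsto ϖ (nhdsWithin rp (Set.Ioi rp)) (nhds M) ∧
    Filter.Tendsto Q (nhdsWithin rp (Set.Ioi rp)) (nhds e) ∧
    Filter.Tendsto φ (nhdsWithin rp (Set.Ioi rp)) (nhds ε) ∧
    Filter.Tendsto κ (nhdsWithin rp (Set.Ioi rp)) (nhds κp) ∧
    Filter.Tendsto (deriv φ) (nhdsWithin rp (Set.Ioi rp))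
      (nhds ((-Λ/3)*α*ε*κp/(2*Kp))) ∧
    Filter.Tendsto (fun r => A r / Ω2 r) (nhdsWithin rp (Set.Ioi rp))
      (nhds (e/(2*Kp*rp^2))) ∧
    Filter.Tendsto (deriv Ω2) (nhdsWithin rp (Set.Ioi rp)) (nhds (2*Kp*κp))

open MeasureTheory

open scoped BoundedContinuousFunction Topology

/-- The mean of `ψ` over the segment from `rp` to `r`. -/
def segAvg (rp : ℝ) (ψ : ℝ → ℝ) (r : ℝ) : ℝ := ∫ τ in (0:ℝ)..1, ψ (rp + τ * (r - rp))

lemma continuous_segAvg_param {X : Type*} [TopologicalSpace X] {rp : ℝ} {ψ : X → ℝ → ℝ}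
    (hψ : Continuous (Function.uncurry ψ)) {s : X → ℝ} (hs : Continuous s) :
    Continuous fun x => segAvg rp (ψ x) (s x) := by
  unfold segAvg
  apply intervalIntegral.continuous_parametric_intervalIntegral_of_continuous'
  have : Continuous fun p : X × ℝ => (p.1, rp + p.2 * (s p.1 - rp)) := by fun_prop
  exact hψ.comp this

lemma continuous_segAvg {rp : ℝ} {ψ : ℝ → ℝ} (hψ : Continuous ψ) :
    Continuous (segAvg rp ψ) :=
  continuous_segAvg_param (X := ℝ) (ψ := fun _ => ψ) (hψ.comp continuous_snd) continuous_id

lemma mul_segAvg (rp : ℝ) (ψ : ℝ → ℝ) (r : ℝ) :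
    (r - rp) * segAvg rp ψ r = ∫ t in rp..r, ψ t := by
  have := intervalIntegral.mul_integral_comp_add_mul (a := 0) (b := 1) (f := ψ) (r - rp) rp
  simp only [mul_zero, add_zero, mul_one, add_sub_cancel] at this
  rw [← this, segAvg]
  congr 2
  ext τ
  ring_nf

lemma segAvg_self (rp : ℝ) (ψ : ℝ → ℝ) : segAvg rp ψ rp = ψ rp := by
  simp [segAvg]

lemma abs_segAvg_le {rp C : ℝ} {ψ : ℝ → ℝ} {r : ℝ} (hr : rp ≤ r)
    (h : ∀ t ∈ Icc rp r, |ψ t| ≤ C) : |segAvg rp ψ r| ≤ C := by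
  have := intervalIntegral.norm_integral_le_of_norm_le_const (a := 0) (b := 1) (C := C)
    (f := fun τ => ψ (rp + τ * (r - rp))) ?_
  · simpa [segAvg] using this
  · intro τ hτ
    rw [uIoc_of_le zero_le_one] at hτ
    exact h _ ⟨by nlinarith [hτ.1], by nlinarith [hτ.2]⟩

lemma hasDerivAt_mul_segAvg (rp : ℝ) {ψ : ℝ → ℝ} (hψ : Continuous ψ) (r : ℝ) :
    HasDerivAt (fun s => (s - rp) * segAvg rp ψ s) (ψ r) r := by
  simp_rw [mul_segAvg]
  exact intervalIntegral.integral_hasDerivAt_right (hψ.intervalIntegrable _ _)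
    hψ.aestronglyMeasurable.stronglyMeasurableAtFilter hψ.continuousAt

lemma segAvg_add {rp : ℝ} {ψ χ : ℝ → ℝ} (hψ : Continuous ψ) (hχ : Continuous χ) (r : ℝ) :
    segAvg rp (fun t => ψ t + χ t) r = segAvg rp ψ r + segAvg rp χ r := by
  unfold segAvg
  apply intervalIntegral.integral_add <;> apply Continuous.intervalIntegrable <;> fun_prop

lemma segAvg_const_mul (rp a : ℝ) (ψ : ℝ → ℝ) (r : ℝ) :
    segAvg rp (fun t => a * ψ t) r = a * segAvg rp ψ r := by
  unfold segAvg
  apply intervalIntegral.integral_const_mul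

/-- A pointwise linear and uniformly bounded family of functionals is a bounded operator. -/
lemma exists_clm {α : Type*} [TopologicalSpace α] (f : (α →ᵇ ℝ) → α → ℝ) (C : ℝ) (hC : 0 ≤ C)
    (hadd : ∀ ψ χ x, f (ψ + χ) x = f ψ x + f χ x) (hsmul : ∀ (a : ℝ) ψ x, f (a • ψ) x = a * f ψ x)
    (hcont : ∀ ψ, Continuous (f ψ)) (hb : ∀ ψ x, |f ψ x| ≤ C * ‖ψ‖) :
    ∃ T : (α →ᵇ ℝ) →L[ℝ] (α →ᵇ ℝ), ‖T‖ ≤ C ∧ ∀ ψ x, T ψ x = f ψ x := by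
  let T0 : (α →ᵇ ℝ) →ₗ[ℝ] (α →ᵇ ℝ) :=
    { toFun := fun ψ => BoundedContinuousFunction.ofNormedAddCommGroup (f ψ) (hcont ψ) (C * ‖ψ‖)
        (hb ψ)
      map_add' := fun ψ χ => by ext x; exact hadd ψ χ x
      map_smul' := fun a ψ => by ext x; exact hsmul a ψ x }
  refine ⟨T0.mkContinuous C fun ψ => ?_, T0.mkContinuous_norm_le hC _, fun ψ x => rfl⟩
  rw [BoundedContinuousFunction.norm_le (by positivity)]
  exact hb ψ

/-- A family of linear Volterra equations with parameter `e`, started at `rp`, has a solution that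
is jointly continuous in the parameter and the variable. -/
lemma exists_volterra_family (rp C : ℝ) (hC : 0 ≤ C) (k W : ℝ → ℝ → ℝ)
    (hk : Continuous (Function.uncurry k)) (hW : Continuous (Function.uncurry W))
    (hb : ∀ e t s, rp ≤ s → s ≤ t → |k e t * W e s| ≤ C) :
    ∃ u : ℝ → ℝ → ℝ, Continuous (Function.uncurry u) ∧ ∀ e r, rp ≤ r →
      u e r = 1 + ∫ t in rp..r, k e t * segAvg rp (fun s => W e s * u e s) t := by
  set l : ℝ := 2 * C + 1 with hl
  have hl0 : 0 < l := by positivity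
  let f : ((ℝ × ℝ) →ᵇ ℝ) → ℝ × ℝ → ℝ := fun v p =>
    exp (-(l * (max p.2 rp - rp))) * ∫ t in rp..(max p.2 rp),
      k p.1 t * segAvg rp (fun s => W p.1 s * (exp (l * (s - rp)) * v (p.1, s))) t
  have hin : ∀ (v : (ℝ × ℝ) →ᵇ ℝ), Continuous (Function.uncurry fun e t =>
      k e t * segAvg rp (fun s => W e s * (exp (l * (s - rp)) * v (e, s))) t) := by
    intro v
    apply Continuous.mul hk
    apply continuous_segAvg_param (X := ℝ × ℝ)
      (ψ := fun p s => W p.1 s * (exp (l * (s - rp)) * v (p.1, s))) _ continuous_snd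
    have h1 : Continuous fun q : (ℝ × ℝ) × ℝ => W q.1.1 q.2 :=
      hW.comp (by fun_prop : Continuous fun q : (ℝ × ℝ) × ℝ => (q.1.1, q.2))
    have h2 : Continuous fun q : (ℝ × ℝ) × ℝ => v (q.1.1, q.2) :=
      v.continuous.comp (by fun_prop : Continuous fun q : (ℝ × ℝ) × ℝ => (q.1.1, q.2))
    exact h1.mul ((by fun_prop : Continuous fun q : (ℝ × ℝ) × ℝ => exp (l * (q.2 - rp))).mul h2)
  have hinr : ∀ (v : (ℝ × ℝ) →ᵇ ℝ) e, Continuous fun t =>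
      k e t * segAvg rp (fun s => W e s * (exp (l * (s - rp)) * v (e, s))) t := fun v e =>
    (hin v).comp (by fun_prop : Continuous fun t : ℝ => (e, t))
  have hinn : ∀ (v : (ℝ × ℝ) →ᵇ ℝ) e, Continuous fun s =>
      W e s * (exp (l * (s - rp)) * v (e, s)) := by
    intro v e
    have h1 : Continuous fun s : ℝ => W e s :=
      hW.comp (by fun_prop : Continuous fun q : ℝ => (e, q))
    have h2 : Continuous fun s : ℝ => v (e, s) := by fun_prop
    fun_prop
  obtain ⟨T, hT, hTf⟩ : ∃ T : ((ℝ × ℝ) →ᵇ ℝ) →L[ℝ] ((ℝ × ℝ) →ᵇ ℝ), ‖T‖ ≤ 1 / 2 ∧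
      ∀ ψ x, T ψ x = f ψ x := by
    refine exists_clm f (1 / 2) (by norm_num) ?_ ?_ ?_ ?_
    · intro ψ χ p
      simp only [f]
      rw [← mul_add, ← intervalIntegral.integral_add ((hinr ψ _).intervalIntegrable _ _)
        ((hinr χ _).intervalIntegrable _ _)]
      congr 1
      apply intervalIntegral.integral_congr
      intro t _
      beta_reduce
      rw [← mul_add, ← segAvg_add (hinn ψ _) (hinn χ _)]
      congr 1
      apply congrArg (fun ψ => segAvg rp ψ t)
      ext s
      simp only [BoundedContinuousFunction.add_apply]
      ring
    · intro a ψ p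
      simp only [f]
      rw [mul_left_comm a, ← intervalIntegral.integral_const_mul a]
      congr 1
      apply intervalIntegral.integral_congr
      intro t _
      beta_reduce
      rw [mul_left_comm a, ← segAvg_const_mul rp a]
      congr 1
      apply congrArg (fun ψ => segAvg rp ψ t)
      ext s
      simp only [BoundedContinuousFunction.smul_apply, smul_eq_mul]
      ring
    · intro ψ
      apply Continuous.mul (by fun_prop)
      exact intervalIntegral.continuous_parametric_intervalIntegral_of_continuous
        (X := ℝ × ℝ) (f := fun p t => k p.1 t * segAvg rp (fun s => W p.1 s *
          (exp (l * (s - rp)) * ψ (p.1, s))) t)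
        ((hin ψ).comp (by fun_prop : Continuous fun q : (ℝ × ℝ) × ℝ => (q.1.1, q.2))) (by fun_prop)
    · rintro ψ ⟨e, r⟩
      simp only [f]
      set R := max r rp
      have hR : rp ≤ R := le_max_right _ _
      have hD : ∀ t : ℝ, HasDerivAt (fun t => C * ‖ψ‖ / l * exp (l * (t - rp)))
          (C * ‖ψ‖ * exp (l * (t - rp))) t := by
        intro t
        have := ((((hasDerivAt_id t).sub_const rp).const_mul l).exp).const_mul (C * ‖ψ‖ / l)
        refine this.congr_deriv ?_
        field_simp
        rfl
      have hI : ∫ t in rp..R, C * ‖ψ‖ * exp (l * (t - rp)) =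
          C * ‖ψ‖ / l * exp (l * (R - rp)) - C * ‖ψ‖ / l * exp (l * (rp - rp)) :=
        intervalIntegral.integral_eq_sub_of_hasDerivAt (fun t _ => hD t)
          (Continuous.intervalIntegrable (by fun_prop) _ _)
      have hle := intervalIntegral.norm_integral_le_of_norm_le (μ := MeasureTheory.volume) hR
        (f := fun t => k e t * segAvg rp (fun s => W e s * (exp (l * (s - rp)) * ψ (e, s))) t)
        (g := fun t => C * ‖ψ‖ * exp (l * (t - rp))) (MeasureTheory.ae_of_all _ fun t ht => by
          rw [← segAvg_const_mul]
          apply abs_segAvg_le ht.1.le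
          intro s hs
          have h1 := hb e t s hs.1 hs.2
          have h2 : |ψ (e, s)| ≤ ‖ψ‖ := ψ.norm_coe_le_norm _
          have h3 : exp (l * (s - rp)) ≤ exp (l * (t - rp)) := by
            apply exp_le_exp.mpr
            nlinarith [hs.2]
          rw [← mul_assoc, abs_mul (k e t * W e s), abs_mul (exp _), abs_of_pos (exp_pos _)]
          calc |k e t * W e s| * (exp (l * (s - rp)) * |ψ (e, s)|)
              ≤ C * (exp (l * (t - rp)) * ‖ψ‖) := by gcongr
            _ = _ := by ring)
        (Continuous.intervalIntegrable (by fun_prop) _ _)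
      rw [Real.norm_eq_abs, hI] at hle
      rw [abs_mul, abs_of_pos (exp_pos _)]
      have hn := norm_nonneg ψ
      have h4 : C / l ≤ 1 / 2 := by
        rw [div_le_iff₀ hl0]; linarith
      calc _ ≤ exp (-(l * (R - rp))) * (C * ‖ψ‖ / l * exp (l * (R - rp))) := by
              gcongr
              refine hle.trans (sub_le_self _ (by positivity))
        _ = C / l * ‖ψ‖ * (exp (-(l * (R - rp))) * exp (l * (R - rp))) := by ring
        _ = C / l * ‖ψ‖ := by rw [← exp_add]; simp
        _ ≤ _ := by gcongr
  have hT1 : ‖T‖ < 1 := by linarith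
  let a : (ℝ × ℝ) →ᵇ ℝ := BoundedContinuousFunction.ofNormedAddCommGroup
    (fun p => exp (-(l * (max p.2 rp - rp)))) (by fun_prop) 1 (fun p => by
      rw [Real.norm_eq_abs, abs_of_pos (exp_pos _), exp_le_one_iff]
      have : rp ≤ max p.2 rp := le_max_right _ _
      nlinarith)
  have hfix : ∃ v, v = a + T v := by
    refine ⟨(↑(Units.oneSub T hT1)⁻¹ : _ →L[ℝ] _) a, ?_⟩
    have h := (Units.oneSub T hT1).mul_inv
    have h2 := congrArg (fun S => S a) h
    simp only [Units.val_oneSub, one_apply_eq_self] at h2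
    exact sub_eq_iff_eq_add.mp h2
  obtain ⟨v, hv⟩ := hfix
  refine ⟨fun e r => exp (l * (r - rp)) * v (e, r), ?_, ?_⟩
  · have : Continuous fun p : ℝ × ℝ => exp (l * (p.2 - rp)) * v (p.1, p.2) := by fun_prop
    exact this
  · intro e r hr
    have h := DFunLike.congr_fun hv (e, r)
    rw [BoundedContinuousFunction.add_apply, hTf] at h
    have h3 : a (e, r) = exp (-(l * (max r rp - rp))) := rfl
    rw [h3] at h
    simp only [f, max_eq_left hr] at h
    beta_reduce
    rw [h, ← mul_one_add, ← mul_assoc, ← exp_add]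
    simp

/-- For Reissner–Nordström–AdS, `r² Ω_RN²(r) = (r - rp) * gRN L rp e r`. -/
def gRN (L rp e r : ℝ) : ℝ := L * r * (r ^ 2 + r * rp + rp ^ 2) + r - e ^ 2 / rp

/-- The potential of the linear radial equation for `u` on Reissner–Nordström–AdS: the radial
derivative of `r² Ω_RN² ∂ᵣu` equals `potV * u`. -/
def potV (L α c rp e r : ℝ) : ℝ :=
  L * α * r ^ 2 - c * e ^ 2 * (r - rp) * r ^ 2 / (rp ^ 2 * gRN L rp e r)

/-- `u`, with derivative `w`, solves the linear radial equation with charge `e`, is regular at the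
horizon and equals one there. -/
structure IsRadialSol (L α c rp e : ℝ) (u w : ℝ → ℝ) : Prop where
  contu : Continuous u
  contw : Continuous w
  u_horizon : u rp = 1
  du : ∀ r, rp < r → HasDerivAt u (w r) r
  dp : ∀ r, rp < r → HasDerivAt (fun s => (s - rp) * gRN L rp e s * w s)
    (potV L α c rp e r * u r) r

lemma gRN_eq {L rp e r : ℝ} (hrp : 0 < rp) : gRN L rp e r =
    (rp ^ 2 + 3 * L * rp ^ 4 - e ^ 2) / rp +
      (r - rp) * (L * (r ^ 2 + 2 * r * rp + 3 * rp ^ 2) + 1) := by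
  unfold gRN
  field_simp
  ring

section

variable {L α c rp e : ℝ}

lemma gRN_ge (hL : 0 < L) (hrp : 0 < rp) (he : e ^ 2 < rp ^ 2 + 3 * L * rp ^ 4) {r : ℝ}
    (hr : rp ≤ r) : (r - rp) * (L * r ^ 2 + 1) < gRN L rp e r := by
  rw [gRN_eq hrp]
  have h1 : 0 < (rp ^ 2 + 3 * L * rp ^ 4 - e ^ 2) / rp := div_pos (by linarith) hrp
  have h2 : (r - rp) * (L * r ^ 2 + 1) ≤
      (r - rp) * (L * (r ^ 2 + 2 * r * rp + 3 * rp ^ 2) + 1) := by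
    apply mul_le_mul_of_nonneg_left _ (by linarith)
    have : 0 ≤ L * (2 * r * rp + 3 * rp ^ 2) := by
      have : 0 < r := hrp.trans_le hr
      positivity
    nlinarith
  linarith

lemma gRN_pos (hL : 0 < L) (hrp : 0 < rp) (he : e ^ 2 < rp ^ 2 + 3 * L * rp ^ 4) {r : ℝ}
    (hr : rp ≤ r) : 0 < gRN L rp e r := by
  refine lt_of_le_of_lt ?_ (gRN_ge hL hrp he hr)
  have : 0 ≤ r - rp := by linarith
  positivity

lemma gRN_sq_le (hL : 0 < L) (hrp : 0 < rp) (he : e ^ 2 < rp ^ 2 + 3 * L * rp ^ 4) {r : ℝ}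
    (hr : rp ≤ r) :
    r ^ 2 ≤ (rp ^ 3 / (rp ^ 2 + 3 * L * rp ^ 4 - e ^ 2) + 1 / (2 * L * rp)) * gRN L rp e r := by
  have hg := gRN_pos hL hrp he hr
  have hd : 0 < rp ^ 2 + 3 * L * rp ^ 4 - e ^ 2 := by linarith
  have h1 : (rp ^ 2 + 3 * L * rp ^ 4 - e ^ 2) / rp ≤ gRN L rp e r := by
    rw [gRN_eq hrp]
    have : 0 ≤ r - rp := by linarith
    have : 0 < r := hrp.trans_le hr
    have : 0 ≤ (r - rp) * (L * (r ^ 2 + 2 * r * rp + 3 * rp ^ 2) + 1) := by positivity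
    linarith
  have h2 : (r - rp) * (2 * L * rp * (r + rp)) ≤ gRN L rp e r := by
    rw [gRN_eq hrp]
    have h3 : 0 ≤ r - rp := by linarith
    have : (r - rp) * (2 * L * rp * (r + rp)) ≤
        (r - rp) * (L * (r ^ 2 + 2 * r * rp + 3 * rp ^ 2) + 1) := by
      apply mul_le_mul_of_nonneg_left _ h3
      nlinarith [sq_nonneg r, sq_nonneg rp]
    have : 0 < (rp ^ 2 + 3 * L * rp ^ 4 - e ^ 2) / rp := div_pos hd hrp
    linarith
  have h4 : rp ^ 2 ≤ rp ^ 3 / (rp ^ 2 + 3 * L * rp ^ 4 - e ^ 2) * gRN L rp e r := by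
    calc rp ^ 2 = rp ^ 3 / (rp ^ 2 + 3 * L * rp ^ 4 - e ^ 2) *
          ((rp ^ 2 + 3 * L * rp ^ 4 - e ^ 2) / rp) := by
            rw [div_mul_div_comm, mul_comm (rp ^ 2 + 3 * L * rp ^ 4 - e ^ 2) rp,
              mul_div_mul_right _ _ hd.ne']
            field_simp
      _ ≤ _ := by gcongr
  have h5 : (r - rp) * (r + rp) ≤ 1 / (2 * L * rp) * gRN L rp e r := by
    rw [div_mul_eq_mul_div, one_mul, le_div_iff₀ (by positivity)]
    linarith
  nlinarith

lemma potV_neg (hL : 0 < L) (hα : α < 0) (hc : 0 ≤ c) (hrp : 0 < rp)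
    (he : e ^ 2 < rp ^ 2 + 3 * L * rp ^ 4) {r : ℝ} (hr : rp ≤ r) : potV L α c rp e r < 0 := by
  have hg := gRN_pos hL hrp he hr
  have hr0 : 0 < r := hrp.trans_le hr
  have h1 : 0 ≤ c * e ^ 2 * (r - rp) * r ^ 2 / (rp ^ 2 * gRN L rp e r) := by
    have : 0 ≤ r - rp := by linarith
    positivity
  have h2 : L * α * r ^ 2 < 0 := by
    have : 0 < L * r ^ 2 := by positivity
    nlinarith
  unfold potV
  linarith

lemma abs_potV_le (hL : 0 < L) (hc : 0 ≤ c) (hrp : 0 < rp)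
    (he : e ^ 2 < rp ^ 2 + 3 * L * rp ^ 4) {r : ℝ} (hr : rp ≤ r) :
    |potV L α c rp e r| ≤ (L * |α| + c * e ^ 2 / rp ^ 2) * r ^ 2 := by
  have hg := gRN_pos hL hrp he hr
  have hr0 : 0 ≤ r - rp := by linarith
  have h0 : (r - rp) / gRN L rp e r ≤ 1 := by
    rw [div_le_one hg]
    refine le_trans ?_ (gRN_ge hL hrp he hr).le
    nlinarith [mul_nonneg hr0 (mul_nonneg hL.le (sq_nonneg r))]
  have h0' : 0 ≤ (r - rp) / gRN L rp e r := by positivity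
  have h2 : c * e ^ 2 * (r - rp) * r ^ 2 / (rp ^ 2 * gRN L rp e r) =
      c * e ^ 2 / rp ^ 2 * r ^ 2 * ((r - rp) / gRN L rp e r) := by field_simp
  have h3 : 0 ≤ c * e ^ 2 / rp ^ 2 * r ^ 2 := by positivity
  unfold potV
  rw [h2]
  refine (abs_sub _ _).trans ?_
  rw [abs_mul, abs_mul, abs_of_pos hL, abs_of_nonneg (sq_nonneg r),
    abs_of_nonneg (mul_nonneg h3 h0')]
  nlinarith

lemma exists_radial_family (hL : 0 < L) (hc : 0 ≤ c) (hrp : 0 < rp) {e1 : ℝ} (he0 : 0 ≤ e1)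
    (he : e1 ^ 2 < rp ^ 2 + 3 * L * rp ^ 4) :
    ∃ u w : ℝ → ℝ → ℝ, Continuous (Function.uncurry u) ∧ Continuous (Function.uncurry w) ∧
      ∀ e ∈ Icc 0 e1, IsRadialSol L α c rp e (u e) (w e) := by
  set cl : ℝ → ℝ := fun e => max 0 (min e e1) with hcl
  have hclc : Continuous cl := by fun_prop
  have hcl1 : ∀ e, 0 ≤ cl e ∧ cl e ≤ e1 := fun e =>
    ⟨le_max_left _ _, max_le he0 (min_le_right _ _)⟩
  have hcl2 : ∀ e, (cl e) ^ 2 < rp ^ 2 + 3 * L * rp ^ 4 := fun e => by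
    nlinarith [hcl1 e]
  have hcl3 : ∀ e ∈ Icc 0 e1, cl e = e := fun e h => by
    simp [hcl, h.1, h.2]
  have hg : ∀ e r, 0 < gRN L rp (cl e) (max r rp) := fun e r =>
    gRN_pos hL hrp (hcl2 e) (le_max_right _ _)
  have hgc : Continuous fun p : ℝ × ℝ => gRN L rp (cl p.1) (max p.2 rp) := by
    unfold gRN; fun_prop
  let k : ℝ → ℝ → ℝ := fun e r => (gRN L rp (cl e) (max r rp))⁻¹
  let W : ℝ → ℝ → ℝ := fun e r => potV L α c rp (cl e) (max r rp)
  have hk : Continuous (Function.uncurry k) := hgc.inv₀ fun p => (hg p.1 p.2).ne'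
  have hW : Continuous (Function.uncurry W) := by
    have : Continuous fun p : ℝ × ℝ => potV L α c rp (cl p.1) (max p.2 rp) := by
      unfold potV
      apply Continuous.sub (by fun_prop)
      apply Continuous.div (by fun_prop) (by fun_prop)
      intro p
      have := hg p.1 p.2
      positivity
    exact this
  set C1 := L * |α| + c * e1 ^ 2 / rp ^ 2
  set C2 := rp ^ 3 / (rp ^ 2 + 3 * L * rp ^ 4 - e1 ^ 2) + 1 / (2 * L * rp)
  have hd : 0 < rp ^ 2 + 3 * L * rp ^ 4 - e1 ^ 2 := by linarith
  have hC1 : 0 ≤ C1 := by positivity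
  have hC2 : 0 ≤ C2 := by positivity
  obtain ⟨u, huc, hu⟩ := exists_volterra_family rp (C2 * C1) (by positivity) k W hk hW (by
    intro e t s hs hst
    have ht := hs.trans hst
    simp only [k, W, max_eq_left hs, max_eq_left ht]
    have h1 := abs_potV_le (α := α) hL hc hrp (hcl2 e) hs
    have h2 := gRN_sq_le hL hrp (hcl2 e) ht
    have hgp := gRN_pos hL hrp (hcl2 e) ht
    have hsq : (cl e) ^ 2 ≤ e1 ^ 2 := by nlinarith [hcl1 e]
    have h3 : |potV L α c rp (cl e) s| ≤ C1 * t ^ 2 := by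
      refine h1.trans ?_
      have : s ^ 2 ≤ t ^ 2 := by nlinarith
      simp only [C1]
      gcongr
    have h4 : t ^ 2 ≤ C2 * gRN L rp (cl e) t := by
      refine h2.trans ?_
      have : rp ^ 2 + 3 * L * rp ^ 4 - e1 ^ 2 ≤ rp ^ 2 + 3 * L * rp ^ 4 - (cl e) ^ 2 := by linarith
      simp only [C2]
      gcongr
    rw [abs_mul, abs_inv, abs_of_pos hgp, inv_mul_le_iff₀ hgp]
    calc _ ≤ C1 * t ^ 2 := h3
      _ ≤ C1 * (C2 * gRN L rp (cl e) t) := by gcongr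
      _ = _ := by ring)
  have huW : ∀ e, Continuous fun s => W e s * u e s := fun e =>
    (hW.comp (by fun_prop : Continuous fun s : ℝ => (e, s))).mul
      (huc.comp (by fun_prop : Continuous fun s : ℝ => (e, s)))
  let w : ℝ → ℝ → ℝ := fun e r => k e r * segAvg rp (fun s => W e s * u e s) r
  have hwc : Continuous (Function.uncurry w) := by
    have : Continuous fun p : ℝ × ℝ => segAvg rp (fun s => W p.1 s * u p.1 s) p.2 := by
      apply continuous_segAvg_param (X := ℝ × ℝ) (ψ := fun p s => W p.1 s * u p.1 s) _
        continuous_snd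
      exact (hW.mul huc).comp (by fun_prop : Continuous fun q : (ℝ × ℝ) × ℝ => (q.1.1, q.2))
    exact hk.mul this
  refine ⟨u, w, huc, hwc, fun e hee => ?_⟩
  have hwe : Continuous (w e) := hwc.comp (by fun_prop : Continuous fun s : ℝ => (e, s))
  refine ⟨huc.comp (by fun_prop : Continuous fun s : ℝ => (e, s)), hwe, ?_, ?_, ?_⟩
  · rw [hu e rp le_rfl]; simp
  · intro r hr
    have h1 : HasDerivAt (fun r => 1 + ∫ t in rp..r, w e t) (w e r) r :=
      (intervalIntegral.integral_hasDerivAt_right (hwe.intervalIntegrable _ _)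
        hwe.aestronglyMeasurable.stronglyMeasurableAtFilter hwe.continuousAt).const_add 1
    refine h1.congr_of_eventuallyEq ?_
    filter_upwards [Ioi_mem_nhds hr] with s hs
    exact hu e s (le_of_lt hs)
  · intro r hr
    have h1 := hasDerivAt_mul_segAvg rp (huW e) r
    simp only [W, hcl3 e hee, max_eq_left hr.le] at h1
    refine h1.congr_of_eventuallyEq ?_
    filter_upwards [Ioi_mem_nhds hr] with s hs
    have hs' : rp ≤ s := le_of_lt hs
    have hgs := hg e s
    simp only [hcl3 e hee, max_eq_left hs'] at hgs
    simp only [w, k, W, hcl3 e hee, max_eq_left hs']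
    field_simp

end

section

variable {L α c rp e : ℝ} {u w : ℝ → ℝ}

lemma hasDerivAt_mul_gRN (hrp : 0 < rp) {r : ℝ} :
    HasDerivAt (fun s => (s - rp) * gRN L rp e s)
      (4 * L * r ^ 3 + 2 * r - (L * rp ^ 3 + rp + e ^ 2 / rp)) r := by
  have : (fun s => (s - rp) * gRN L rp e s) = fun s =>
      L * s ^ 4 + s ^ 2 - (L * rp ^ 3 + rp + e ^ 2 / rp) * s + e ^ 2 := by
    ext s
    unfold gRN
    field_simp
    ring
  rw [this]
  have h := ((((hasDerivAt_pow 4 r).const_mul L).add (hasDerivAt_pow 2 r)).sub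
    ((hasDerivAt_id r).const_mul (L * rp ^ 3 + rp + e ^ 2 / rp))).add_const (e ^ 2)
  refine h.congr_deriv ?_
  simp
  ring

lemma continuous_gRN : Continuous (gRN L rp e) := by
  unfold gRN
  fun_prop

/-- A continuous function without zeros which is positive at the left endpoint stays positive. -/
lemma forall_pos_of_ne_zero {f : ℝ → ℝ} {a : ℝ} (hf : Continuous f) (ha : 0 < f a)
    (h : ∀ r, a ≤ r → f r ≠ 0) : ∀ r, a ≤ r → 0 < f r := by
  intro r hr
  by_contra! hn
  obtain ⟨t, ht, h0⟩ := intermediate_value_Icc' hr hf.continuousOn ⟨hn, ha.le⟩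
  exact h t ht.1 h0

namespace IsRadialSol

lemma continuous_flux (h : IsRadialSol L α c rp e u w) :
    Continuous fun s => (s - rp) * gRN L rp e s * w s := by
  have := h.contw
  have := continuous_gRN (L := L) (rp := rp) (e := e)
  fun_prop

lemma hasDerivAt_mul_flux (h : IsRadialSol L α c rp e u w) {r m' : ℝ} {m : ℝ → ℝ} (hr : rp < r)
    (hg : 0 < gRN L rp e r) (hm : HasDerivAt m m' r) :
    HasDerivAt (fun s => u s * ((s - rp) * gRN L rp e s * w s - m s * u s))
      ((potV L α c rp e r - m' - m r ^ 2 / ((r - rp) * gRN L rp e r)) * u r ^ 2 +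
        ((r - rp) * gRN L rp e r * w r - m r * u r) ^ 2 / ((r - rp) * gRN L rp e r)) r := by
  have h1 := (h.du r hr).mul ((h.dp r hr).sub (hm.mul (h.du r hr)))
  refine h1.congr_deriv ?_
  have : 0 < r - rp := by linarith
  simp only [Pi.mul_apply, Pi.sub_apply]
  field_simp
  ring

lemma pos_near (h : IsRadialSol L α c rp e u w) : ∃ δ > 0, ∀ r ∈ Icc rp (rp + δ), 0 < u r := by
  have h1 : ∀ᶠ r in 𝓝 rp, 0 < u r :=
    h.contu.continuousAt.eventually (lt_mem_nhds (by rw [h.u_horizon]; exact one_pos))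
  obtain ⟨δ, hδ, hd⟩ := Metric.eventually_nhds_iff.1 h1
  refine ⟨δ / 2, by linarith, fun r hr => hd ?_⟩
  rw [Real.dist_eq, abs_lt]
  constructor <;> linarith [hr.1, hr.2]

/-- A solution which stays nonnegative is positive and strictly decreasing. -/
lemma pos_of_nonneg (h : IsRadialSol L α c rp e u w)
    (hL : 0 < L) (hα : α < 0) (hc : 0 ≤ c) (hrp : 0 < rp)
    (he : e ^ 2 < rp ^ 2 + 3 * L * rp ^ 4) (h0 : ∀ r, rp ≤ r → 0 ≤ u r) :
    (∀ r, rp < r → w r < 0) ∧ ∀ r, rp ≤ r → 0 < u r := by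
  have hw : ∀ r, rp < r → w r < 0 := by
    intro r hr
    obtain ⟨δ, hδ, hd⟩ := h.pos_near
    have ha : AntitoneOn (fun s => (s - rp) * gRN L rp e s * w s) (Ici rp) := by
      apply antitoneOn_of_hasDerivWithinAt_nonpos (convex_Ici rp) h.continuous_flux.continuousOn
        (f' := fun r => potV L α c rp e r * u r)
      · intro x hx
        rw [interior_Ici] at hx
        exact (h.dp x hx).hasDerivWithinAt
      · intro x hx
        rw [interior_Ici] at hx
        exact mul_nonpos_of_nonpos_of_nonneg (potV_neg hL hα hc hrp he (le_of_lt hx)).le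
          (h0 x (le_of_lt hx))
    have hs : StrictAntiOn (fun s => (s - rp) * gRN L rp e s * w s) (Icc rp (rp + δ)) := by
      apply strictAntiOn_of_hasDerivWithinAt_neg (convex_Icc _ _) h.continuous_flux.continuousOn
        (f' := fun r => potV L α c rp e r * u r)
      · intro x hx
        rw [interior_Icc] at hx
        exact (h.dp x hx.1).hasDerivWithinAt
      · intro x hx
        rw [interior_Icc] at hx
        exact mul_neg_of_neg_of_pos (potV_neg hL hα hc hrp he hx.1.le) (hd x (Ioo_subset_Icc_self
          hx))
    set t := min r (rp + δ)
    have ht : rp < t := lt_min hr (by linarith)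
    have h1 := hs (left_mem_Icc.2 (by linarith)) ⟨ht.le, min_le_right _ _⟩ ht
    have h2 := ha ht.le hr.le (min_le_left _ _)
    simp only [sub_self, zero_mul] at h1 h2
    have h3 : (r - rp) * gRN L rp e r * w r < 0 := h2.trans_lt h1
    have h4 : 0 < (r - rp) * gRN L rp e r :=
      mul_pos (by linarith) (gRN_pos hL hrp he hr.le)
    exact (pos_iff_neg_of_mul_neg h3).1 h4
  refine ⟨hw, fun r hr => ?_⟩
  have hs : StrictAntiOn u (Ici rp) := by
    apply strictAntiOn_of_hasDerivWithinAt_neg (convex_Ici _) h.contu.continuousOn (f' := w)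
    · intro x hx
      rw [interior_Ici] at hx
      exact (h.du x hx).hasDerivWithinAt
    · intro x hx
      rw [interior_Ici] at hx
      exact hw x hx
  have := hs hr (show rp ≤ r + 1 by linarith) (by linarith)
  exact (h0 _ (by linarith)).trans_lt this

lemma neutral_pos (h : IsRadialSol L α c rp 0 u w)
    (hL : 0 < L) (hα : -9 / 4 < α) (hrp : 0 < rp) :
    ∀ r, rp < r → 0 < u r ∧ 0 < r * w r + 3 / 2 * u r := by
  have he : (0:ℝ) ^ 2 < rp ^ 2 + 3 * L * rp ^ 4 := by
    rw [zero_pow two_ne_zero]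
    positivity
  set m : ℝ → ℝ := fun r => -(3 / 2 * L * (r ^ 3 - rp ^ 3)) with hm
  have hm' : ∀ r, HasDerivAt m (-(9 / 2 * L * r ^ 2)) r := by
    intro r
    have := (((hasDerivAt_pow 3 r).sub_const (rp ^ 3)).const_mul (3 / 2 * L)).neg
    refine this.congr_deriv ?_
    push_cast
    ring
  have hpe : ∀ r, (r - rp) * gRN L rp 0 r = L * r * (r ^ 3 - rp ^ 3) + r * (r - rp) := by
    intro r
    unfold gRN
    ring
  have hcube : ∀ r, rp < r → 0 < r ^ 3 - rp ^ 3 := fun r hr => by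
    have : rp ^ 3 < r ^ 3 := pow_lt_pow_left₀ hr hrp.le (by norm_num)
    linarith
  have hcoef : ∀ r, rp < r → 0 <
      potV L α c rp 0 r - -(9 / 2 * L * r ^ 2) - m r ^ 2 / ((r - rp) * gRN L rp 0 r) := by
    intro r hr
    have hr0 : 0 < r := hrp.trans hr
    have h3 := hcube r hr
    have hV : potV L α c rp 0 r = L * α * r ^ 2 := by simp [potV]
    have h4 : m r ^ 2 / ((r - rp) * gRN L rp 0 r) ≤ 9 / 4 * L * r ^ 2 := by
      have hp : 0 < (r - rp) * gRN L rp 0 r :=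
        mul_pos (by linarith) (gRN_pos hL hrp he hr.le)
      rw [div_le_iff₀ hp, hpe]
      have h5 : 0 ≤ r * (r - rp) := mul_nonneg hr0.le (by linarith)
      have h6 : (r ^ 3 - rp ^ 3) ^ 2 ≤ r ^ 3 * (r ^ 3 - rp ^ 3) := by
        have : 0 < rp ^ 3 := by positivity
        nlinarith
      calc m r ^ 2 = 9 / 4 * L ^ 2 * (r ^ 3 - rp ^ 3) ^ 2 := by simp only [hm]; ring
        _ ≤ 9 / 4 * L ^ 2 * (r ^ 3 * (r ^ 3 - rp ^ 3)) := by gcongr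
        _ ≤ 9 / 4 * L * r ^ 2 * (L * r * (r ^ 3 - rp ^ 3) + r * (r - rp)) := by
          have : 0 ≤ 9 / 4 * L * r ^ 2 * (r * (r - rp)) := by positivity
          linarith
    rw [hV]
    have : 0 < L * (α + 9 / 4) * r ^ 2 := by
      have : 0 < α + 9 / 4 := by linarith
      positivity
    linarith
  set I : ℝ → ℝ := fun s => u s * ((s - rp) * gRN L rp 0 s * w s - m s * u s)
  have hIc : Continuous I := by
    have h1 := h.continuous_flux
    have h2 := h.contu
    have h3 : Continuous m := by fun_prop
    fun_prop
  have hI : ∀ r, rp < r → HasDerivAt I _ r := fun r hr =>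
    h.hasDerivAt_mul_flux hr (gRN_pos hL hrp he hr.le) (hm' r)
  have hIpos : ∀ r, rp < r → 0 < I r := by
    intro r hr
    obtain ⟨δ, hδ, hd⟩ := h.pos_near
    have hp : ∀ r, rp < r → 0 < (r - rp) * gRN L rp 0 r := fun r hr =>
      mul_pos (by linarith) (gRN_pos hL hrp he hr.le)
    have ha : MonotoneOn I (Ici rp) := by
      apply monotoneOn_of_deriv_nonneg (convex_Ici rp) hIc.continuousOn
      · intro x hx
        rw [interior_Ici] at hx
        exact (hI x hx).differentiableAt.differentiableWithinAt
      · intro x hx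
        rw [interior_Ici] at hx
        rw [(hI x hx).deriv]
        have h1 := hcoef x hx
        have h2 := hp x hx
        positivity
    have hs : StrictMonoOn I (Icc rp (rp + δ)) := by
      apply strictMonoOn_of_deriv_pos (convex_Icc _ _) hIc.continuousOn
      intro x hx
      rw [interior_Icc] at hx
      rw [(hI x hx.1).deriv]
      have h1 := hcoef x hx.1
      have h2 := hp x hx.1
      have h3 := hd x (Ioo_subset_Icc_self hx)
      have h4 := mul_pos h1 (pow_pos h3 2)
      have h5 : 0 ≤ ((x - rp) * gRN L rp 0 x * w x - m x * u x) ^ 2 / ((x - rp) * gRN L rp 0 x) :=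
        by
        positivity
      linarith
    set t := min r (rp + δ)
    have ht : rp < t := lt_min hr (by linarith)
    have h1 := hs (left_mem_Icc.2 (by linarith)) ⟨ht.le, min_le_right _ _⟩ ht
    have h2 := ha ht.le hr.le (min_le_left _ _)
    have h0 : I rp = 0 := by simp [I, hm]
    linarith
  have hu : ∀ r, rp ≤ r → 0 < u r := by
    apply forall_pos_of_ne_zero h.contu (by rw [h.u_horizon]; exact one_pos)
    intro r hr h0
    rcases hr.eq_or_lt with rfl | hr
    · rw [h.u_horizon] at h0
      exact one_ne_zero h0
    · have := hIpos r hr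
      simp [I, h0] at this
  intro r hr
  have hr0 : 0 < r := hrp.trans hr
  have hur := hu r hr.le
  refine ⟨hur, ?_⟩
  have h1 := pos_of_mul_pos_right (hIpos r hr) hur.le
  have hp : 0 < (r - rp) * gRN L rp 0 r := mul_pos (by linarith) (gRN_pos hL hrp he hr.le)
  have h2 : L * r * (r ^ 3 - rp ^ 3) ≤ (r - rp) * gRN L rp 0 r := by
    rw [hpe]
    have := mul_nonneg hr0.le (sub_nonneg.2 hr.le)
    linarith
  have h3 : 0 < (r - rp) * gRN L rp 0 r * (r * w r + 3 / 2 * u r) := by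
    have h4 := mul_pos hr0 h1
    have h5 := mul_le_mul_of_nonneg_right h2 (by positivity : 0 ≤ 3 / 2 * u r)
    simp only [hm] at h4
    linarith
  exact pos_of_mul_pos_right h3 hp.le

end IsRadialSol

/-- A radius beyond which a radial solution decaying slower than `r ^ (-3 / 2)` is trapped. -/
lemma exists_trapping_radius (hL : 0 < L) (hα : -9 / 4 < α) (hc : 0 ≤ c) (hrp : 0 < rp) :
    ∃ R, rp < R ∧ ∀ e u w, e ^ 2 < rp ^ 2 + 3 * L * rp ^ 4 → IsRadialSol L α c rp e u w →
      ∀ r1, R ≤ r1 → 0 < u r1 → 0 < r1 * w r1 + 3 / 2 * u r1 → ∀ r, r1 ≤ r → 0 < u r := by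
  set E := rp ^ 2 + 3 * L * rp ^ 4 with hE
  have hEp : 0 < E := by positivity
  set B := 3 / 4 + 15 / 4 * E / rp ^ 2 + c * E / (L * rp ^ 2)
  have hB : 0 < B := by positivity
  have hα' : 0 < α + 9 / 4 := by linarith
  refine ⟨max (rp + 1) (max 1 (B / (L * (α + 9 / 4)))), by
    exact lt_max_of_lt_left (by linarith), ?_⟩
  intro e u w he h r1 hr1 hu1 hw1
  have hb1 : rp + 1 ≤ r1 := (le_max_left _ _).trans hr1
  have hb2 : 1 ≤ r1 := ((le_max_left _ _).trans (le_max_right _ _)).trans hr1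
  have hb3 : B / (L * (α + 9 / 4)) ≤ r1 := ((le_max_right _ _).trans (le_max_right _ _)).trans hr1
  have hg : ∀ r, rp ≤ r → 0 < gRN L rp e r := fun r hr => gRN_pos hL hrp he hr
  set m : ℝ → ℝ := fun r => -(3 / 2 * ((r - rp) * gRN L rp e r / r)) with hm
  have hm' : ∀ r, 0 < r → HasDerivAt m (-(3 / 2 *
      (((4 * L * r ^ 3 + 2 * r - (L * rp ^ 3 + rp + e ^ 2 / rp)) * r -
        (r - rp) * gRN L rp e r * 1) / r ^ 2))) r := fun r hr =>
    (((hasDerivAt_mul_gRN hrp).div (hasDerivAt_id r) hr.ne').const_mul (3 / 2)).neg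
  have hcoef : ∀ r, r1 ≤ r → 0 ≤ potV L α c rp e r - -(3 / 2 *
      (((4 * L * r ^ 3 + 2 * r - (L * rp ^ 3 + rp + e ^ 2 / rp)) * r -
        (r - rp) * gRN L rp e r * 1) / r ^ 2)) - m r ^ 2 / ((r - rp) * gRN L rp e r) := by
    intro r hr
    have hr0 : 0 < r := by linarith
    have hrr : rp < r := by linarith
    have hx : 0 < r - rp := by linarith
    have hgr := hg r hrr.le
    have h1 : (r - rp) * r ^ 2 / gRN L rp e r ≤ 1 / L := by
      rw [div_le_div_iff₀ hgr hL]
      have := gRN_ge hL hrp he hrr.le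
      linarith
    have h2 : c * e ^ 2 * (r - rp) * r ^ 2 / (rp ^ 2 * gRN L rp e r) ≤ c * E / (L * rp ^ 2) := by
      calc _ = c * e ^ 2 / rp ^ 2 * ((r - rp) * r ^ 2 / gRN L rp e r) := by field_simp
        _ ≤ c * E / rp ^ 2 * (1 / L) := by gcongr
        _ = _ := by field_simp
    have h3 : e ^ 2 / r ^ 2 ≤ E / rp ^ 2 := by gcongr
    have h4 : B ≤ L * (α + 9 / 4) * r ^ 2 := by
      rw [div_le_iff₀ (by positivity)] at hb3
      have : r1 ≤ r ^ 2 := by nlinarith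
      calc B ≤ r1 * (L * (α + 9 / 4)) := hb3
        _ ≤ r ^ 2 * (L * (α + 9 / 4)) := by gcongr
        _ = _ := by ring
    have h5 : 0 ≤ 9 / 4 * (L * rp ^ 3 + rp + e ^ 2 / rp) / r := by positivity
    have hp : 0 < (r - rp) * gRN L rp e r := by positivity
    have h6 : m r ^ 2 / ((r - rp) * gRN L rp e r) = 9 / 4 * ((r - rp) * gRN L rp e r) / r ^ 2 := by
      simp only [hm]
      generalize (r - rp) * gRN L rp e r = p at hp
      field_simp
      ring
    have h7 : (r - rp) * gRN L rp e r =
        L * r ^ 4 + r ^ 2 - (L * rp ^ 3 + rp + e ^ 2 / rp) * r + e ^ 2 := by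
      unfold gRN
      field_simp
      ring
    rw [h6, h7]
    generalize (L * rp ^ 3 + rp + e ^ 2 / rp) = M2 at *
    have h8 : L * α * r ^ 2 - c * e ^ 2 * (r - rp) * r ^ 2 / (rp ^ 2 * gRN L rp e r) - -(3 / 2 *
      (((4 * L * r ^ 3 + 2 * r - M2) * r -
        (L * r ^ 4 + r ^ 2 - M2 * r + e ^ 2) * 1) / r ^ 2)) -
          9 / 4 * (L * r ^ 4 + r ^ 2 - M2 * r + e ^ 2) / r ^ 2 =
        L * (α + 9 / 4) * r ^ 2 - 3 / 4 - 15 / 4 * (e ^ 2 / r ^ 2) + 9 / 4 * M2 / r -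
        c * e ^ 2 * (r - rp) * r ^ 2 / (rp ^ 2 * gRN L rp e r) := by
      generalize c * e ^ 2 * (r - rp) * r ^ 2 / (rp ^ 2 * gRN L rp e r) = Z
      field_simp
      ring
    unfold potV
    rw [h8]
    simp only [B] at h4
    have h9 : 15 / 4 * E / rp ^ 2 = 15 / 4 * (E / rp ^ 2) := by ring
    linarith
  set I : ℝ → ℝ := fun s => u s * ((s - rp) * gRN L rp e s * w s - m s * u s)
  have hI : ∀ r, r1 ≤ r → HasDerivAt I _ r := fun r hr =>
    h.hasDerivAt_mul_flux (by linarith) (hg r (by linarith)) (hm' r (by linarith))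
  have ha : MonotoneOn I (Ici r1) := by
    apply monotoneOn_of_deriv_nonneg (convex_Ici r1)
    · intro x hx
      exact (hI x hx).continuousAt.continuousWithinAt
    · intro x hx
      rw [interior_Ici] at hx
      exact (hI x (le_of_lt hx)).differentiableAt.differentiableWithinAt
    · intro x hx
      rw [interior_Ici] at hx
      have hx' : r1 ≤ x := le_of_lt hx
      rw [(hI x hx').deriv]
      have h1 := hcoef x hx'
      have h2 : 0 < (x - rp) * gRN L rp e x := mul_pos (by linarith) (hg x (by linarith))
      positivity
  have hr10 : 0 < r1 := by linarith
  have hI1 : 0 < I r1 := by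
    have h2 : 0 < (r1 - rp) * gRN L rp e r1 := mul_pos (by linarith) (hg r1 (by linarith))
    have : I r1 = u r1 * ((r1 - rp) * gRN L rp e r1 / r1 * (r1 * w r1 + 3 / 2 * u r1)) := by
      simp only [I, hm]
      field_simp
      ring
    rw [this]
    positivity
  apply forall_pos_of_ne_zero h.contu hu1
  intro r hr h0
  have := ha self_mem_Ici hr hr
  simp only [I, h0, zero_mul] at this
  linarith

end

section

variable {L α c rp e : ℝ} {u w : ℝ → ℝ}

/-- Near extremality the near-horizon region forces solutions to oscillate. -/
lemma IsRadialSol.exists_neg (h : IsRadialSol L α c rp e u w)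
    (hL : 0 < L) (hα : α < 0) (hc : 0 ≤ c) (hrp : 0 < rp)
    (he : e ^ 2 < rp ^ 2 + 3 * L * rp ^ 4) {ν x0 x1 Γ : ℝ} (hν : 0 < ν) (hx0 : 0 < x0)
    (hx1 : x1 = x0 * exp (-(π / ν)))
    (hΓ : (rp ^ 2 + 3 * L * rp ^ 4 - e ^ 2) / rp / x1 +
      (L * ((rp + x0) ^ 2 + 2 * (rp + x0) * rp + 3 * rp ^ 2) + 1) ≤ Γ)
    (hneg : L * α * rp ^ 2 - c * e ^ 2 / Γ + Γ * (1 / 4 + ν ^ 2) < 0) :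
    ∃ r, rp < r ∧ u r < 0 := by
  by_contra! hcon
  have h0 : ∀ r, rp ≤ r → 0 ≤ u r := by
    intro r hr
    rcases hr.eq_or_lt with rfl | hr
    · rw [h.u_horizon]; exact zero_le_one
    · exact hcon r hr
  obtain ⟨-, hu⟩ := h.pos_of_nonneg hL hα hc hrp he h0
  have hd : 0 < (rp ^ 2 + 3 * L * rp ^ 4 - e ^ 2) / rp := div_pos (by linarith) hrp
  have hx1p : 0 < x1 := by rw [hx1]; positivity
  have hx10 : x1 < x0 := by
    rw [hx1]
    apply mul_lt_of_lt_one_right hx0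
    rw [exp_lt_one_iff]
    have : 0 < π / ν := by positivity
    linarith
  have hΓp : 0 < Γ := by
    refine lt_of_lt_of_le ?_ hΓ
    positivity
  have hgΓ : ∀ r, x1 ≤ r - rp → r - rp ≤ x0 → gRN L rp e r ≤ Γ * (r - rp) := by
    intro r h1 h2
    have hx : 0 < r - rp := by linarith
    have hr : 0 < r := by linarith
    rw [gRN_eq hrp]
    generalize (rp ^ 2 + 3 * L * rp ^ 4 - e ^ 2) / rp = d at *
    have h3 : d ≤ d / x1 * (r - rp) := by
      rw [div_mul_eq_mul_div, le_div_iff₀ hx1p]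
      gcongr
    have h4 : L * (r ^ 2 + 2 * r * rp + 3 * rp ^ 2) + 1 ≤
        L * ((rp + x0) ^ 2 + 2 * (rp + x0) * rp + 3 * rp ^ 2) + 1 := by
      have : r ≤ rp + x0 := by linarith
      gcongr
    calc _ ≤ d / x1 * (r - rp) + (r - rp) *
          (L * ((rp + x0) ^ 2 + 2 * (rp + x0) * rp + 3 * rp ^ 2) + 1) := by gcongr
      _ = (d / x1 + (L * ((rp + x0) ^ 2 + 2 * (rp + x0) * rp + 3 * rp ^ 2) + 1)) * (r - rp) := by
        ring
      _ ≤ _ := by gcongr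
  set z : ℝ → ℝ := fun r => (r - rp) * gRN L rp e r * w r / (u r * (Γ * (r - rp))) with hz
  have hz' : ∀ r, rp < r → HasDerivAt z ((potV L α c rp e r * u r * (u r * (Γ * (r - rp))) -
      (r - rp) * gRN L rp e r * w r * (w r * (Γ * (r - rp)) + u r * (Γ * 1))) /
      (u r * (Γ * (r - rp))) ^ 2) r := by
    intro r hr
    have hx : 0 < r - rp := by linarith
    have hur := hu r hr.le
    exact (h.dp r hr).div ((h.du r hr).mul (((hasDerivAt_id r).sub_const rp).const_mul Γ))
      (by positivity)
  have hzle : ∀ r, x1 ≤ r - rp → r - rp ≤ x0 →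
      (potV L α c rp e r * u r * (u r * (Γ * (r - rp))) -
      (r - rp) * gRN L rp e r * w r * (w r * (Γ * (r - rp)) + u r * (Γ * 1))) /
      (u r * (Γ * (r - rp))) ^ 2 ≤ -(((z r + 1 / 2) ^ 2 + ν ^ 2) / (r - rp)) := by
    intro r h1 h2
    have hx : 0 < r - rp := by linarith
    have hr : rp < r := by linarith
    have hur := hu r hr.le
    have hgp := gRN_pos hL hrp he hr.le
    have hgle := hgΓ r h1 h2
    have e1 : (potV L α c rp e r * u r * (u r * (Γ * (r - rp))) -
      (r - rp) * gRN L rp e r * w r * (w r * (Γ * (r - rp)) + u r * (Γ * 1))) /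
      (u r * (Γ * (r - rp))) ^ 2 =
        (potV L α c rp e r / Γ - z r ^ 2 * (Γ * (r - rp) / gRN L rp e r) - z r) / (r - rp) := by
      simp only [hz]
      field_simp
      ring
    have e2 : z r ^ 2 ≤ z r ^ 2 * (Γ * (r - rp) / gRN L rp e r) := by
      apply le_mul_of_one_le_right (sq_nonneg _)
      rwa [one_le_div hgp]
    have e3 : potV L α c rp e r ≤ L * α * rp ^ 2 - c * e ^ 2 / Γ := by
      have a1 : L * α * r ^ 2 ≤ L * α * rp ^ 2 := by
        have : rp ^ 2 ≤ r ^ 2 := by gcongr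
        have : L * α < 0 := mul_neg_of_pos_of_neg hL hα
        nlinarith
      have a2 : c * e ^ 2 / Γ ≤ c * e ^ 2 * (r - rp) * r ^ 2 / (rp ^ 2 * gRN L rp e r) := by
        have b1 : 1 / Γ ≤ (r - rp) / gRN L rp e r := by
          rw [div_le_div_iff₀ hΓp hgp]
          linarith
        have b2 : 1 ≤ r ^ 2 / rp ^ 2 := by
          rw [one_le_div (by positivity)]
          gcongr
        calc c * e ^ 2 / Γ = c * e ^ 2 * (1 / Γ) * 1 := by ring
          _ ≤ c * e ^ 2 * ((r - rp) / gRN L rp e r) * (r ^ 2 / rp ^ 2) := by gcongr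
          _ = _ := by field_simp
      unfold potV
      linarith
    have e4 : potV L α c rp e r / Γ ≤ -(1 / 4 + ν ^ 2) := by
      rw [div_le_iff₀ hΓp]
      linarith
    rw [e1, ← neg_div]
    gcongr
    linarith
  set Θ : ℝ → ℝ := fun r => arctan ((z r + 1 / 2) / ν) + ν * Real.log (r - rp)
  have hΘ : ∀ r, rp < r → HasDerivAt Θ (1 / (1 + ((z r + 1 / 2) / ν) ^ 2) *
      (((potV L α c rp e r * u r * (u r * (Γ * (r - rp))) -
      (r - rp) * gRN L rp e r * w r * (w r * (Γ * (r - rp)) + u r * (Γ * 1))) /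
      (u r * (Γ * (r - rp))) ^ 2) / ν) + ν * (1 / (r - rp))) r := by
    intro r hr
    have hx : r - rp ≠ 0 := by linarith
    exact ((((hz' r hr).add_const (1 / 2)).div_const ν).arctan).add
      ((((hasDerivAt_id r).sub_const rp).log hx).const_mul ν)
  have hanti : AntitoneOn Θ (Icc (rp + x1) (rp + x0)) := by
    apply antitoneOn_of_deriv_nonpos (convex_Icc _ _)
    · intro r hr
      exact (hΘ r (by linarith [hr.1])).continuousAt.continuousWithinAt
    · intro r hr
      rw [interior_Icc] at hr
      exact (hΘ r (by linarith [hr.1])).differentiableAt.differentiableWithinAt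
    · intro r hr
      rw [interior_Icc] at hr
      rw [(hΘ r (by linarith [hr.1])).deriv]
      have hx : 0 < r - rp := by linarith [hr.1]
      have h1 := hzle r (by linarith [hr.1]) (by linarith [hr.2])
      refine (add_le_add_left (mul_le_mul_of_nonneg_left
        (div_le_div_of_nonneg_right h1 hν.le) (by positivity)) _).trans (le_of_eq ?_)
      field_simp
      ring
  have h2 := hanti (left_mem_Icc.2 (by linarith)) (right_mem_Icc.2 (by linarith)) (by linarith)
  simp only [Θ, add_sub_cancel_left] at h2
  have h3 : Real.log x1 = Real.log x0 - π / ν := by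
    rw [hx1, Real.log_mul hx0.ne' (exp_ne_zero _), Real.log_exp]
    ring
  rw [h3] at h2
  have h4 : ν * (Real.log x0 - π / ν) = ν * Real.log x0 - π := by field_simp
  rw [h4] at h2
  have h5 := arctan_lt_pi_div_two ((z (rp + x1) + 1 / 2) / ν)
  have h6 := neg_pi_div_two_lt_arctan ((z (rp + x0) + 1 / 2) / ν)
  linarith

lemma exists_charge_oscillating (hL : 0 < L) (hc : 0 ≤ c) (hrp : 0 < rp)
    (hH : L * α * rp ^ 2 - c * (rp ^ 2 + 3 * L * rp ^ 4) / (6 * L * rp ^ 2 + 1) +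
      (6 * L * rp ^ 2 + 1) / 4 < 0) :
    ∃ e ν x0 Γ : ℝ, 0 < e ∧ e ^ 2 < rp ^ 2 + 3 * L * rp ^ 4 ∧ 0 < ν ∧ 0 < x0 ∧
      (rp ^ 2 + 3 * L * rp ^ 4 - e ^ 2) / rp / (x0 * exp (-(π / ν))) +
        (L * ((rp + x0) ^ 2 + 2 * (rp + x0) * rp + 3 * rp ^ 2) + 1) ≤ Γ ∧
      L * α * rp ^ 2 - c * e ^ 2 / Γ + Γ * (1 / 4 + ν ^ 2) < 0 := by
  set E := rp ^ 2 + 3 * L * rp ^ 4 with hE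
  have hEp : 0 < E := by positivity
  set G := 6 * L * rp ^ 2 + 1 with hG
  have hGp : 0 < G := by positivity
  have hcont : ContinuousAt (fun t : ℝ => L * α * rp ^ 2 - c * (E - t) / (G + t) +
      (G + t) * (1 / 4 + t ^ 2)) 0 := by
    have : G + 0 ≠ 0 := by simpa using hGp.ne'
    fun_prop (disch := assumption)
  have hev : ∀ᶠ t in 𝓝 (0:ℝ), L * α * rp ^ 2 - c * (E - t) / (G + t) +
      (G + t) * (1 / 4 + t ^ 2) < 0 := by
    apply hcont.eventually_lt continuousAt_const
    simp only [sub_zero, add_zero]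
    nlinarith
  have hev2 : ∀ᶠ t in 𝓝 (0:ℝ), t < E := gt_mem_nhds hEp
  obtain ⟨t, ⟨ht1, htE⟩, ht0⟩ := (((hev.and hev2).filter_mono nhdsWithin_le_nhds).and
    (self_mem_nhdsWithin : Ioi (0:ℝ) ∈ 𝓝[>] 0)).exists
  have ht0 : 0 < t := ht0
  have hcont2 : ContinuousAt (fun x0 : ℝ =>
      L * ((rp + x0) ^ 2 + 2 * (rp + x0) * rp + 3 * rp ^ 2) + 1) 0 := by fun_prop
  have hev3 : ∀ᶠ x0 in 𝓝 (0:ℝ),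
      L * ((rp + x0) ^ 2 + 2 * (rp + x0) * rp + 3 * rp ^ 2) + 1 < G + t := by
    apply hcont2.eventually_lt continuousAt_const
    simp only [hG, add_zero]
    nlinarith
  obtain ⟨x0, hx, hx0⟩ := ((hev3.filter_mono nhdsWithin_le_nhds).and
    (self_mem_nhdsWithin : Ioi (0:ℝ) ∈ 𝓝[>] 0)).exists
  have hx0 : 0 < x0 := hx0
  set x1 := x0 * exp (-(π / t)) with hx1
  have hx1p : 0 < x1 := by positivity
  set d := min t (rp * (x1 * (G + t -
    (L * ((rp + x0) ^ 2 + 2 * (rp + x0) * rp + 3 * rp ^ 2) + 1)))) with hd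
  have hdp : 0 < d := by
    apply lt_min ht0
    have : 0 < G + t - (L * ((rp + x0) ^ 2 + 2 * (rp + x0) * rp + 3 * rp ^ 2) + 1) := by linarith
    positivity
  have hdt : d ≤ t := min_le_left _ _
  have hsq : √(E - d) ^ 2 = E - d := Real.sq_sqrt (by linarith)
  refine ⟨√(E - d), t, x0, G + t, Real.sqrt_pos.2 (by linarith), by rw [hsq]; linarith, ht0, hx0,
    ?_, ?_⟩
  · rw [hsq]
    have h1 : (E - (E - d)) / rp / x1 ≤
        G + t - (L * ((rp + x0) ^ 2 + 2 * (rp + x0) * rp + 3 * rp ^ 2) + 1) := by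
      rw [sub_sub_cancel, div_div, div_le_iff₀ (by positivity)]
      have := min_le_right t (rp * (x1 * (G + t -
        (L * ((rp + x0) ^ 2 + 2 * (rp + x0) * rp + 3 * rp ^ 2) + 1))))
      rw [← hd] at this
      linarith
    linarith
  · rw [hsq]
    have : c * (E - t) / (G + t) ≤ c * (E - d) / (G + t) := by gcongr
    linarith

/-- For some charge the linear equation has a positive solution with fast decay. -/
theorem exists_linear_hair (hL : 0 < L) (hα1 : -9 / 4 < α) (hα : α < 0) (hc : 0 ≤ c)
    (hrp : 0 < rp)
    (hH : L * α * rp ^ 2 - c * (rp ^ 2 + 3 * L * rp ^ 4) / (6 * L * rp ^ 2 + 1) +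
      (6 * L * rp ^ 2 + 1) / 4 < 0) :
    ∃ e, 0 < e ∧ e ^ 2 < rp ^ 2 + 3 * L * rp ^ 4 ∧ ∃ u w : ℝ → ℝ, IsRadialSol L α c rp e u w ∧
      (∀ r, rp < r → w r < 0) ∧ (∀ r, rp ≤ r → 0 < u r) ∧
      ∃ R, rp < R ∧ ∀ r, R ≤ r → r * w r + 3 / 2 * u r ≤ 0 := by
  obtain ⟨e1, ν, x0, Γ, he1p, he1, hν, hx0, hΓ, hneg⟩ := exists_charge_oscillating hL hc hrp hH
  obtain ⟨u, w, hu, hw, hsol⟩ := exists_radial_family (α := α) hL hc hrp he1p.le he1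
  obtain ⟨R, hR, htrap⟩ := exists_trapping_radius hL hα1 hc hrp
  have hsq : ∀ e ∈ Icc 0 e1, e ^ 2 < rp ^ 2 + 3 * L * rp ^ 4 := fun e he => by
    nlinarith [he.1, he.2]
  set S : Set ℝ := {e | ∃ r1, R < r1 ∧ (∀ r ∈ Icc rp r1, 0 < u e r) ∧
    0 < r1 * w e r1 + 3 / 2 * u e r1}
  set T : Set ℝ := {e | ∃ r, rp < r ∧ u e r < 0}
  have hSo : IsOpen S := by
    rw [isOpen_iff_mem_nhds]
    rintro e ⟨r1, hr1, h1, h2⟩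
    have ev1 : ∀ᶠ e' in 𝓝 e, ∀ r ∈ Icc rp r1, 0 < u e' r := by
      apply isCompact_Icc.eventually_forall_of_forall_eventually
      intro r hr
      exact hu.continuousAt.eventually (lt_mem_nhds (h1 r hr))
    have hcw : Continuous fun e' => r1 * w e' r1 + 3 / 2 * u e' r1 := by
      have a1 : Continuous fun e' => w e' r1 :=
        hw.comp (by fun_prop : Continuous fun e' : ℝ => (e', r1))
      have a2 : Continuous fun e' => u e' r1 :=
        hu.comp (by fun_prop : Continuous fun e' : ℝ => (e', r1))
      fun_prop
    have ev2 := hcw.continuousAt.eventually (lt_mem_nhds h2)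
    filter_upwards [ev1, ev2] with e' g1 g2
    exact ⟨r1, hr1, g1, g2⟩
  have hTo : IsOpen T := by
    rw [isOpen_iff_mem_nhds]
    rintro e ⟨r, hr, h1⟩
    have a2 : Continuous fun e' => u e' r :=
      hu.comp (by fun_prop : Continuous fun e' : ℝ => (e', r))
    filter_upwards [a2.continuousAt.eventually (gt_mem_nhds h1)] with e' g
    exact ⟨r, hr, g⟩
  have h0S : (0:ℝ) ∈ S := by
    have h := (hsol 0 ⟨le_rfl, he1p.le⟩).neutral_pos hL hα1 hrp
    refine ⟨R + 1, by linarith, fun r hr => ?_, (h (R + 1) (by linarith)).2⟩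
    rcases hr.1.eq_or_lt with h' | h'
    · rw [← h', (hsol 0 ⟨le_rfl, he1p.le⟩).u_horizon]
      exact one_pos
    · exact (h r h').1
  have h1T : e1 ∈ T := (hsol e1 ⟨he1p.le, le_rfl⟩).exists_neg hL hα hc hrp he1 hν hx0 rfl hΓ hneg
  have hdisj : ∀ e ∈ Icc 0 e1, e ∈ S → e ∈ T → False := by
    rintro e he ⟨r1, hr1, h1, h2⟩ ⟨r, hr, h3⟩
    rcases le_total r r1 with h | h
    · exact absurd (h1 r ⟨hr.le, h⟩) (not_lt.2 h3.le)
    · exact absurd (htrap e _ _ (hsq e he) (hsol e he) r1 hr1.le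
        (h1 r1 ⟨by linarith, le_rfl⟩) h2 r h) (not_lt.2 h3.le)
  obtain ⟨e, he, heST⟩ : ∃ e ∈ Icc 0 e1, e ∉ S ∪ T := by
    by_contra! hcon
    obtain ⟨e, he, h1, h2⟩ := isPreconnected_Icc S T hSo hTo hcon
      ⟨0, ⟨le_rfl, he1p.le⟩, h0S⟩ ⟨e1, ⟨he1p.le, le_rfl⟩, h1T⟩
    exact hdisj e he h1 h2
  have heS : e ∉ S := fun h => heST (Or.inl h)
  have heT : e ∉ T := fun h => heST (Or.inr h)
  have hnn : ∀ r, rp ≤ r → 0 ≤ u e r := by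
    intro r hr
    rcases hr.eq_or_lt with rfl | hr
    · rw [(hsol e he).u_horizon]; exact zero_le_one
    · by_contra! hlt
      exact heT ⟨r, hr, hlt⟩
  obtain ⟨hwneg, hpos⟩ := (hsol e he).pos_of_nonneg hL hα hc hrp (hsq e he) hnn
  refine ⟨e, lt_of_le_of_ne he.1 ?_, hsq e he, u e, w e, hsol e he, hwneg, hpos, R + 1,
    by linarith, fun r hr => ?_⟩
  · rintro rfl
    exact heS h0S
  · by_contra! hlt
    exact heS ⟨r, by linarith, fun t ht => hpos t ht.1, hlt⟩

end

/-- Violation of the near-horizon Breitenlohner–Freedman bound at extremality. -/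
lemma near_horizon_bound {L c rp α a R0 : ℝ} (hL : 0 < L)
    (hα : α < -3 / 2 + c / (2 * L)) (hrp : 0 < rp)
    (ha : a = α + 3 / 2 - c / (2 * L)) (hR0 : 0 < R0)
    (hroot : 24 * a * R0 ^ 2 + (4 * a - 2 * c / L + 6) * R0 + 1 = 0) (hlarge : R0 < L * rp ^ 2) :
    L * α * rp ^ 2 - c * (rp ^ 2 + 3 * L * rp ^ 4) / (6 * L * rp ^ 2 + 1) +
      (6 * L * rp ^ 2 + 1) / 4 < 0 := by
  have ha0 : a < 0 := by linarith
  set X := L * rp ^ 2 with hX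
  have hf : 24 * a * X ^ 2 + (4 * a - 2 * c / L + 6) * X + 1 < 0 := by
    have h1 : R0 * (24 * a * X ^ 2 + (4 * a - 2 * c / L + 6) * X + 1) =
        (X - R0) * (24 * X * a * R0 - 1) := by
      linear_combination X * hroot
    have h2 : (X - R0) * (24 * X * a * R0 - 1) < 0 := by
      apply mul_neg_of_pos_of_neg (by linarith)
      have : 0 < X * R0 := mul_pos (by linarith) hR0
      nlinarith
    rw [← h1] at h2
    exact (pos_iff_neg_of_mul_neg h2).1 hR0
  have hX0 : 0 < X := by linarith
  have hG : 0 < 6 * X + 1 := by linarith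
  have e1 : L * α * rp ^ 2 - c * (rp ^ 2 + 3 * L * rp ^ 4) / (6 * L * rp ^ 2 + 1) +
      (6 * L * rp ^ 2 + 1) / 4 =
      (24 * a * X ^ 2 + (4 * a - 2 * c / L + 6) * X + 1) / (4 * (6 * X + 1)) := by
    have : 6 * L * rp ^ 2 + 1 = 6 * X + 1 := by rw [hX]; ring
    rw [this]
    have : c * (rp ^ 2 + 3 * L * rp ^ 4) = c / L * (X + 3 * X ^ 2) := by
      rw [hX]; field_simp
    rw [this, ha]
    have : L * α * rp ^ 2 = α * X := by rw [hX]; ring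
    rw [this]
    have : c / (2 * L) = c / L / 2 := by field_simp
    rw [this]
    field_simp
    ring
  rw [e1]
  exact div_neg_of_neg_of_pos hf (by linarith)

/-- A map which is constant in `X` for `s = 0` has fixed points for small parameters `s`. -/
lemma exists_fixedPoint_of_contDiffAt {E : Type*} [NormedAddCommGroup E] [NormedSpace ℝ E]
    [CompleteSpace E] {T : E × ℝ → E} {X0 : E} (hT : ContDiffAt ℝ 1 T (X0, 0))
    (h0 : ∀ X, T (X, 0) = X0) {N : Set (E × ℝ)} (hN : N ∈ 𝓝 (X0, (0:ℝ))) :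
    ∃ s0 > 0, ∀ s, 0 ≤ s → s < s0 → ∃ X, (X, s) ∈ N ∧ T (X, s) = X := by
  have hs := hT.hasStrictFDerivAt one_ne_zero
  set T' := fderiv ℝ T (X0, 0)
  have hT0 : ∀ v : E, T' (v, 0) = 0 := by
    intro v
    have h1 : HasFDerivAt (fun X : E => T (X, (0:ℝ)))
        (T'.comp ((ContinuousLinearMap.id ℝ E).prod 0)) X0 :=
      hs.hasFDerivAt.comp X0 ((hasFDerivAt_id X0).prodMk (hasFDerivAt_const 0 X0))
    simp only [h0] at h1
    have h2 := h1.unique (hasFDerivAt_const X0 X0)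
    simpa using congrArg (fun A : E →L[ℝ] E => A v) h2
  have hΦ : HasStrictFDerivAt (fun p : E × ℝ => (p.1 - T p, p.2))
      ((ContinuousLinearMap.fst ℝ E ℝ - T').prod (ContinuousLinearMap.snd ℝ E ℝ)) (X0, 0) :=
    (hasStrictFDerivAt_fst.sub hs).prodMk hasStrictFDerivAt_snd
  have hsurj : Function.Surjective
      ((ContinuousLinearMap.fst ℝ E ℝ - T').prod (ContinuousLinearMap.snd ℝ E ℝ)) := by
    rintro ⟨v, t⟩
    refine ⟨(v + T' (0, t), t), ?_⟩
    have : T' (v + T' (0, t), t) = T' (0, t) := by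
      have h1 : ((v + T' (0, t), t) : E × ℝ) = (v + T' (0, t), 0) + (0, t) := by simp
      conv_lhs => rw [h1]
      rw [map_add, hT0, zero_add]
    simp [this]
  have hmap := hΦ.map_nhds_eq_of_surj (LinearMap.range_eq_top.2 hsurj)
  simp only [h0, sub_self] at hmap
  have h1 : (fun p : E × ℝ => (p.1 - T p, p.2)) '' N ∈ 𝓝 ((0:E), (0:ℝ)) := by
    rw [← hmap]
    exact image_mem_map hN
  have h2 : ∀ᶠ s in 𝓝 (0:ℝ), ((0:E), s) ∈ (fun p : E × ℝ => (p.1 - T p, p.2)) '' N := by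
    have : ContinuousAt (fun s : ℝ => ((0:E), s)) 0 := by fun_prop
    exact this.eventually h1
  obtain ⟨s0, hs0, h3⟩ := Metric.eventually_nhds_iff.1 h2
  refine ⟨s0, hs0, fun s hs1 hs2 => ?_⟩
  obtain ⟨⟨X, s'⟩, hX, hXe⟩ := h3 (y := s) (by rwa [Real.dist_eq, sub_zero, abs_of_nonneg hs1])
  simp only [Prod.mk.injEq] at hXe
  obtain ⟨hXe, rfl⟩ := hXe
  exact ⟨X, hX, (sub_eq_zero.1 hXe).symm⟩

lemma eventually_norm_lt {X F : Type*} [TopologicalSpace X] [NormedAddCommGroup F] {f : X → F}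
    {x : X} (hf : ContinuousAt f x) : ∀ᶠ y in 𝓝 x, ‖f y‖ < ‖f x‖ + 1 :=
  hf.norm.eventually (gt_mem_nhds (by simp))

set_option maxHeartbeats 1000000 in
/-- The bifurcation equations for the rescaled unknowns, posed in a commutative Banach algebra. -/
theorem exists_bifurcating_solution {𝔅 : Type*} [NormedCommRing 𝔅] [NormedAlgebra ℝ 𝔅]
    [CompleteSpace 𝔅] (I₂ IU A₀ A₁ J : 𝔅 →L[ℝ] 𝔅) (l : 𝔅 →L[ℝ] ℝ)
    (ζ G₀ H₀ iR xr W₁ W₂ W₃ : 𝔅) (b e rp c k : ℝ) (hG : G₀ * H₀ = 1)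
    (hl : l (-(2 * e / rp) • (xr * ζ ^ 2 * iR) - c • (xr * ((2 * b / rp) • H₀ +
      (b ^ 2 * (2 * e / rp)) • (iR ^ 3 * H₀ ^ 2)))) ≠ 0) :
    ∃ s0 > 0, ∃ K : ℝ, ∀ s, 0 ≤ s → s < s0 → ∃ (δ : ℝ) (β₁ γ₁ η θ ω γ G H β n q τ σ : 𝔅),
      |δ| ≤ K ∧ ‖θ‖ ≤ K ∧ ‖γ‖ ≤ K ∧ ‖τ‖ ≤ K ∧
      θ = 1 + s • I₂ η ∧ ω = ζ * θ + s • (iR * η) ∧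
      γ = γ₁ - ((2 * e * δ + s * δ ^ 2) / rp) • iR ∧
      G = G₀ + s • (iR ^ 2 * γ) ∧ G * H = 1 ∧
      β = b • 1 + s • ((δ / rp) • 1 + β₁) ∧
      n = ω ^ 2 + c • (β * θ * H * iR) ^ 2 ∧
      q = IU (c • (β * H * θ ^ 2)) ∧
      β₁ = A₁ (q - W₁ * β * n) ∧
      τ = -(iR ^ 2 * ((2 * (e + s * δ)) • q + s • q ^ 2)) - k • (W₂ * θ ^ 2) - W₃ * G * n ∧
      γ₁ = A₀ τ ∧
      σ = xr * γ * ζ * ω - c • (xr * (((δ / rp) • 1 + β₁) * (β + b • 1) * H -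
        b ^ 2 • (γ * iR ^ 2 * H * H₀)) * θ) - W₃ * n * G * ω ∧
      l σ = 0 ∧ η = H * (J σ - γ * ζ * θ * iR) := by
  set σ₁ := -(2 * e / rp) • (xr * ζ ^ 2 * iR) - c • (xr * ((2 * b / rp) • H₀ +
      (b ^ 2 * (2 * e / rp)) • (iR ^ 3 * H₀ ^ 2))) with hσ₁
  let θ : (𝔅 × 𝔅 × ℝ × 𝔅) × ℝ → 𝔅 := fun p => 1 + p.2 • I₂ p.1.2.2.2
  let ω : (𝔅 × 𝔅 × ℝ × 𝔅) × ℝ → 𝔅 := fun p => ζ * θ p + p.2 • (iR * p.1.2.2.2)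
  let gam : 𝔅 → ℝ → ℝ → 𝔅 := fun γ₁ δ s => γ₁ - ((2 * e * δ + s * δ ^ 2) / rp) • iR
  let G : (𝔅 × 𝔅 × ℝ × 𝔅) × ℝ → 𝔅 := fun p => G₀ + p.2 • (iR ^ 2 * gam p.1.2.1 p.1.2.2.1 p.2)
  let H : (𝔅 × 𝔅 × ℝ × 𝔅) × ℝ → 𝔅 := fun p => Ring.inverse (G p)
  let β : (𝔅 × 𝔅 × ℝ × 𝔅) × ℝ → 𝔅 := fun p => b • 1 + p.2 • ((p.1.2.2.1 / rp) • 1 + p.1.1)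
  let n : (𝔅 × 𝔅 × ℝ × 𝔅) × ℝ → 𝔅 := fun p => ω p ^ 2 + c • (β p * θ p * H p * iR) ^ 2
  let q : (𝔅 × 𝔅 × ℝ × 𝔅) × ℝ → 𝔅 := fun p => IU (c • (β p * H p * θ p ^ 2))
  let B : (𝔅 × 𝔅 × ℝ × 𝔅) × ℝ → 𝔅 := fun p => A₁ (q p - W₁ * β p * n p)
  let τ : (𝔅 × 𝔅 × ℝ × 𝔅) × ℝ → 𝔅 := fun p => -(iR ^ 2 * ((2 * (e + p.2 * p.1.2.2.1)) • q p +
    p.2 • q p ^ 2)) - k • (W₂ * θ p ^ 2) - W₃ * G p * n p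
  let Γ : (𝔅 × 𝔅 × ℝ × 𝔅) × ℝ → 𝔅 := fun p => A₀ (τ p)
  let σ : ((𝔅 × 𝔅 × ℝ × 𝔅) × ℝ → ℝ) → (𝔅 × 𝔅 × ℝ × 𝔅) × ℝ → 𝔅 := fun δ p => xr * gam (Γ p) (δ p)
    p.2 * ζ * ω p -
    c • (xr * (((δ p / rp) • 1 + B p) * (β p + b • 1) * H p -
      b ^ 2 • (gam (Γ p) (δ p) p.2 * iR ^ 2 * H p * H₀)) * θ p) - W₃ * n p * G p * ω p
  let δ₀ : (𝔅 × 𝔅 × ℝ × 𝔅) × ℝ → ℝ := fun p => p.1.2.2.1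
  let δ' : (𝔅 × 𝔅 × ℝ × 𝔅) × ℝ → ℝ := fun p => p.1.2.2.1 - (l σ₁)⁻¹ * l (σ δ₀ p)
  let Y : (𝔅 × 𝔅 × ℝ × 𝔅) × ℝ → 𝔅 := fun p => H p * (J (σ δ' p) - gam (Γ p) (δ' p) p.2 * ζ * θ p *
    iR)
  let T : (𝔅 × 𝔅 × ℝ × 𝔅) × ℝ → 𝔅 × 𝔅 × ℝ × 𝔅 := fun p => (B p, Γ p, δ' p, Y p)
  have hinv0 : Ring.inverse G₀ = H₀ := by
    have : IsUnit G₀ := IsUnit.of_mul_eq_one _ hG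
    calc Ring.inverse G₀ = Ring.inverse G₀ * (G₀ * H₀) := by rw [hG, mul_one]
      _ = H₀ := by rw [← mul_assoc, Ring.inverse_mul_cancel _ this, one_mul]
  have hG0 : ∀ X : 𝔅 × 𝔅 × ℝ × 𝔅, G (X, 0) = G₀ := fun X => by simp [G]
  have hconst : ∀ X : 𝔅 × 𝔅 × ℝ × 𝔅, T (X, 0) = T (0, 0) := by
    intro X
    have hθ : ∀ X : 𝔅 × 𝔅 × ℝ × 𝔅, θ (X, 0) = 1 := fun X => by simp [θ]
    have hω : ∀ X : 𝔅 × 𝔅 × ℝ × 𝔅, ω (X, 0) = ζ := fun X => by simp [ω, hθ]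
    have hH : ∀ X : 𝔅 × 𝔅 × ℝ × 𝔅, H (X, 0) = H₀ := fun X => by simp only [H, hG0, hinv0]
    have hβ : ∀ X : 𝔅 × 𝔅 × ℝ × 𝔅, β (X, 0) = b • 1 := fun X => by simp [β]
    have hn : n (X, 0) = n (0, 0) := by simp only [n, hω, hβ, hθ, hH]
    have hq : q (X, 0) = q (0, 0) := by simp only [q, hβ, hθ, hH]
    have hB : B (X, 0) = B (0, 0) := by simp only [B, hβ, hq, hn]
    have hΓ : Γ (X, 0) = Γ (0, 0) := by
      simp only [Γ, τ, hθ, hq, hn, hG0, zero_mul, add_zero, zero_smul]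
    have hσ : σ δ₀ (X, 0) = σ δ₀ (0, 0) + X.2.2.1 • σ₁ := by
      simp only [σ, δ₀, hσ₁, gam, hΓ, hB, hn, hθ, hω, hH, hβ, hG0]
      simp only [Algebra.smul_def, Prod.snd_zero, Prod.fst_zero, mul_zero, zero_mul, add_zero,
        map_mul, map_pow, map_neg, map_ofNat, mul_one, map_zero, div_eq_mul_inv,
        sub_zero, zero_add, ne_eq, OfNat.ofNat_ne_zero, not_false_eq_true, zero_pow]
      ring
    have hδ : δ' (X, 0) = δ' (0, 0) := by
      simp only [δ', hσ, map_add, map_smul, smul_eq_mul]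
      simp only [Prod.snd_zero, Prod.fst_zero]
      field_simp
      ring
    have hσ' : σ δ' (X, 0) = σ δ' (0, 0) := by
      simp only [σ, hΓ, hB, hn, hθ, hω, hH, hβ, hG0, hδ]
    have hY : Y (X, 0) = Y (0, 0) := by simp only [Y, hH, hσ', hΓ, hδ, hθ]
    simp only [T, hB, hΓ, hδ, hY]
  set X0 : 𝔅 × 𝔅 × ℝ × 𝔅 := T (0, 0)
  have hGunit : IsUnit (G (X0, 0)) := by rw [hG0]; exact IsUnit.of_mul_eq_one _ hG
  have cθ : ContDiffAt ℝ 1 θ (X0, 0) :=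
    contDiffAt_const.add (contDiffAt_snd.smul (I₂.contDiff.contDiffAt.comp _ (by fun_prop)))
  have cω : ContDiffAt ℝ 1 ω (X0, 0) := by
    simp only [ω]
    fun_prop
  have cgam : ∀ {f : (𝔅 × 𝔅 × ℝ × 𝔅) × ℝ → 𝔅} {d : (𝔅 × 𝔅 × ℝ × 𝔅) × ℝ → ℝ}, ContDiffAt ℝ 1 f (X0,
    0) →
      ContDiffAt ℝ 1 d (X0, 0) → ContDiffAt ℝ 1 (fun p => gam (f p) (d p) p.2) (X0, 0) := by
    intro f d hf hd
    simp only [gam, div_eq_mul_inv]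
    fun_prop
  have cG : ContDiffAt ℝ 1 G (X0, 0) := by
    have := cgam (f := fun p => p.1.2.1) (d := fun p => p.1.2.2.1) (by fun_prop) (by fun_prop)
    simp only [G]
    fun_prop
  have cH : ContDiffAt ℝ 1 H (X0, 0) := by
    obtain ⟨v, hv⟩ := hGunit
    have h1 := contDiffAt_ringInverse ℝ (n := 1) v
    rw [hv] at h1
    exact h1.comp _ cG
  have cβ : ContDiffAt ℝ 1 β (X0, 0) := by
    simp only [β, div_eq_mul_inv]
    fun_prop
  have cn : ContDiffAt ℝ 1 n (X0, 0) := by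
    simp only [n]
    fun_prop
  have cq : ContDiffAt ℝ 1 q (X0, 0) := IU.contDiff.contDiffAt.comp _ (by fun_prop)
  have cB : ContDiffAt ℝ 1 B (X0, 0) := A₁.contDiff.contDiffAt.comp _ (by fun_prop)
  have cτ : ContDiffAt ℝ 1 τ (X0, 0) := by
    simp only [τ]
    fun_prop
  have cΓ : ContDiffAt ℝ 1 Γ (X0, 0) := A₀.contDiff.contDiffAt.comp _ cτ
  have cσ : ∀ {d : (𝔅 × 𝔅 × ℝ × 𝔅) × ℝ → ℝ}, ContDiffAt ℝ 1 d (X0, 0) → ContDiffAt ℝ 1 (σ d) (X0,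
    0) := by
    intro d hd
    have := cgam cΓ hd
    simp only [σ, div_eq_mul_inv]
    fun_prop
  have cδ₀ : ContDiffAt ℝ 1 δ₀ (X0, 0) := by
    simp only [δ₀]
    fun_prop
  have cδ' : ContDiffAt ℝ 1 δ' (X0, 0) := by
    have := l.contDiff.contDiffAt.comp (X0, (0:ℝ)) (cσ cδ₀)
    have h2 : ContDiffAt ℝ 1 (fun p => l (σ δ₀ p)) (X0, 0) := this
    simp only [δ']
    fun_prop
  have cY : ContDiffAt ℝ 1 Y (X0, 0) := by
    have h1 := cgam cΓ cδ'
    have h2 : ContDiffAt ℝ 1 (fun p => J (σ δ' p)) (X0, 0) :=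
      J.contDiff.contDiffAt.comp (X0, (0:ℝ)) (cσ cδ')
    simp only [Y]
    fun_prop
  have cT : ContDiffAt ℝ 1 T (X0, 0) := cB.prodMk (cΓ.prodMk (cδ'.prodMk cY))
  have hN1 : ∀ᶠ p in 𝓝 (X0, (0:ℝ)), IsUnit (G p) := by
    have : {x : 𝔅 | IsUnit x} ∈ 𝓝 (G (X0, 0)) := Units.isOpen.mem_nhds hGunit
    exact cG.continuousAt.eventually this
  have cγ := cgam (f := fun p => p.1.2.1) (d := fun p => p.1.2.2.1) (by fun_prop) (by fun_prop)
  obtain ⟨s0, hs0, h⟩ := exists_fixedPoint_of_contDiffAt cT hconst (hN1.and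
    ((eventually_norm_lt cδ₀.continuousAt).and ((eventually_norm_lt cθ.continuousAt).and
      ((eventually_norm_lt cγ.continuousAt).and (eventually_norm_lt cτ.continuousAt)))))
  set k₁ := ‖δ₀ (X0, 0)‖
  set k₂ := ‖θ (X0, 0)‖
  set k₃ := ‖gam X0.2.1 X0.2.2.1 0‖
  set k₄ := ‖τ (X0, 0)‖
  have hk₁ : 0 ≤ k₁ := norm_nonneg _
  have hk₂ : 0 ≤ k₂ := norm_nonneg _
  have hk₃ : 0 ≤ k₃ := norm_nonneg _
  have hk₄ : 0 ≤ k₄ := norm_nonneg _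
  refine ⟨s0, hs0, k₁ + k₂ + k₃ + k₄ + 1, fun s hs1 hs2 => ?_⟩
  obtain ⟨X, ⟨hu, hX1, hX2, hX3, hX4⟩, hfix⟩ := h s hs1 hs2
  have f1 : B (X, s) = X.1 := congrArg (fun x : 𝔅 × 𝔅 × ℝ × 𝔅 => x.1) hfix
  have f2 : Γ (X, s) = X.2.1 := congrArg (fun x : 𝔅 × 𝔅 × ℝ × 𝔅 => x.2.1) hfix
  have f3 : δ' (X, s) = X.2.2.1 := congrArg (fun x : 𝔅 × 𝔅 × ℝ × 𝔅 => x.2.2.1) hfix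
  have f4 : Y (X, s) = X.2.2.2 := congrArg (fun x : 𝔅 × 𝔅 × ℝ × 𝔅 => x.2.2.2) hfix
  have hσ0 : l (σ δ₀ (X, s)) = 0 := by
    simp only [δ'] at f3
    have : (l σ₁)⁻¹ * l (σ δ₀ (X, s)) = 0 := by linarith
    exact (mul_eq_zero.1 this).resolve_left (inv_ne_zero hl)
  have hσσ : σ δ' (X, s) = σ δ₀ (X, s) := by simp only [σ, f3, δ₀]
  refine ⟨X.2.2.1, X.1, X.2.1, X.2.2.2, θ (X, s), ω (X, s), gam X.2.1 X.2.2.1 s, G (X, s),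
    H (X, s), β (X, s), n (X, s), q (X, s), τ (X, s), σ δ₀ (X, s), ?_, ?_, ?_, ?_, rfl, rfl, rfl,
    rfl, Ring.mul_inverse_cancel _ hu, rfl, rfl, rfl, f1.symm, rfl, f2.symm, ?_, hσ0, ?_⟩
  · have : |X.2.2.1| < k₁ + 1 := hX1
    linarith
  · have : ‖θ (X, s)‖ < k₂ + 1 := hX2
    linarith
  · have : ‖gam X.2.1 X.2.2.1 s‖ < k₃ + 1 := hX3
    linarith
  · have : ‖τ (X, s)‖ < k₄ + 1 := hX4
    linarith
  · simp only [σ, f1, f2, δ₀]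
  · rw [← f4]
    simp only [Y, hσσ, f2, f3]

section

variable {L α c rp e : ℝ} {u w : ℝ → ℝ}

/-- Decay estimates for the positive fast decaying solution of the linear equation. -/
lemma IsRadialSol.decay (h : IsRadialSol L α c rp e u w)
    (hL : 0 < L) (hα : α < 0) (hc : 0 ≤ c) (hrp : 0 < rp)
    (he : e ^ 2 < rp ^ 2 + 3 * L * rp ^ 4) (hw : ∀ r, rp < r → w r < 0)
    (hu : ∀ r, rp ≤ r → 0 < u r) {R : ℝ} (hR : rp < R)
    (hfast : ∀ r, R ≤ r → r * w r + 3 / 2 * u r ≤ 0) :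
    (∀ r, rp ≤ r → u r ≤ 1) ∧ (∃ C, ∀ r, rp ≤ r → r ^ 3 * u r ^ 2 ≤ C) ∧
    (∃ C, ∀ r, rp ≤ r → |r * w r / u r| ≤ C) ∧ IntegrableOn (fun t => u t ^ 2) (Ioi rp) ∧
    ∃ C, 0 ≤ C ∧ ∀ r, rp ≤ r → ∫ t in Ioi r, u t ^ 2 ≤ C * (r * u r ^ 2) := by
  have hanti : AntitoneOn u (Ici rp) := by
    apply antitoneOn_of_hasDerivWithinAt_nonpos (convex_Ici rp) h.contu.continuousOn (f' := w)
    · intro x hx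
      rw [interior_Ici] at hx
      exact (h.du x hx).hasDerivWithinAt
    · intro x hx
      rw [interior_Ici] at hx
      exact (hw x hx).le
  have hle1 : ∀ r, rp ≤ r → u r ≤ 1 := fun r hr => by
    rw [← h.u_horizon]
    exact hanti self_mem_Ici hr hr
  have hR0 : 0 < R := hrp.trans hR
  have hcub : AntitoneOn (fun r => r ^ 3 * u r ^ 2) (Ici R) := by
    apply antitoneOn_of_hasDerivWithinAt_nonpos (convex_Ici R)
      (f' := fun r => (3:ℕ) * r ^ 2 * u r ^ 2 + r ^ 3 * ((2:ℕ) * u r ^ 1 * w r))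
    · have := h.contu
      exact Continuous.continuousOn (by fun_prop)
    · intro x hx
      rw [interior_Ici] at hx
      exact ((hasDerivAt_pow 3 x).mul ((h.du x (hR.trans hx)).pow 2)).hasDerivWithinAt
    · intro x hx
      rw [interior_Ici] at hx
      have hx' : R < x := hx
      have h1 := hfast x hx'.le
      have h2 := hu x (hR.trans hx').le
      have h3 : 0 < x := hR0.trans hx'
      have : (3:ℕ) * x ^ 2 * u x ^ 2 + x ^ 3 * ((2:ℕ) * u x ^ 1 * w x) =
          2 * (x ^ 2 * u x) * (x * w x + 3 / 2 * u x) := by push_cast; ring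
      rw [this]
      exact mul_nonpos_of_nonneg_of_nonpos (by positivity) h1
  have hcu : ∃ C, ∀ r, rp ≤ r → r ^ 3 * u r ^ 2 ≤ C := by
    refine ⟨R ^ 3, fun r hr => ?_⟩
    have h1 := hle1 r hr
    have h2 := hu r hr
    have hr0 : 0 < r := hrp.trans_le hr
    rcases le_total r R with h3 | h3
    · calc r ^ 3 * u r ^ 2 ≤ R ^ 3 * 1 ^ 2 := by gcongr
        _ = _ := by ring
    · have := hcub self_mem_Ici h3 h3
      have h4 := hle1 R hR.le
      have h5 := hu R hR.le
      calc r ^ 3 * u r ^ 2 ≤ R ^ 3 * u R ^ 2 := this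
        _ ≤ R ^ 3 * 1 ^ 2 := by gcongr
        _ = _ := by ring
  have hζ : ∃ C, ∀ r, rp ≤ r → |r * w r / u r| ≤ C := by
    have hcont : ContinuousOn (fun r => r * w r / u r) (Icc rp (2 * rp)) := by
      have h1 := h.contu
      have h2 := h.contw
      exact ContinuousOn.div (by fun_prop) (by fun_prop) fun x hx => (hu x hx.1).ne'
    obtain ⟨C1, hC1⟩ := isCompact_Icc.exists_bound_of_continuousOn hcont
    set B := 3 * L + 1 / rp ^ 2
    have hB : 0 < B := by positivity
    refine ⟨max C1 (64 * B / L), fun r hr => ?_⟩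
    rcases le_total r (2 * rp) with hr2 | hr2
    · exact (hC1 r ⟨hr, hr2⟩).trans (le_max_left _ _)
    · refine le_trans ?_ (le_max_right _ _)
      have hr0 : 0 < r := by linarith
      have hrr : rp < r := by linarith
      obtain ⟨ξ, hξ, hξe⟩ := exists_hasDerivAt_eq_slope u w (show r < 2 * r by linarith)
        h.contu.continuousOn fun x hx => h.du x (by linarith [hx.1])
      have hξr : rp < ξ := by linarith [hξ.1]
      have hξ0 : 0 < ξ := by linarith
      have e1 : -w ξ * r ≤ u r := by
        have : w ξ * r = u (2 * r) - u r := by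
          rw [hξe]
          field_simp
          ring
        have := hu (2 * r) (by linarith)
        linarith
      have hpw : AntitoneOn (fun s => (s - rp) * gRN L rp e s * w s) (Ici rp) := by
        apply antitoneOn_of_hasDerivWithinAt_nonpos (convex_Ici rp) h.continuous_flux.continuousOn
          (f' := fun r => potV L α c rp e r * u r)
        · intro x hx
          rw [interior_Ici] at hx
          exact (h.dp x hx).hasDerivWithinAt
        · intro x hx
          rw [interior_Ici] at hx
          exact mul_nonpos_of_nonpos_of_nonneg (potV_neg hL hα hc hrp he (le_of_lt hx)).le
            (hu x (le_of_lt hx)).le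
      have e2 : (ξ - rp) * gRN L rp e ξ * w ξ ≤ (r - rp) * gRN L rp e r * w r :=
        hpw hrr.le hξr.le hξ.1.le
      have e3 : (ξ - rp) * gRN L rp e ξ ≤ B * (16 * r ^ 4) := by
        have a1 : gRN L rp e ξ ≤ 3 * L * ξ ^ 3 + ξ := by
          unfold gRN
          have : 0 ≤ e ^ 2 / rp := by positivity
          have : ξ * rp ≤ ξ ^ 2 := by nlinarith
          have : rp ^ 2 ≤ ξ ^ 2 := by gcongr
          have : L * ξ * (ξ ^ 2 + ξ * rp + rp ^ 2) ≤ L * ξ * (ξ ^ 2 + ξ ^ 2 + ξ ^ 2) := by gcongr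
          linarith
        have a2 : ξ ^ 2 ≤ 1 / rp ^ 2 * ξ ^ 4 := by
          have : rp ^ 2 ≤ ξ ^ 2 := by gcongr
          rw [one_div, inv_mul_eq_div, le_div_iff₀ (by positivity)]
          calc ξ ^ 2 * rp ^ 2 ≤ ξ ^ 2 * ξ ^ 2 := by gcongr
            _ = _ := by ring
        calc (ξ - rp) * gRN L rp e ξ ≤ ξ * (3 * L * ξ ^ 3 + ξ) := by
              have := (gRN_pos hL hrp he hξr.le).le
              gcongr
              linarith
          _ = 3 * L * ξ ^ 4 + ξ ^ 2 := by ring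
          _ ≤ B * ξ ^ 4 := by simp only [B]; linarith
          _ ≤ B * (2 * r) ^ 4 := by
            have := hξ.2.le
            gcongr
          _ = _ := by ring
      have e4 : L * r ^ 4 / 4 ≤ (r - rp) * gRN L rp e r := by
        have a1 := gRN_ge hL hrp he hrr.le
        have a2 : r / 2 ≤ r - rp := by linarith
        calc L * r ^ 4 / 4 = r / 2 * (r / 2 * (L * r ^ 2)) := by ring
          _ ≤ (r - rp) * ((r - rp) * (L * r ^ 2 + 1)) := by
            gcongr
            linarith
          _ ≤ _ := by
            have : 0 ≤ r - rp := by linarith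
            gcongr
      have hwr := hw r hrr
      have hwξ := hw ξ hξr
      have hur := hu r hrr.le
      rw [abs_div, abs_of_pos hur, div_le_iff₀ hur, abs_of_neg (mul_neg_of_pos_of_neg hr0 hwr),
        div_mul_eq_mul_div, le_div_iff₀ hL]
      have e5 : L * r ^ 4 / 4 * -w r ≤ B * (16 * r ^ 4) * -w ξ := by
        calc _ ≤ (r - rp) * gRN L rp e r * -w r := by
              gcongr
              linarith
          _ ≤ (ξ - rp) * gRN L rp e ξ * -w ξ := by linarith
          _ ≤ _ := by
            gcongr
            linarith
      have e6 : L * -w r ≤ 64 * B * -w ξ := by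
        have : r ^ 4 / 4 * (L * -w r) ≤ r ^ 4 / 4 * (64 * B * -w ξ) := by linarith
        exact le_of_mul_le_mul_left this (by positivity)
      calc -(r * w r) * L = r * (L * -w r) := by ring
        _ ≤ r * (64 * B * -w ξ) := by gcongr
        _ = 64 * B * (-w ξ * r) := by ring
        _ ≤ 64 * B * u r := by gcongr
  have htail : ∀ r, R ≤ r → ∀ t ∈ Ioi r, u t ^ 2 ≤ r ^ 3 * u r ^ 2 * t ^ (-3 : ℝ) := by
    intro r hr t ht
    have ht' : r < t := ht
    have ht0 : 0 < t := by linarith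
    have := hcub hr (hr.trans ht'.le) ht'.le
    have e1 : t ^ (-3 : ℝ) = (t ^ 3)⁻¹ := by
      rw [rpow_neg ht0.le]
      norm_cast
    rw [e1, ← div_eq_mul_inv, le_div_iff₀ (by positivity), mul_comm]
    exact this
  have hint3 : ∀ r, 0 < r → IntegrableOn (fun t : ℝ => t ^ (-3 : ℝ)) (Ioi r) := fun r hr =>
    integrableOn_Ioi_rpow_of_lt (by norm_num) hr
  have hintR : ∀ r, R ≤ r → IntegrableOn (fun t => u t ^ 2) (Ioi r) := by
    intro r hr
    refine ((hint3 r (hR0.trans_le hr)).const_mul (r ^ 3 * u r ^ 2)).mono'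
      ((h.contu.pow 2).aestronglyMeasurable) ?_
    filter_upwards [ae_restrict_mem measurableSet_Ioi] with t ht
    rw [Real.norm_of_nonneg (sq_nonneg _)]
    exact htail r hr t ht
  have hInt : IntegrableOn (fun t => u t ^ 2) (Ioi rp) := by
    rw [← Ioc_union_Ioi_eq_Ioi hR.le]
    exact ((h.contu.pow 2).integrableOn_Ioc).union (hintR R le_rfl)
  refine ⟨hle1, hcu, hζ, hInt, ?_⟩
  set I := ∫ t in Ioi rp, u t ^ 2
  have hI : 0 ≤ I := integral_nonneg fun t => sq_nonneg _
  have huR := hu R hR.le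
  refine ⟨max (1 / 2) (I / (rp * u R ^ 2)), le_max_of_le_left (by norm_num), fun r hr => ?_⟩
  have hur := hu r hr
  have hr0 : 0 < r := hrp.trans_le hr
  rcases le_total R r with h1 | h1
  · have e1 : ∫ t in Ioi r, u t ^ 2 ≤ ∫ t in Ioi r, r ^ 3 * u r ^ 2 * t ^ (-3 : ℝ) :=
      setIntegral_mono_on (hintR r h1) ((hint3 r hr0).const_mul _) measurableSet_Ioi (htail r h1)
    have e2 : ∫ t in Ioi r, r ^ 3 * u r ^ 2 * t ^ (-3 : ℝ) = 1 / 2 * (r * u r ^ 2) := by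
      rw [integral_const_mul, integral_Ioi_rpow_of_lt (by norm_num) hr0]
      have : r ^ ((-3 : ℝ) + 1) = (r ^ 2)⁻¹ := by
        rw [show (-3 : ℝ) + 1 = -(2 : ℕ) by norm_num, rpow_neg hr0.le, rpow_natCast]
      rw [this]
      field_simp
      norm_num
    rw [e2] at e1
    refine e1.trans ?_
    gcongr
    exact le_max_left _ _
  · have e1 : ∫ t in Ioi r, u t ^ 2 ≤ I :=
      setIntegral_mono_set hInt (ae_of_all _ fun t => sq_nonneg _)
        (Ioi_subset_Ioi hr).eventuallyLE
    have e2 : rp * u R ^ 2 ≤ r * u r ^ 2 := by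
      have := hanti hr hR.le h1
      gcongr
    calc _ ≤ I := e1
      _ = I / (rp * u R ^ 2) * (rp * u R ^ 2) := by field_simp
      _ ≤ max (1 / 2) (I / (rp * u R ^ 2)) * (r * u r ^ 2) := by
        gcongr
        exact le_max_right _ _

end

lemma exists_boundedContinuous {rp C : ℝ} {f : ℝ → ℝ} (hf : ContinuousOn f (Ici rp))
    (hb : ∀ r, rp ≤ r → |f r| ≤ C) : ∃ F : ℝ →ᵇ ℝ, ∀ r, F r = f (max r rp) :=
  ⟨BoundedContinuousFunction.ofNormedAddCommGroup (fun r => f (max r rp))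
    (hf.comp_continuous (by fun_prop) fun r => le_max_right r rp) C
    fun r => hb _ (le_max_right r rp), fun _ => rfl⟩

lemma exists_operator {rp C : ℝ} (f : (ℝ →ᵇ ℝ) → ℝ → ℝ) (hC : 0 ≤ C)
    (hadd : ∀ ψ χ r, rp ≤ r → f (ψ + χ) r = f ψ r + f χ r)
    (hsmul : ∀ (a : ℝ) ψ r, rp ≤ r → f (a • ψ) r = a * f ψ r)
    (hcont : ∀ ψ, ContinuousOn (f ψ) (Ici rp)) (hb : ∀ ψ r, rp ≤ r → |f ψ r| ≤ C * ‖ψ‖) :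
    ∃ T : (ℝ →ᵇ ℝ) →L[ℝ] (ℝ →ᵇ ℝ), ∀ ψ r, rp ≤ r → T ψ r = f ψ r := by
  obtain ⟨T, -, hT⟩ := exists_clm (fun ψ r => f ψ (max r rp)) C hC
    (fun ψ χ r => hadd ψ χ _ (le_max_right r rp)) (fun a ψ r => hsmul a ψ _ (le_max_right r rp))
    (fun ψ => (hcont ψ).comp_continuous (by fun_prop) fun r => le_max_right r rp)
    (fun ψ r => hb ψ _ (le_max_right r rp))
  exact ⟨T, fun ψ r hr => by rw [hT, max_eq_left hr]⟩

lemma abs_segAvg_mul_le {rp : ℝ} {ρ : ℝ → ℝ} (hρ : Continuous ρ) (h0 : ∀ r, rp ≤ r → 0 ≤ ρ r)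
    (ψ : ℝ →ᵇ ℝ) {r : ℝ} (hr : rp ≤ r) :
    |segAvg rp (fun t => ρ t * ψ t) r| ≤ segAvg rp ρ r * ‖ψ‖ := by
  unfold segAvg
  rw [← intervalIntegral.integral_mul_const, ← Real.norm_eq_abs]
  refine intervalIntegral.norm_integral_le_of_norm_le zero_le_one ?_ ?_
  · refine ae_of_all _ fun τ hτ => ?_
    have h1 : 0 ≤ ρ (rp + τ * (r - rp)) := h0 _ (by nlinarith [hτ.1])
    rw [norm_mul, Real.norm_of_nonneg h1]
    exact mul_le_mul_of_nonneg_left (ψ.norm_coe_le_norm _) h1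
  · exact Continuous.intervalIntegrable (by fun_prop) _ _

lemma exists_operator_segAvg {rp M : ℝ} {ρ f : ℝ → ℝ} (hρ : Continuous ρ)
    (h0 : ∀ r, rp ≤ r → 0 ≤ ρ r) (hf : ContinuousOn f (Ici rp))
    (hM : ∀ r, rp ≤ r → |f r| * segAvg rp ρ r ≤ M) :
    ∃ T : (ℝ →ᵇ ℝ) →L[ℝ] (ℝ →ᵇ ℝ), ∀ ψ r, rp ≤ r →
      T ψ r = f r * segAvg rp (fun t => ρ t * ψ t) r := by
  have hM0 : 0 ≤ M := by
    refine le_trans ?_ (hM rp le_rfl)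
    rw [segAvg_self]
    exact mul_nonneg (abs_nonneg _) (h0 rp le_rfl)
  apply exists_operator (fun ψ r => f r * segAvg rp (fun t => ρ t * ψ t) r) hM0
  · intro ψ χ r _
    simp only [BoundedContinuousFunction.add_apply, mul_add]
    rw [segAvg_add (by fun_prop) (by fun_prop), mul_add]
  · intro a ψ r _
    simp only [BoundedContinuousFunction.smul_apply, smul_eq_mul, mul_left_comm _ a]
    rw [segAvg_const_mul, mul_left_comm]
  · intro ψ
    exact hf.mul (continuous_segAvg (by fun_prop)).continuousOn
  · intro ψ r hr
    rw [abs_mul]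
    calc _ ≤ |f r| * (segAvg rp ρ r * ‖ψ‖) := by
          gcongr
          exact abs_segAvg_mul_le hρ h0 ψ hr
      _ = |f r| * segAvg rp ρ r * ‖ψ‖ := by ring
      _ ≤ _ := by
        gcongr
        exact hM r hr

lemma integrableOn_mul_bounded {s : Set ℝ} {ρ : ℝ → ℝ} (h : IntegrableOn ρ s) (ψ : ℝ →ᵇ ℝ) :
    IntegrableOn (fun t => ρ t * ψ t) s :=
  Integrable.mul_bdd (c := ‖ψ‖) h ψ.continuous.aestronglyMeasurable
    (ae_of_all _ fun t => ψ.norm_coe_le_norm t)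

lemma abs_integral_mul_le {s : Set ℝ} {ρ : ℝ → ℝ} (hs : MeasurableSet s)
    (h : IntegrableOn ρ s) (h0 : ∀ r ∈ s, 0 ≤ ρ r)
    (ψ : ℝ →ᵇ ℝ) : |∫ t in s, ρ t * ψ t| ≤ (∫ t in s, ρ t) * ‖ψ‖ := by
  rw [← integral_mul_const, ← Real.norm_eq_abs]
  apply norm_integral_le_of_norm_le (h.mul_const _)
  filter_upwards [ae_restrict_mem hs] with t ht
  rw [norm_mul, Real.norm_of_nonneg (h0 t ht)]
  exact mul_le_mul_of_nonneg_left (ψ.norm_coe_le_norm _) (h0 t ht)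

lemma exists_functional {s : Set ℝ} {ρ : ℝ → ℝ} (hs : MeasurableSet s)
    (h : IntegrableOn ρ s) (h0 : ∀ r ∈ s, 0 ≤ ρ r) :
    ∃ l : (ℝ →ᵇ ℝ) →L[ℝ] ℝ, ∀ ψ, l ψ = ∫ t in s, ρ t * ψ t := by
  let l0 : (ℝ →ᵇ ℝ) →ₗ[ℝ] ℝ :=
    { toFun := fun ψ => ∫ t in s, ρ t * ψ t
      map_add' := fun ψ χ => by
        simp only [BoundedContinuousFunction.add_apply, mul_add]
        exact integral_add (integrableOn_mul_bounded h ψ) (integrableOn_mul_bounded h χ)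
      map_smul' := fun a ψ => by
        simp only [BoundedContinuousFunction.smul_apply, smul_eq_mul, mul_left_comm _ a]
        exact integral_const_mul _ _ }
  exact ⟨l0.mkContinuous (∫ t in s, ρ t) fun ψ => abs_integral_mul_le hs h h0 ψ, fun ψ => rfl⟩

/-- The regular quotient of the flux with vanishing total integral by `(r - rp) * r * ρ`. -/
lemma exists_flux_operator {rp C : ℝ} {ρ : ℝ → ℝ} (hrp : 0 < rp) (hρ : Continuous ρ)
    (hpos : ∀ r, rp ≤ r → 0 < ρ r) (hle : ∀ r, rp ≤ r → ρ r ≤ 1)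
    (hInt : IntegrableOn ρ (Ioi rp)) (hI : 0 < ∫ t in Ioi rp, ρ t)
    (htail : ∀ r, rp ≤ r → ∫ t in Ioi r, ρ t ≤ C * (r * ρ r)) :
    ∃ J : (ℝ →ᵇ ℝ) →L[ℝ] (ℝ →ᵇ ℝ), ∀ ψ : ℝ →ᵇ ℝ, ∫ t in Ioi rp, ρ t * ψ t = 0 → ∀ r, rp ≤ r →
      J ψ r = segAvg rp (fun t => ρ t * ψ t) r / (r * ρ r) := by
  set I := ∫ t in Ioi rp, ρ t
  have hcont : Continuous (segAvg rp ρ) := continuous_segAvg hρ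
  obtain ⟨m, hm, hmle⟩ : ∃ m > 0, ∀ r ∈ Icc rp (rp + 1), m ≤ ρ r := by
    obtain ⟨t0, ht, ht0⟩ := (isCompact_Icc (a := rp) (b := rp + 1)).exists_isMinOn
      ⟨rp, by simp⟩ hρ.continuousOn
    exact ⟨ρ t0, hpos t0 ht.1, fun r hr => ht0 hr⟩
  have hadd : ∀ ψ χ : ℝ →ᵇ ℝ, ∫ t in Ioi rp, ρ t * (ψ + χ) t =
      (∫ t in Ioi rp, ρ t * ψ t) + ∫ t in Ioi rp, ρ t * χ t := fun ψ χ => by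
    simp only [BoundedContinuousFunction.add_apply, mul_add]
    exact integral_add (integrableOn_mul_bounded hInt ψ) (integrableOn_mul_bounded hInt χ)
  obtain ⟨J, hJ⟩ := exists_operator (rp := rp) (C := max (2 / (rp * m)) (2 * C))
    (fun ψ r => (segAvg rp (fun t => ρ t * ψ t) r -
      segAvg rp ρ r * ((∫ t in Ioi rp, ρ t * ψ t) / I)) / (r * ρ r)) (by positivity)
    (fun ψ χ r _ => by
      rw [hadd]
      simp only [BoundedContinuousFunction.add_apply, mul_add]
      rw [segAvg_add (by fun_prop) (by fun_prop)]
      ring)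
    (fun a ψ r _ => by
      simp only [BoundedContinuousFunction.smul_apply, smul_eq_mul, mul_left_comm _ a]
      rw [segAvg_const_mul, integral_const_mul]
      ring)
    (fun ψ => by
      have : Continuous (segAvg rp fun t => ρ t * ψ t) := continuous_segAvg (by fun_prop)
      refine ContinuousOn.div (by fun_prop) (by fun_prop) fun r hr => ?_
      have := hpos r hr
      have : 0 < r := hrp.trans_le hr
      positivity)
    (fun ψ r hr => by
      have hr0 : 0 < r := hrp.trans_le hr
      have hρr := hpos r hr
      set a := (∫ t in Ioi rp, ρ t * ψ t) / I
      have ha : |a| ≤ ‖ψ‖ := by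
        rw [abs_div, abs_of_pos hI, div_le_iff₀ hI, mul_comm]
        exact abs_integral_mul_le measurableSet_Ioi hInt (fun t ht => (hpos t (le_of_lt ht)).le) ψ
      rw [abs_div, abs_of_pos (mul_pos hr0 hρr), div_le_iff₀ (mul_pos hr0 hρr)]
      have hψ := norm_nonneg ψ
      rcases le_total r (rp + 1) with h1 | h1
      · have e1 : |segAvg rp (fun t => ρ t * ψ t) r| ≤ ‖ψ‖ := by
          apply abs_segAvg_le hr
          intro t ht
          rw [abs_mul, abs_of_pos (hpos t ht.1)]
          calc ρ t * |ψ t| ≤ 1 * ‖ψ‖ := by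
                gcongr
                · exact hle t ht.1
                · exact ψ.norm_coe_le_norm t
            _ = _ := one_mul _
        have e2 : |segAvg rp ρ r| ≤ 1 := by
          apply abs_segAvg_le hr
          intro t ht
          rw [abs_of_pos (hpos t ht.1)]
          exact hle t ht.1
        have e3 : |segAvg rp ρ r * a| ≤ 1 * ‖ψ‖ := by
          rw [abs_mul]
          gcongr
        have e4 := hmle r ⟨hr, h1⟩
        calc _ ≤ ‖ψ‖ + 1 * ‖ψ‖ := (abs_sub _ _).trans (add_le_add e1 e3)
          _ = 2 / (rp * m) * ‖ψ‖ * (rp * m) := by field_simp; ring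
          _ ≤ max (2 / (rp * m)) (2 * C) * ‖ψ‖ * (r * ρ r) := by
            gcongr
            exact le_max_left _ _
      · have hx : 1 ≤ r - rp := by linarith
        have hsplit : ∀ f : ℝ → ℝ, Continuous f → IntegrableOn f (Ioi rp) →
            (r - rp) * segAvg rp f r = (∫ t in Ioi rp, f t) - ∫ t in Ioi r, f t := by
          intro f hf hfi
          rw [mul_segAvg, ← intervalIntegral.integral_interval_add_Ioi (b := r) hfi
            (hfi.mono_set (Ioi_subset_Ioi hr))]
          ring
        have e1 := hsplit _ (by fun_prop) (integrableOn_mul_bounded hInt ψ)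
        have e2 := hsplit _ hρ hInt
        have hintr : IntegrableOn ρ (Ioi r) := hInt.mono_set (Ioi_subset_Ioi hr)
        have e3 : |∫ t in Ioi r, ρ t * ψ t| ≤ (∫ t in Ioi r, ρ t) * ‖ψ‖ :=
          abs_integral_mul_le measurableSet_Ioi hintr
            (fun t ht => (hpos t (hr.trans (le_of_lt ht))).le) ψ
        have e4 : 0 ≤ ∫ t in Ioi r, ρ t :=
          setIntegral_nonneg measurableSet_Ioi fun t ht => (hpos t (hr.trans (le_of_lt ht))).le
        have e5 : (r - rp) * (segAvg rp (fun t => ρ t * ψ t) r - segAvg rp ρ r * a) =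
            (∫ t in Ioi r, ρ t) * a - ∫ t in Ioi r, ρ t * ψ t := by
          have : (∫ t in Ioi rp, ρ t * ψ t) = I * a := by simp only [a]; field_simp
          rw [this] at e1
          linear_combination e1 - a * e2
        have e6 : |(∫ t in Ioi r, ρ t) * a| ≤ (∫ t in Ioi r, ρ t) * ‖ψ‖ := by
          rw [abs_mul, abs_of_nonneg e4]
          gcongr
        have e7 := htail r hr
        calc |segAvg rp (fun t => ρ t * ψ t) r - segAvg rp ρ r * a|
            ≤ (r - rp) * |segAvg rp (fun t => ρ t * ψ t) r - segAvg rp ρ r * a| :=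
              le_mul_of_one_le_left (abs_nonneg _) hx
          _ = |(∫ t in Ioi r, ρ t) * a - ∫ t in Ioi r, ρ t * ψ t| := by
            rw [← e5, abs_mul, abs_of_nonneg (by linarith : 0 ≤ r - rp)]
          _ ≤ (∫ t in Ioi r, ρ t) * ‖ψ‖ + (∫ t in Ioi r, ρ t) * ‖ψ‖ :=
            (abs_sub _ _).trans (add_le_add e6 e3)
          _ ≤ C * (r * ρ r) * ‖ψ‖ + C * (r * ρ r) * ‖ψ‖ := by gcongr
          _ = 2 * C * ‖ψ‖ * (r * ρ r) := by ring
          _ ≤ _ := by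
            gcongr
            exact le_max_right _ _)
  refine ⟨J, fun ψ hψ r hr => ?_⟩
  rw [hJ ψ r hr, hψ]
  simp

/-- A nonlinear radial solution with regularised unknowns: the charge `Q`, the potential
`A = κ * (r - rp) * b`, the metric coefficient `r ^ 2 * Ω² / κ² = (r - rp) * g` and the scalar field
`√s * u` with derivative `√s * w`; moreover `κ' / κ = s * r * N`. -/
structure IsHairySol (L α c rp s e : ℝ) (Q b g u w N : ℝ → ℝ) : Prop where
  contQ : ContinuousOn Q (Ici rp)
  contb : ContinuousOn b (Ici rp)
  contg : ContinuousOn g (Ici rp)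
  contu : ContinuousOn u (Ici rp)
  contw : ContinuousOn w (Ici rp)
  g_pos : ∀ r, rp ≤ r → 0 < g r
  Q_horizon : Q rp = e
  u_horizon : u rp = 1
  N_eq : ∀ r, rp ≤ r → N r = w r ^ 2 + c * r ^ 4 * b r ^ 2 * u r ^ 2 / g r ^ 2
  dQ : ∀ r, rp < r → HasDerivAt Q (s * (c * r ^ 4 * (b r / g r) * u r ^ 2)) r
  du : ∀ r, rp < r → HasDerivAt u (w r) r
  db : ∀ r, rp < r → HasDerivAt (fun t => (t - rp) * b t)
    (Q r / r ^ 2 - s * ((r - rp) * b r * (r * N r))) r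
  dg : ∀ r, rp < r → HasDerivAt (fun t => (t - rp) * g t / t)
    (1 - Q r ^ 2 / r ^ 2 + 3 * L * r ^ 2 - s * (L * α * r ^ 2 * u r ^ 2)
      - s * ((r - rp) * g r * N r)) r
  dp : ∀ r, rp < r → HasDerivAt (fun t => (t - rp) * g t * w t)
    ((L * α * r ^ 2 - c * (r - rp) * r ^ 4 * b r ^ 2 / g r) * u r
      - s * (r * N r * ((r - rp) * g r * w r))) r

lemma hasDerivAt_sub_div_mul {rp r : ℝ} (hrp : rp ≠ 0) (hr : r ≠ 0) :
    HasDerivAt (fun t => (t - rp) / (t * rp)) (1 / r ^ 2) r := by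
  refine (((hasDerivAt_id r).sub_const rp).div ((hasDerivAt_id r).mul_const rp)
    (mul_ne_zero hr hrp)).congr_deriv ?_
  simp only [id]
  field_simp
  ring

lemma hasDerivAt_mul_gRN_div {L rp e r : ℝ} (hrp : 0 < rp) (hr : r ≠ 0) :
    HasDerivAt (fun t => (t - rp) * gRN L rp e t / t)
      (1 - e ^ 2 / r ^ 2 + 3 * L * r ^ 2) r := by
  refine ((hasDerivAt_mul_gRN (L := L) (e := e) hrp (r := r)).div (hasDerivAt_id r)
    hr).congr_deriv ?_
  unfold gRN
  simp only [id]
  field_simp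
  ring

/-- Hairy solutions from the rescaled unknowns of the bifurcation equations. -/
lemma IsRadialSol.isHairySol {L α c rp e s δ : ℝ} {U W β₁ γ₁ η θ ω γ G β n q τ σ j S : ℝ → ℝ}
    (h : IsRadialSol L α c rp e U W) (hL : 0 < L) (hrp : 0 < rp)
    (he : e ^ 2 < rp ^ 2 + 3 * L * rp ^ 4) (hU : ∀ r, rp ≤ r → 0 < U r)
    (cβ : Continuous β) (cG : Continuous G) (cθ : Continuous θ) (cω : Continuous ω)
    (cq : Continuous q) (hG : ∀ r, rp ≤ r → 0 < G r) (hθ0 : θ rp = 1) (hq0 : q rp = 0)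
    (hω : ∀ r, rp ≤ r → ω r = r * W r / U r * θ r + s * (η r / r))
    (hγ : ∀ r, rp ≤ r → γ r = γ₁ r - (2 * e * δ + s * δ ^ 2) / rp * (1 / r))
    (hGγ : ∀ r, rp ≤ r → G r = gRN L rp e r / r ^ 3 + s * (γ r / r ^ 2))
    (hβ : ∀ r, rp ≤ r → β r = e / rp + s * (δ / rp + β₁ r))
    (hn : ∀ r, rp ≤ r → n r = ω r ^ 2 + c * (β r * θ r / (G r * r)) ^ 2)
    (hτ : ∀ r, rp ≤ r → τ r = -((2 * (e + s * δ) * q r + s * q r ^ 2) / r ^ 2) -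
      L * α * (r ^ 2 * U r ^ 2 * θ r ^ 2) - (r - rp) * r * U r ^ 2 * G r * n r)
    (hσ : ∀ r, rp ≤ r → σ r = (r - rp) / r * γ r * (r * W r / U r) * ω r -
      c * ((r - rp) / r * ((δ / rp + β₁ r) * (β r + e / rp) / G r -
        (e / rp) ^ 2 * (γ r / r ^ 2 / G r * (r ^ 3 / gRN L rp e r))) * θ r) -
      (r - rp) * r * U r ^ 2 * n r * G r * ω r)
    (hη : ∀ r, rp ≤ r → G r * η r = j r - γ r * (r * W r / U r) * θ r / r)
    (hS : ∀ r, rp ≤ r → S r = (r - rp) * (r * U r ^ 2) * j r)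
    (dθ : ∀ r, rp < r → HasDerivAt θ (s * (η r / r ^ 2)) r)
    (dq : ∀ r, rp < r → HasDerivAt q (U r ^ 2 * (c * (β r / G r * θ r ^ 2))) r)
    (dβ : ∀ r, rp < r → HasDerivAt (fun t => (t - rp) * β₁ t / t)
      ((q r - (r - rp) * U r ^ 2 * β r * n r) / r ^ 2) r)
    (dγ : ∀ r, rp < r → HasDerivAt (fun t => (t - rp) * γ₁ t) (τ r) r)
    (dS : ∀ r, rp < r → HasDerivAt S (U r ^ 2 * σ r) r) :
    IsHairySol L α c rp s (e + s * δ) (fun r => e + s * δ + s * q r) (fun r => β r / r)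
      (fun r => r ^ 3 * G r) (fun r => U r * θ r) (fun r => U r / r * ω r)
      (fun r => U r ^ 2 / r ^ 2 * n r) ∧
    ∀ r, rp < r → HasDerivAt (fun t => s * ((t - rp) * γ t))
      (s * (τ r - (2 * e * δ + s * δ ^ 2) / r ^ 2)) r := by
  have cU := h.contu
  have r0 : ∀ {r}, rp ≤ r → 0 < r := fun hr => hrp.trans_le hr
  have ev : ∀ {r}, rp < r → ∀ᶠ t in 𝓝 r, rp ≤ t := fun hr =>
    (lt_mem_nhds hr).mono fun t ht => le_of_lt ht
  have dy : ∀ r, rp < r → HasDerivAt (fun t => s * ((t - rp) * γ t))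
      (s * (τ r - (2 * e * δ + s * δ ^ 2) / r ^ 2)) r := by
    intro r hr
    have h1 := ((dγ r hr).sub ((hasDerivAt_sub_div_mul hrp.ne' (r0 hr.le).ne').const_mul
      (2 * e * δ + s * δ ^ 2))).const_mul s
    refine (h1.congr_of_eventuallyEq ?_).congr_deriv (by ring)
    filter_upwards [ev hr] with t ht
    have := r0 ht
    simp only [Pi.sub_apply]
    rw [hγ t ht]
    field_simp
  have du : ∀ r, rp < r → HasDerivAt (fun r => U r * θ r) (U r / r * ω r) r := by
    intro r hr
    refine ((h.du r hr).mul (dθ r hr)).congr_deriv ?_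
    have := r0 hr.le
    have := hU r hr.le
    rw [hω r hr.le]
    field_simp
  refine ⟨⟨by fun_prop, ?_, by fun_prop, by fun_prop, ?_, ?_, by simp [hq0],
    by simp [hθ0, h.u_horizon], ?_, ?_, du, ?_, ?_, ?_⟩, dy⟩
  · exact cβ.continuousOn.div continuousOn_id fun r hr => (r0 hr).ne'
  · exact (cU.continuousOn.div continuousOn_id fun r hr => (r0 hr).ne').mul cω.continuousOn
  · intro r hr
    have := r0 hr
    have := hG r hr
    positivity
  · intro r hr
    have := r0 hr
    have := hG r hr
    rw [hn r hr]
    field_simp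
  · intro r hr
    refine (((dq r hr).const_mul s).const_add (e + s * δ)).congr_deriv ?_
    have := r0 hr.le
    have := hG r hr.le
    field_simp
  · intro r hr
    have h1 := ((hasDerivAt_sub_div_mul hrp.ne' (r0 hr.le).ne').const_mul
      (e + s * δ)).add ((dβ r hr).const_mul s)
    refine (h1.congr_of_eventuallyEq ?_).congr_deriv ?_
    · filter_upwards [ev hr] with t ht
      have := r0 ht
      simp only [Pi.add_apply]
      rw [hβ t ht]
      field_simp
      ring
    · have := r0 hr.le
      field_simp
      ring
  · intro r hr
    have h1 := (hasDerivAt_mul_gRN_div (L := L) (e := e) hrp (r0 hr.le).ne').add (dy r hr)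
    refine (h1.congr_of_eventuallyEq ?_).congr_deriv ?_
    · filter_upwards [ev hr] with t ht
      have := r0 ht
      simp only [Pi.add_apply]
      rw [hGγ t ht]
      field_simp
    · have := r0 hr.le
      rw [hτ r hr.le]
      field_simp
      ring
  · intro r hr
    have hr1 := r0 hr.le
    have hU1 := hU r hr.le
    have hG1 := hG r hr.le
    have hg1 := gRN_pos hL hrp he hr.le
    have h1 := (((h.dp r hr).mul (dθ r hr))).add (((dS r hr).const_mul s).div (h.du r hr) hU1.ne')
    refine (h1.congr_of_eventuallyEq ?_).congr_deriv ?_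
    · filter_upwards [ev hr] with t ht
      have := r0 ht
      have := hU t ht
      have := hG t ht
      have e1 := hη t ht
      have e2 := hGγ t ht
      simp only [Pi.add_apply, Pi.mul_apply, Pi.div_apply]
      have e3 : j t = G t * η t + γ t * (t * W t / U t) * θ t / t := by linarith
      have e4 : gRN L rp e t = t ^ 3 * G t - s * t * γ t := by
        rw [e2]
        field_simp
        ring
      rw [hS t ht, hω t ht, e3, e4]
      field_simp
      ring
    · have e1 := hη r hr.le
      have e2 := hGγ r hr.le
      have e3 : j r = G r * η r + γ r * (r * W r / U r) * θ r / r := by linarith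
      have e4 : gRN L rp e r = r ^ 3 * G r - s * r * γ r := by
        rw [e2]
        field_simp
        ring
      have e5 : s * (γ r / r ^ 2 / G r * (r ^ 3 / gRN L rp e r)) =
          r ^ 3 / gRN L rp e r - 1 / G r := by
        have e6 : r ^ 2 * G r = gRN L rp e r / r + s * γ r := by
          rw [e2]
          field_simp
        field_simp
        rw [e4]
        ring
      obtain ⟨k, hk⟩ : ∃ k, k = r ^ 3 / gRN L rp e r := ⟨_, rfl⟩
      have e6 : s * (δ / rp + β₁ r) = β r - e / rp := by
        rw [hβ r hr.le]
        ring
      have e7 : potV L α c rp e r = L * α * r ^ 2 - c * (e / rp) ^ 2 * ((r - rp) / r) * k := by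
        rw [hk]
        unfold potV
        field_simp
      have e8 : s * σ r = (r - rp) / r * (s * γ r) * (r * W r / U r) * ω r -
          c * ((r - rp) / r * ((β r - e / rp) * (β r + e / rp) / G r -
            (e / rp) ^ 2 * (k - 1 / G r)) * θ r) -
          s * ((r - rp) * r * U r ^ 2 * n r * G r * ω r) := by
        rw [hσ r hr.le, ← e6, hk, ← e5]
        ring
      have e9 : s * (U r ^ 2 * σ r) = U r ^ 2 * (s * σ r) := by ring
      rw [e9, e8, e7, hS r hr.le, e3, e4]
      rw [hω r hr.le]
      field_simp
      ring

lemma integral_Ioi_pos {f : ℝ → ℝ} {a : ℝ} (hf : IntegrableOn f (Ioi a))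
    (hpos : ∀ t, a < t → 0 < f t) : 0 < ∫ t in Ioi a, f t := by
  rw [setIntegral_pos_iff_support_of_nonneg_ae _ hf]
  · have : Ioi a ⊆ Function.support f ∩ Ioi a := fun t ht => ⟨(hpos t ht).ne', ht⟩
    exact lt_of_lt_of_le (by simp) (measure_mono this)
  · filter_upwards [ae_restrict_mem measurableSet_Ioi] with t ht
    exact (hpos t ht).le

lemma hasDerivAt_of_eq_mul_segAvg {F ψ : ℝ → ℝ} {rp r : ℝ} (hψ : Continuous ψ)
    (hF : ∀ t, rp ≤ t → F t = (t - rp) * segAvg rp ψ t) (hr : rp < r) :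
    HasDerivAt F (ψ r) r := by
  refine (hasDerivAt_mul_segAvg rp hψ r).congr_of_eventuallyEq ?_
  filter_upwards [lt_mem_nhds hr] with t ht
  exact hF t (le_of_lt ht)

lemma mul_segAvg_inv_sq {rp r : ℝ} {f : ℝ → ℝ} (hrp : 0 < rp) (hf : Continuous f)
    (h : ∀ t, rp ≤ t → f t = 1 / t) (hr : rp ≤ r) :
    r * segAvg rp (fun t => f t ^ 2) r = 1 / rp := by
  rcases hr.eq_or_lt with rfl | hr'
  · rw [segAvg_self, h _ le_rfl]
    field_simp
  · have h1 : (r - rp) * segAvg rp (fun t => f t ^ 2) r = (r - rp) / (r * rp) := by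
      rw [mul_segAvg, intervalIntegral.integral_eq_sub_of_hasDerivAt
        (f := fun t => (t - rp) / (t * rp))]
      · simp
      · intro t ht
        rw [uIcc_of_le hr] at ht
        rw [h t ht.1, div_pow, one_pow]
        exact hasDerivAt_sub_div_mul hrp.ne' (hrp.trans_le ht.1).ne'
      · exact (hf.pow 2).intervalIntegrable _ _
    have h2 : r - rp ≠ 0 := by linarith
    have h3 : 0 < r := hrp.trans hr'
    have h4 : segAvg rp (fun t => f t ^ 2) r = 1 / (r * rp) := by
      apply mul_left_cancel₀ h2
      rw [h1]
      ring
    rw [h4]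
    field_simp

lemma exists_pow_three_le_gRN {L rp e : ℝ} (hL : 0 < L) (hrp : 0 < rp)
    (he : e ^ 2 < rp ^ 2 + 3 * L * rp ^ 4) :
    ∃ C, ∀ r, rp ≤ r → r ^ 3 / gRN L rp e r ≤ C := by
  have hd : 0 < (rp ^ 2 + 3 * L * rp ^ 4 - e ^ 2) / rp := div_pos (by linarith) hrp
  refine ⟨max (2 / L) ((2 * rp) ^ 3 / ((rp ^ 2 + 3 * L * rp ^ 4 - e ^ 2) / rp)), fun r hr => ?_⟩
  have hg := gRN_pos hL hrp he hr
  have hr0 : 0 < r := hrp.trans_le hr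
  rcases le_total (2 * rp) r with h | h
  · refine le_trans ?_ (le_max_left _ _)
    rw [div_le_div_iff₀ hg hL]
    have h1 := gRN_ge hL hrp he hr
    have h2 : r / 2 * (L * r ^ 2) ≤ (r - rp) * (L * r ^ 2 + 1) :=
      mul_le_mul (by linarith) (by linarith) (by positivity) (by linarith)
    linarith
  · refine le_trans ?_ (le_max_right _ _)
    have : (rp ^ 2 + 3 * L * rp ^ 4 - e ^ 2) / rp ≤ gRN L rp e r := by
      rw [gRN_eq hrp]
      have h0 : 0 ≤ r - rp := by linarith
      have : 0 ≤ (r - rp) * (L * (r ^ 2 + 2 * r * rp + 3 * rp ^ 2) + 1) := by positivity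
      linarith
    gcongr

lemma gRN_div_pow_three_le {L rp e r : ℝ} (hL : 0 < L) (hrp : 0 < rp) (hr : rp ≤ r) :
    gRN L rp e r / r ^ 3 ≤ 3 * L + 1 / rp ^ 2 := by
  have hr0 : 0 < r := hrp.trans_le hr
  rw [div_le_iff₀ (by positivity)]
  have h1 : gRN L rp e r ≤ L * r * (r ^ 2 + r * r + r ^ 2) + r := by
    have h0 : 0 ≤ e ^ 2 / rp := by positivity
    have : L * r * (r ^ 2 + r * rp + rp ^ 2) ≤ L * r * (r ^ 2 + r * r + r ^ 2) := by gcongr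
    unfold gRN
    linarith
  have h2 : r ≤ 1 / rp ^ 2 * r ^ 3 := by
    rw [div_mul_eq_mul_div, one_mul, le_div_iff₀ (by positivity)]
    have : rp ^ 2 ≤ r ^ 2 := by gcongr
    nlinarith
  nlinarith

set_option linter.unusedSimpArgs false in
theorem exists_hairy_family {L α c rp : ℝ} (hL : 0 < L) (hα1 : -9 / 4 < α) (hα : α < 0)
    (hc : 0 ≤ c) (hrp : 0 < rp)
    (hH : L * α * rp ^ 2 - c * (rp ^ 2 + 3 * L * rp ^ 4) / (6 * L * rp ^ 2 + 1) +
      (6 * L * rp ^ 2 + 1) / 4 < 0) :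
    ∃ e0, 0 < e0 ∧ e0 ^ 2 < rp ^ 2 + 3 * L * rp ^ 4 ∧ ∃ s0 > 0, ∃ K, ∀ s, 0 ≤ s → s < s0 →
      ∃ (e : ℝ) (Q b g u w N y : ℝ → ℝ), |e - e0| ≤ K * s ∧ IsHairySol L α c rp s e Q b g u w N ∧
        (∀ r, rp ≤ r → r ^ 3 * u r ^ 2 ≤ K) ∧ ∀ r, rp < r →
          |(r - rp) * g r / r - (r - rp) * gRN L rp e0 r / r| ≤ K * s * r ∧
          HasDerivAt (fun t => (t - rp) * g t / t - (t - rp) * gRN L rp e0 t / t) (y r) r ∧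
          |y r| ≤ K * s := by
  obtain ⟨e, he0, he, U, W, h, hW, hU, R, hR, hfast⟩ := exists_linear_hair hL hα1 hα hc hrp hH
  obtain ⟨hU1, ⟨CU, hCU⟩, ⟨Cζ, hCζ⟩, hInt, CT, -, htail⟩ := h.decay hL hα hc hrp he hW hU hR hfast
  obtain ⟨CH, hCH⟩ := exists_pow_three_le_gRN hL hrp he
  have r0 : ∀ {r}, rp ≤ r → 0 < r := fun hr => hrp.trans_le hr
  have hg : ∀ {r}, rp ≤ r → 0 < gRN L rp e r := fun hr => gRN_pos hL hrp he hr
  have cU := h.contu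
  have cW := h.contw
  have cg := continuous_gRN (L := L) (rp := rp) (e := e)
  obtain ⟨ζ, hζ⟩ := exists_boundedContinuous (rp := rp) (C := Cζ) (f := fun r => r * W r / U r)
    (by
      refine ContinuousOn.div (by fun_prop) (by fun_prop) fun r hr => (hU r hr).ne') hCζ
  obtain ⟨G₀, hG₀⟩ := exists_boundedContinuous (rp := rp) (C := 3 * L + 1 / rp ^ 2)
    (f := fun r => gRN L rp e r / r ^ 3)
    (ContinuousOn.div (by fun_prop) (by fun_prop) fun r hr => (pow_pos (r0 hr) 3).ne')
    (fun r hr => by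
      have := r0 hr
      have := hg hr
      rw [abs_of_nonneg (by positivity)]
      exact gRN_div_pow_three_le hL hrp hr)
  obtain ⟨H₀, hH₀⟩ := exists_boundedContinuous (rp := rp) (C := CH)
    (f := fun r => r ^ 3 / gRN L rp e r)
    (ContinuousOn.div (by fun_prop) (by fun_prop) fun r hr => (hg hr).ne')
    (fun r hr => by
      have := r0 hr
      have := hg hr
      rw [abs_of_nonneg (by positivity)]
      exact hCH r hr)
  obtain ⟨iR, hiR⟩ := exists_boundedContinuous (rp := rp) (C := 1 / rp) (f := fun r => 1 / r)
    (ContinuousOn.div (by fun_prop) (by fun_prop) fun r hr => (r0 hr).ne')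
    (fun r hr => by
      have := r0 hr
      rw [abs_of_nonneg (by positivity)]
      gcongr)
  obtain ⟨xr, hxr⟩ := exists_boundedContinuous (rp := rp) (C := 1) (f := fun r => (r - rp) / r)
    (ContinuousOn.div (by fun_prop) (by fun_prop) fun r hr => (r0 hr).ne')
    (fun r hr => by
      have := r0 hr
      have h1 : 0 ≤ r - rp := by linarith
      rw [abs_of_nonneg (by positivity), div_le_one this]
      linarith)
  obtain ⟨W₁, hW₁⟩ := exists_boundedContinuous (rp := rp) (C := CU / rp ^ 2)
    (f := fun r => (r - rp) * U r ^ 2) (by fun_prop)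
    (fun r hr => by
      have := r0 hr
      have h1 : 0 ≤ r - rp := by linarith
      rw [abs_of_nonneg (by positivity), le_div_iff₀ (by positivity)]
      calc (r - rp) * U r ^ 2 * rp ^ 2 ≤ r * U r ^ 2 * r ^ 2 := by gcongr; linarith
        _ = r ^ 3 * U r ^ 2 := by ring
        _ ≤ CU := hCU r hr)
  obtain ⟨W₂, hW₂⟩ := exists_boundedContinuous (rp := rp) (C := CU / rp)
    (f := fun r => r ^ 2 * U r ^ 2) (by fun_prop)
    (fun r hr => by
      have := r0 hr
      rw [abs_of_nonneg (by positivity), le_div_iff₀ (by positivity)]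
      calc r ^ 2 * U r ^ 2 * rp ≤ r ^ 2 * U r ^ 2 * r := by gcongr
        _ = r ^ 3 * U r ^ 2 := by ring
        _ ≤ CU := hCU r hr)
  obtain ⟨W₃, hW₃⟩ := exists_boundedContinuous (rp := rp) (C := CU / rp)
    (f := fun r => (r - rp) * r * U r ^ 2) (by fun_prop)
    (fun r hr => by
      have := r0 hr
      have h1 : 0 ≤ r - rp := by linarith
      rw [abs_of_nonneg (by positivity), le_div_iff₀ (by positivity)]
      calc (r - rp) * r * U r ^ 2 * rp ≤ r * r * U r ^ 2 * r := by gcongr; linarith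
        _ = r ^ 3 * U r ^ 2 := by ring
        _ ≤ CU := hCU r hr)
  have hIpos := integral_Ioi_pos hInt fun t ht => pow_pos (hU t (le_of_lt ht)) 2
  obtain ⟨J, hJ⟩ := exists_flux_operator (C := CT) (ρ := fun r => U r ^ 2) hrp (cU.pow 2)
    (fun r hr => pow_pos (hU r hr) 2) (fun r hr => pow_le_one₀ (hU r hr).le (hU1 r hr)) hInt hIpos
    htail
  obtain ⟨l, hl⟩ := exists_functional measurableSet_Ioi hInt (fun r _ => sq_nonneg (U r))
  have hiR' : ∀ t, rp ≤ t → iR t = 1 / t := fun t ht => by rw [hiR, max_eq_left ht]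
  have hseg : ∀ r, rp ≤ r → r * segAvg rp (fun t => iR t ^ 2) r = 1 / rp := fun r hr =>
    mul_segAvg_inv_sq hrp iR.continuous hiR' hr
  obtain ⟨A₁, hA₁⟩ := exists_operator_segAvg (rp := rp) (M := 1 / rp) (ρ := fun t => iR t ^ 2)
    (f := fun r => r) (by fun_prop) (fun r _ => sq_nonneg _) (by fun_prop) (fun r hr => by
      rw [abs_of_pos (r0 hr), hseg r hr])
  obtain ⟨A₀, hA₀⟩ := exists_operator_segAvg (rp := rp) (M := 1) (ρ := fun _ => 1)
    (f := fun _ => 1) (by fun_prop) (fun r _ => zero_le_one) (by fun_prop) (fun r hr => by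
      simp [segAvg])
  obtain ⟨I₂, hI₂⟩ := exists_operator_segAvg (rp := rp) (M := 1 / rp) (ρ := fun t => iR t ^ 2)
    (f := fun r => r - rp) (by fun_prop) (fun r _ => sq_nonneg _) (by fun_prop) (fun r hr => by
      have h1 : 0 ≤ r - rp := by linarith
      have h2 := hseg r hr
      have h3 : 0 ≤ segAvg rp (fun t => iR t ^ 2) r := by
        refine nonneg_of_mul_nonneg_right ?_ (r0 hr)
        rw [h2]
        positivity
      rw [abs_of_nonneg h1]
      nlinarith)
  obtain ⟨IU, hIU⟩ := exists_operator_segAvg (rp := rp) (M := ∫ t in Ioi rp, U t ^ 2)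
    (ρ := fun t => U t ^ 2) (f := fun r => r - rp) (by fun_prop) (fun r _ => sq_nonneg _)
    (by fun_prop) (fun r hr => by
      rw [abs_of_nonneg (by linarith), mul_segAvg, ← intervalIntegral.integral_interval_add_Ioi
        (b := r) hInt (hInt.mono_set (Ioi_subset_Ioi hr))]
      have : 0 ≤ ∫ t in Ioi r, U t ^ 2 := setIntegral_nonneg measurableSet_Ioi fun t _ => sq_nonneg
        _
      linarith)
  have hG : G₀ * H₀ = 1 := by
    ext r
    have h1 := hg (le_max_right r rp)
    have h2 := r0 (le_max_right r rp)
    simp only [BoundedContinuousFunction.mul_apply, hG₀, hH₀, BoundedContinuousFunction.coe_one,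
      Pi.one_apply]
    field_simp
  have hne : l (-(2 * e / rp) • (xr * ζ ^ 2 * iR) - c • (xr * ((2 * (e / rp) / rp) • H₀ +
      ((e / rp) ^ 2 * (2 * e / rp)) • (iR ^ 3 * H₀ ^ 2)))) ≠ 0 := by
    rw [hl]
    generalize hψ : (-(2 * e / rp) • (xr * ζ ^ 2 * iR) - c • (xr * ((2 * (e / rp) / rp) • H₀ +
      ((e / rp) ^ 2 * (2 * e / rp)) • (iR ^ 3 * H₀ ^ 2))) : ℝ →ᵇ ℝ) = ψ
    have h1 := integral_Ioi_pos (integrableOn_mul_bounded hInt ψ).neg fun t ht => by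
      have h1 : 0 < t - rp := by linarith
      have h2 := r0 (le_of_lt ht)
      have h3 := hg (le_of_lt ht)
      have h4 := hU t (le_of_lt ht)
      have h5 := hW t ht
      have h6 : 0 < (t * W t / U t) ^ 2 := by
        have : t * W t / U t ≠ 0 := by
          have := h5.ne
          positivity
        positivity
      have h7 : 0 < U t ^ 2 * ((2 * e / rp) * ((t - rp) / t * (t * W t / U t) ^ 2 * (1 / t))) := by
        positivity
      have h8 : 0 ≤ U t ^ 2 * (c * ((t - rp) / t * ((2 * (e / rp) / rp) * (t ^ 3 / gRN L rp e t) +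
        ((e / rp) ^ 2 * (2 * e / rp)) * ((1 / t) ^ 3 * (t ^ 3 / gRN L rp e t) ^ 2)))) := by
        positivity
      rw [← hψ]
      simp only [Pi.neg_apply, BoundedContinuousFunction.sub_apply,
        BoundedContinuousFunction.smul_apply, BoundedContinuousFunction.mul_apply,
        BoundedContinuousFunction.add_apply, BoundedContinuousFunction.pow_apply, smul_eq_mul,
        hxr, hζ, hiR, hH₀, max_eq_left (le_of_lt ht)]
      linarith
    simp only [Pi.neg_apply, integral_neg] at h1
    linarith
  obtain ⟨s0, hs0, K, hK⟩ := exists_bifurcating_solution I₂ IU A₀ A₁ J l ζ G₀ H₀ iR xr W₁ W₂ W₃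
    (e / rp) e rp c (L * α) hG hne
  refine ⟨e, he0, he, min s0 (rp ^ 2 / ((|K| + 1) * (‖H₀‖ + 1))),
    lt_min hs0 (by positivity), K + |CU| * K ^ 2 + (2 * e * K + s0 * K ^ 2) / rp ^ 2, ?_⟩
  intro s hs hss
  obtain ⟨δ, β₁, γ₁, η, θ, ω, γ, G, H, β, n, q, τ, σ, hδK, hθK, hγK, hτK, hθ, hω, hγ, hGγ, hGH, hβ,
    hn, hq, hβ₁, hτ, hγ₁, hσ, hlσ, hη⟩ := hK s hs (hss.trans_le (min_le_left _ _))
  have hK0 : 0 ≤ K := (abs_nonneg _).trans hδK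
  have hss0 : s ≤ s0 := hss.le.trans (min_le_left _ _)
  rw [lt_min_iff, lt_div_iff₀ (by positivity), abs_of_nonneg hK0] at hss
  have hGH' : ∀ r, G r * H r = 1 := fun r => by
    rw [← BoundedContinuousFunction.mul_apply, hGH]
    rfl
  have hGpos : ∀ r, rp ≤ r → 0 < G r := by
    intro r hr
    have h1 := r0 hr
    have e1 := DFunLike.congr_fun hGγ r
    simp only [BoundedContinuousFunction.add_apply, BoundedContinuousFunction.smul_apply,
      BoundedContinuousFunction.mul_apply, BoundedContinuousFunction.pow_apply, smul_eq_mul,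
      hiR' r hr] at e1
    have e2 : 1 / (‖H₀‖ + 1) ≤ G₀ r := by
      have e3 : G₀ r * H₀ r = 1 := by
        rw [← BoundedContinuousFunction.mul_apply, hG]
        rfl
      have e4 : 0 < G₀ r := by
        have := hg hr
        rw [hG₀, max_eq_left hr]
        positivity
      have e5 : H₀ r ≤ ‖H₀‖ + 1 := by
        have := (le_abs_self _).trans (H₀.norm_coe_le_norm r)
        linarith
      rw [div_le_iff₀ (by positivity)]
      calc 1 = G₀ r * H₀ r := e3.symm
        _ ≤ G₀ r * (‖H₀‖ + 1) := by gcongr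
    have e3 : |s * ((1 / r) ^ 2 * γ r)| ≤ s * ((1 / rp) ^ 2 * K) := by
      rw [abs_mul, abs_mul, abs_of_nonneg hs, abs_of_nonneg (sq_nonneg _)]
      gcongr
      exact (γ.norm_coe_le_norm r).trans hγK
    have e4 : s * ((1 / rp) ^ 2 * K) < 1 / (‖H₀‖ + 1) := by
      rw [lt_div_iff₀ (by positivity)]
      refine lt_of_mul_lt_mul_right ?_ (sq_nonneg rp)
      have : s * ((1 / rp) ^ 2 * K) * (‖H₀‖ + 1) * rp ^ 2 = s * (K * (‖H₀‖ + 1)) := by field_simp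
      have : 0 ≤ s * (‖H₀‖ + 1) := by positivity
      linarith [hss.2]
    linarith [(abs_le.1 e3).1]
  have hH' : ∀ r, rp ≤ r → H r = 1 / G r := fun r hr => by
    rw [eq_div_iff (hGpos r hr).ne', mul_comm, hGH' r]
  have hθr : ∀ r, rp ≤ r → θ r = 1 + s * I₂ η r := fun r hr => by
    rw [hθ]
    rfl
  have hqr : ∀ r, rp ≤ r → q r = (r - rp) * segAvg rp
      (fun t => U t ^ 2 * (c • (β * H * θ ^ 2)) t) r := fun r hr => by
    rw [hq, hIU _ r hr]
  have hGγ' : ∀ r, rp ≤ r → G r = gRN L rp e r / r ^ 3 + s * (γ r / r ^ 2) := fun r hr => by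
    have e1 := DFunLike.congr_fun hGγ r
    simp only [BoundedContinuousFunction.add_apply, BoundedContinuousFunction.sub_apply,
      BoundedContinuousFunction.neg_apply, BoundedContinuousFunction.smul_apply,
      BoundedContinuousFunction.mul_apply, BoundedContinuousFunction.pow_apply,
      BoundedContinuousFunction.coe_one, Pi.one_apply, smul_eq_mul, mul_one, hiR, hG₀,
        max_eq_left hr] at e1
    rw [e1]
    ring
  have key := h.isHairySol (s := s) (δ := δ) (β₁ := β₁) (γ₁ := γ₁) (η := η) (θ := θ) (ω := ω)
    (γ := γ) (G := G) (β := β) (n := n) (q := q) (τ := τ) (σ := σ) (j := J σ)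
    (S := fun r => (r - rp) * segAvg rp (fun t => U t ^ 2 * σ t) r) hL hrp he hU β.continuous
    G.continuous θ.continuous ω.continuous q.continuous hGpos ?_ ?_ ?_ ?_ hGγ' ?_ ?_ ?_ ?_ ?_ ?_ ?_
      ?_
    ?_ ?_ ?_
  · obtain ⟨key, hkγ⟩ := key
    have hCU0 : ∀ r, rp ≤ r → r ^ 3 * U r ^ 2 ≤ |CU| := fun r hr => (hCU r hr).trans (le_abs_self _)
    have hB : |2 * e * δ + s * δ ^ 2| ≤ 2 * e * K + s0 * K ^ 2 := by
      have e1 : δ ^ 2 ≤ K ^ 2 := by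
        rw [← sq_abs]
        gcongr
      have e2 : s * δ ^ 2 ≤ s0 * K ^ 2 := by gcongr
      have e3 := abs_le.1 hδK
      have e4 : 2 * e * δ ≤ 2 * e * K := by gcongr; exact e3.2
      have e5 : 2 * e * (-K) ≤ 2 * e * δ := by gcongr; exact e3.1
      have e6 : 0 ≤ s * δ ^ 2 := by positivity
      have e7 : 0 ≤ s0 * K ^ 2 := by positivity
      rw [abs_le]
      constructor <;> linarith
    have hB0 := (abs_nonneg _).trans hB
    have hB1 : 0 ≤ (2 * e * K + s0 * K ^ 2) / rp ^ 2 := by positivity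
    have hC1 : 0 ≤ |CU| * K ^ 2 := by positivity
    refine ⟨_, _, _, _, _, _, _, fun r => s * (τ r - (2 * e * δ + s * δ ^ 2) / r ^ 2), ?_, key,
      ?_, ?_⟩
    · rw [add_sub_cancel_left, abs_mul, abs_of_nonneg hs, mul_comm]
      gcongr
      linarith
    · intro r hr
      have := r0 hr
      have e1 : θ r ^ 2 ≤ K ^ 2 := by
        rw [← sq_abs]
        gcongr
        exact (θ.norm_coe_le_norm r).trans hθK
      calc r ^ 3 * (U r * θ r) ^ 2 = r ^ 3 * U r ^ 2 * θ r ^ 2 := by ring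
        _ ≤ |CU| * K ^ 2 := mul_le_mul (hCU0 r hr) e1 (sq_nonneg _) (abs_nonneg _)
        _ ≤ _ := by linarith
    · intro r hr
      have hr0 := r0 hr.le
      have hx : 0 ≤ r - rp := by linarith
      have e1 : ∀ t, rp ≤ t → (t - rp) * (t ^ 3 * G t) / t - (t - rp) * gRN L rp e t / t =
          s * ((t - rp) * γ t) := fun t ht => by
        have := r0 ht
        rw [hGγ' t ht]
        field_simp
        ring
      refine ⟨?_, (hkγ r hr).congr_of_eventuallyEq ?_, ?_⟩
      · rw [e1 r hr.le, abs_mul, abs_mul, abs_of_nonneg hs, abs_of_nonneg hx]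
        have e2 : |γ r| ≤ K := (γ.norm_coe_le_norm r).trans hγK
        calc s * ((r - rp) * |γ r|) ≤ s * (r * K) := by gcongr; linarith
          _ = K * s * r := by ring
          _ ≤ _ := by gcongr; linarith
      · filter_upwards [lt_mem_nhds hr] with t ht
        exact e1 t (le_of_lt ht)
      · have e2 : |τ r| ≤ K := (τ.norm_coe_le_norm r).trans hτK
        have e3 : |(2 * e * δ + s * δ ^ 2) / r ^ 2| ≤ (2 * e * K + s0 * K ^ 2) / rp ^ 2 := by
          rw [abs_div, abs_of_nonneg (sq_nonneg r)]
          gcongr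
        rw [abs_mul, abs_of_nonneg hs, mul_comm]
        gcongr
        linarith [abs_sub (τ r) ((2 * e * δ + s * δ ^ 2) / r ^ 2)]
  · rw [hθr rp le_rfl, hI₂ _ rp le_rfl]
    simp
  · rw [hqr rp le_rfl]
    simp
  · intro r hr
    have e1 := DFunLike.congr_fun hω r
    simp only [BoundedContinuousFunction.add_apply, BoundedContinuousFunction.sub_apply,
      BoundedContinuousFunction.neg_apply, BoundedContinuousFunction.smul_apply,
      BoundedContinuousFunction.mul_apply, BoundedContinuousFunction.pow_apply,
      BoundedContinuousFunction.coe_one, Pi.one_apply, smul_eq_mul, mul_one, hζ, hiR,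
        max_eq_left hr] at e1
    rw [e1]
    ring
  · intro r hr
    have e1 := DFunLike.congr_fun hγ r
    simp only [BoundedContinuousFunction.add_apply, BoundedContinuousFunction.sub_apply,
      BoundedContinuousFunction.neg_apply, BoundedContinuousFunction.smul_apply,
      BoundedContinuousFunction.mul_apply, BoundedContinuousFunction.pow_apply,
      BoundedContinuousFunction.coe_one, Pi.one_apply, smul_eq_mul, mul_one, hiR,
        max_eq_left hr] at e1
    exact e1
  · intro r hr
    have e1 := DFunLike.congr_fun hβ r
    simp only [BoundedContinuousFunction.add_apply, BoundedContinuousFunction.sub_apply,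
      BoundedContinuousFunction.neg_apply, BoundedContinuousFunction.smul_apply,
      BoundedContinuousFunction.mul_apply, BoundedContinuousFunction.pow_apply,
      BoundedContinuousFunction.coe_one, Pi.one_apply, smul_eq_mul, mul_one] at e1
    rw [e1]
  · intro r hr
    have e1 := DFunLike.congr_fun hn r
    simp only [BoundedContinuousFunction.add_apply, BoundedContinuousFunction.sub_apply,
      BoundedContinuousFunction.neg_apply, BoundedContinuousFunction.smul_apply,
      BoundedContinuousFunction.mul_apply, BoundedContinuousFunction.pow_apply,
      BoundedContinuousFunction.coe_one, Pi.one_apply, smul_eq_mul, mul_one, hiR, max_eq_left hr,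
        hH' r hr] at e1
    rw [e1]
    ring
  · intro r hr
    have e1 := DFunLike.congr_fun hτ r
    simp only [BoundedContinuousFunction.add_apply, BoundedContinuousFunction.sub_apply,
      BoundedContinuousFunction.neg_apply, BoundedContinuousFunction.smul_apply,
      BoundedContinuousFunction.mul_apply, BoundedContinuousFunction.pow_apply,
      BoundedContinuousFunction.coe_one, Pi.one_apply, smul_eq_mul, mul_one, hiR, hW₂, hW₃,
        max_eq_left hr] at e1
    rw [e1]
    ring
  · intro r hr
    have e1 := DFunLike.congr_fun hσ r
    simp only [BoundedContinuousFunction.add_apply, BoundedContinuousFunction.sub_apply,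
      BoundedContinuousFunction.neg_apply, BoundedContinuousFunction.smul_apply,
      BoundedContinuousFunction.mul_apply, BoundedContinuousFunction.pow_apply,
      BoundedContinuousFunction.coe_one, Pi.one_apply, smul_eq_mul, mul_one, hiR, hW₃, hxr, hζ,
        hH₀, max_eq_left hr, hH' r hr] at e1
    rw [e1]
    ring
  · intro r hr
    have e1 := DFunLike.congr_fun hη r
    simp only [BoundedContinuousFunction.add_apply, BoundedContinuousFunction.sub_apply,
      BoundedContinuousFunction.neg_apply, BoundedContinuousFunction.smul_apply,
      BoundedContinuousFunction.mul_apply, BoundedContinuousFunction.pow_apply,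
      BoundedContinuousFunction.coe_one, Pi.one_apply, smul_eq_mul, mul_one, hiR, hζ,
        max_eq_left hr, hH' r hr] at e1
    have := hGpos r hr
    rw [e1]
    field_simp
  · intro r hr
    have e1 := hJ σ (by rw [← hl, hlσ]) r hr
    have := r0 hr
    have := hU r hr
    simp only [e1]
    field_simp
  · intro r hr
    have e1 := ((hasDerivAt_of_eq_mul_segAvg (by fun_prop) (hI₂ η) hr).const_mul s).const_add 1
    refine (e1.congr_of_eventuallyEq ?_).congr_deriv ?_
    · filter_upwards [lt_mem_nhds hr] with t ht
      exact hθr t (le_of_lt ht)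
    · rw [hiR' r hr.le]
      ring
  · intro r hr
    refine (hasDerivAt_of_eq_mul_segAvg (by fun_prop) hqr hr).congr_deriv ?_
    simp only [BoundedContinuousFunction.add_apply, BoundedContinuousFunction.sub_apply,
      BoundedContinuousFunction.neg_apply, BoundedContinuousFunction.smul_apply,
      BoundedContinuousFunction.mul_apply, BoundedContinuousFunction.pow_apply,
      BoundedContinuousFunction.coe_one, Pi.one_apply, smul_eq_mul, mul_one, hH' r hr.le]
    ring
  · intro r hr
    refine (hasDerivAt_of_eq_mul_segAvg (rp := rp)
      (ψ := fun t => iR t ^ 2 * (q - W₁ * β * n) t) (by fun_prop) (fun t ht => ?_) hr).congr_deriv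
        ?_
    · have := r0 ht
      rw [hβ₁, hA₁ _ t ht]
      field_simp
    · simp only [BoundedContinuousFunction.add_apply, BoundedContinuousFunction.sub_apply,
      BoundedContinuousFunction.neg_apply, BoundedContinuousFunction.smul_apply,
      BoundedContinuousFunction.mul_apply, BoundedContinuousFunction.pow_apply,
      BoundedContinuousFunction.coe_one, Pi.one_apply, smul_eq_mul, mul_one, hW₁, hiR,
        max_eq_left hr.le]
      ring
  · intro r hr
    refine hasDerivAt_of_eq_mul_segAvg (rp := rp) (by fun_prop) (fun t ht => ?_) hr
    rw [hγ₁, hA₀ _ t ht]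
    simp
  · intro r hr
    exact hasDerivAt_mul_segAvg rp (by fun_prop) r

lemma ContinuousOn.tendsto_nhdsGT {f : ℝ → ℝ} {a : ℝ} (hf : ContinuousOn f (Ici a)) :
    Tendsto f (𝓝[>] a) (𝓝 (f a)) :=
  ((hf a self_mem_Ici).mono Ioi_subset_Ici_self).tendsto

lemma eq_of_hasDerivAt_sub_mul {k h : ℝ → ℝ} {rp : ℝ} (hk : ContinuousOn k (Ici rp))
    (hd : ∀ r, rp < r → HasDerivAt (fun t => (t - rp) * k t) (h r) r)
    (hh : ContinuousOn h (Ici rp)) : k rp = h rp := by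
  have h1 : HasDerivWithinAt (fun t => (t - rp) * k t) (h rp) (Ici rp) rp := by
    refine hasDerivWithinAt_Ici_of_tendsto_deriv (s := Ioi rp)
      (fun r hr => (hd r hr).differentiableAt.differentiableWithinAt) ?_ self_mem_nhdsWithin ?_
    · have := (hk rp self_mem_Ici).mono Ioi_subset_Ici_self
      exact (by fun_prop : ContinuousWithinAt (fun t => t - rp) (Ioi rp) rp).mul this
    · refine hh.tendsto_nhdsGT.congr' ?_
      filter_upwards [self_mem_nhdsWithin] with t ht
      exact (hd t ht).deriv.symm
  rw [hasDerivWithinAt_iff_tendsto_slope, Ici_sdiff_left] at h1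
  refine tendsto_nhds_unique (hk.tendsto_nhdsGT.congr' ?_) h1
  filter_upwards [self_mem_nhdsWithin] with t ht
  have : t - rp ≠ 0 := sub_ne_zero.2 (ne_of_gt ht)
  simp only [slope_def_field, sub_self, zero_mul, sub_zero]
  field_simp

lemma contDiffOn_succ_of_hasDerivAt {f f' : ℝ → ℝ} {a : ℝ} {n : ℕ}
    (hf : ∀ r, a < r → HasDerivAt f (f' r) r) (hf' : ContDiffOn ℝ n f' (Ioi a)) :
    ContDiffOn ℝ (n + 1 : ℕ) f (Ioi a) := by
  push_cast
  rw [contDiffOn_succ_iff_deriv_of_isOpen isOpen_Ioi]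
  refine ⟨fun r hr => (hf r hr).differentiableAt.differentiableWithinAt, by simp, ?_⟩
  exact hf'.congr fun r hr => (hf r hr).deriv

namespace IsHairySol

variable {L α c rp s e : ℝ} {Q b g u w N : ℝ → ℝ}

lemma contDiffOn_succ (h : IsHairySol L α c rp s e Q b g u w N) (hrp : 0 < rp) {n : ℕ}
    (hQ : ContDiffOn ℝ n Q (Ioi rp)) (hb : ContDiffOn ℝ n b (Ioi rp))
    (hg : ContDiffOn ℝ n g (Ioi rp)) (hu : ContDiffOn ℝ n u (Ioi rp))
    (hw : ContDiffOn ℝ n w (Ioi rp)) :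
    ContDiffOn ℝ (n + 1 : ℕ) Q (Ioi rp) ∧ ContDiffOn ℝ (n + 1 : ℕ) b (Ioi rp) ∧
      ContDiffOn ℝ (n + 1 : ℕ) g (Ioi rp) ∧ ContDiffOn ℝ (n + 1 : ℕ) u (Ioi rp) ∧
      ContDiffOn ℝ (n + 1 : ℕ) w (Ioi rp) := by
  have r0 : ∀ r ∈ Ioi rp, r ≠ 0 := fun r hr => (hrp.trans hr).ne'
  have r2 : ∀ r ∈ Ioi rp, r ^ 2 ≠ 0 := fun r hr => pow_ne_zero 2 (r0 r hr)
  have x0 : ∀ r ∈ Ioi rp, r - rp ≠ 0 := fun r hr => sub_ne_zero.2 (ne_of_gt hr)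
  have g0 : ∀ r ∈ Ioi rp, g r ≠ 0 := fun r hr => (h.g_pos r (le_of_lt hr)).ne'
  have g2 : ∀ r ∈ Ioi rp, g r ^ 2 ≠ 0 := fun r hr => pow_ne_zero 2 (g0 r hr)
  have hN : ContDiffOn ℝ n N (Ioi rp) := by
    have : ContDiffOn ℝ n (fun r => w r ^ 2 + c * r ^ 4 * b r ^ 2 * u r ^ 2 / g r ^ 2) (Ioi rp) :=
      (hw.pow 2).add (ContDiffOn.div (by fun_prop) (hg.pow 2) g2)
    exact this.congr fun r hr => h.N_eq r (le_of_lt hr)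
  have hxb := contDiffOn_succ_of_hasDerivAt (n := n) h.db
    ((hQ.div (by fun_prop) r2).sub (by fun_prop))
  have hxg := contDiffOn_succ_of_hasDerivAt (n := n) h.dg
    ((((contDiffOn_const.sub ((hQ.pow 2).div (by fun_prop) r2)).add (by fun_prop)).sub
      (by fun_prop)).sub (by fun_prop))
  have hxw := contDiffOn_succ_of_hasDerivAt (n := n) h.dp
    (((((by fun_prop : ContDiffOn ℝ n (fun r => L * α * r ^ 2) (Ioi rp)).sub
      (ContDiffOn.div (by fun_prop) hg g0)).mul hu)).sub (by fun_prop))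
  have hg' : ContDiffOn ℝ (n + 1 : ℕ) g (Ioi rp) := by
    have : ContDiffOn ℝ (n + 1 : ℕ) (fun t => (t - rp) * g t / t * t / (t - rp)) (Ioi rp) :=
      (hxg.mul contDiffOn_id).div (by fun_prop) x0
    refine this.congr fun r hr => ?_
    have := r0 r hr
    have := x0 r hr
    field_simp
  refine ⟨contDiffOn_succ_of_hasDerivAt h.dQ ?_, ?_, hg', contDiffOn_succ_of_hasDerivAt h.du hw, ?_⟩
  · have := hb.div hg g0
    fun_prop
  · refine (hxb.div (by fun_prop : ContDiffOn ℝ (n + 1 : ℕ) (fun t => t - rp) (Ioi rp)) x0).congr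
      fun r hr => ?_
    have := x0 r hr
    simp only [Pi.div_apply]
    field_simp
  · refine (hxw.div (by fun_prop : ContDiffOn ℝ (n + 1 : ℕ) (fun t => (t - rp) * g t) (Ioi rp))
      fun r hr => mul_ne_zero (x0 r hr) (g0 r hr)).congr fun r hr => ?_
    have := x0 r hr
    have := g0 r hr
    simp only [Pi.div_apply]
    field_simp

lemma contDiffOn_two (h : IsHairySol L α c rp s e Q b g u w N) (hrp : 0 < rp) :
    ContDiffOn ℝ 2 Q (Ioi rp) ∧ ContDiffOn ℝ 2 b (Ioi rp) ∧ ContDiffOn ℝ 2 g (Ioi rp) ∧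
      ContDiffOn ℝ 2 u (Ioi rp) ∧ ContDiffOn ℝ 2 w (Ioi rp) := by
  have c0 : ∀ {f : ℝ → ℝ}, ContinuousOn f (Ici rp) → ContDiffOn ℝ (0 : ℕ) f (Ioi rp) := fun hf =>
    contDiffOn_zero.2 (hf.mono Ioi_subset_Ici_self)
  obtain ⟨h1, h2, h3, h4, h5⟩ := h.contDiffOn_succ hrp (c0 h.contQ) (c0 h.contb) (c0 h.contg)
    (c0 h.contu) (c0 h.contw)
  exact h.contDiffOn_succ hrp h1 h2 h3 h4 h5

lemma continuousOn_N (h : IsHairySol L α c rp s e Q b g u w N) : ContinuousOn N (Ici rp) := by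
  have hb := h.contb
  have hu := h.contu
  have : ContinuousOn (fun r => w r ^ 2 + c * r ^ 4 * b r ^ 2 * u r ^ 2 / g r ^ 2) (Ici rp) :=
    (h.contw.pow 2).add (ContinuousOn.div (by fun_prop) (h.contg.pow 2)
      fun r hr => pow_ne_zero 2 (h.g_pos r hr).ne')
  exact this.congr h.N_eq

lemma hasDerivAt_potential (h : IsHairySol L α c rp s e Q b g u w N) (hrp : 0 < rp) {r : ℝ}
    (hr : rp < r) : HasDerivAt (fun t => (t - rp) * g t / t ^ 2)
      ((1 - Q r ^ 2 / r ^ 2 + 3 * L * r ^ 2 - s * (L * α * r ^ 2 * u r ^ 2) -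
        s * ((r - rp) * g r * N r)) / r - (r - rp) * g r / r / r ^ 2) r := by
  have hr0 : r ≠ 0 := (hrp.trans hr).ne'
  have h1 := (h.dg r hr).fun_div (hasDerivAt_id' r) hr0
  refine (h1.congr_of_eventuallyEq (.of_forall fun t => ?_)).congr_deriv ?_
  · simp only [div_div, sq]
  · field_simp

lemma exists_lapse (h : IsHairySol L α c rp s e Q b g u w N) {κp : ℝ} (hκp : 0 < κp) :
    ∃ κ : ℝ → ℝ, Continuous κ ∧ κ rp = κp ∧ (∀ r, 0 < κ r) ∧
      ∀ r, rp < r → HasDerivAt κ (κ r * (s * (r * N r))) r := by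
  have hN : Continuous fun t => N (max t rp) :=
    h.continuousOn_N.comp_continuous (by fun_prop) fun t => mem_Ici.2 (le_max_right _ _)
  have hc : Continuous fun t => s * (t * N (max t rp)) :=
    continuous_const.mul (continuous_id.mul hN)
  have hd : ∀ r, HasDerivAt (fun r => κp * exp (∫ t in rp..r, s * (t * N (max t rp))))
      (κp * (exp (∫ t in rp..r, s * (t * N (max t rp))) * (s * (r * N (max r rp))))) r := fun r =>
    ((intervalIntegral.integral_hasDerivAt_right (hc.intervalIntegrable _ _)
      hc.aestronglyMeasurable.stronglyMeasurableAtFilter hc.continuousAt).exp).const_mul κp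
  refine ⟨fun r => κp * exp (∫ t in rp..r, s * (t * N (max t rp))), ?_, by simp,
    fun r => by positivity, fun r hr => ?_⟩
  · exact continuous_iff_continuousAt.2 fun r => (hd r).continuousAt
  · refine (hd r).congr_deriv ?_
    rw [max_eq_left hr.le]
    ring

theorem staticSystem {Λ q0 ε : ℝ} {κ : ℝ → ℝ}
    (h : IsHairySol (-Λ / 3) α (q0 ^ 2) rp (ε ^ 2) e Q b g u w N) (hrp : 0 < rp)
    (hκ : ∀ r, 0 < κ r) (dκ : ∀ r, rp < r → HasDerivAt κ (κ r * (ε ^ 2 * (r * N r))) r) :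
    StaticSystem Λ α q0 rp κ (fun r => κ r ^ 2 * ((r - rp) * g r / r ^ 2))
      (fun r => r / 2 * (1 + Q r ^ 2 / r ^ 2 + -Λ / 3 * r ^ 2 - (r - rp) * g r / r ^ 2)) Q
      (fun r => κ r * ((r - rp) * b r)) (fun r => ε * u r) := by
  unfold StaticSystem
  generalize -Λ / 3 = L at *
  obtain ⟨hQ, hb, hg, hu, hw⟩ := h.contDiffOn_two hrp
  have r0 : ∀ r ∈ Ioi rp, 0 < r := fun r hr => hrp.trans hr
  have x0 : ∀ r ∈ Ioi rp, 0 < r - rp := fun r hr => sub_pos.2 hr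
  have g0 : ∀ r ∈ Ioi rp, 0 < g r := fun r hr => h.g_pos r (le_of_lt hr)
  have r2 : ∀ r ∈ Ioi rp, r ^ 2 ≠ 0 := fun r hr => pow_ne_zero 2 (r0 r hr).ne'
  have hF : ContDiffOn ℝ 2 (fun r => (r - rp) * g r / r ^ 2) (Ioi rp) :=
    ContDiffOn.div (by fun_prop) (by fun_prop) r2
  have hκ2 : ContDiffOn ℝ 2 κ (Ioi rp) := by
    have hN : ContDiffOn ℝ 2 N (Ioi rp) := by
      have : ContDiffOn ℝ 2 (fun r => w r ^ 2 + q0 ^ 2 * r ^ 4 * b r ^ 2 * u r ^ 2 / g r ^ 2)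
          (Ioi rp) :=
        (hw.pow 2).add (ContDiffOn.div (by fun_prop) (hg.pow 2)
          fun r hr => pow_ne_zero 2 (g0 r hr).ne')
      exact this.congr fun r hr => h.N_eq r (le_of_lt hr)
    have hk0 : ContDiffOn ℝ (0 : ℕ) κ (Ioi rp) := contDiffOn_zero.2 fun r hr =>
      (dκ r hr).continuousAt.continuousWithinAt
    have hk1 : ContDiffOn ℝ (1 : ℕ) κ (Ioi rp) := contDiffOn_succ_of_hasDerivAt dκ
      (hk0.mul (contDiffOn_const.mul (contDiffOn_id.mul (hN.of_le (by norm_num)))))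
    exact contDiffOn_succ_of_hasDerivAt dκ
      (hk1.mul (contDiffOn_const.mul (contDiffOn_id.mul (hN.of_le (by norm_num)))))
  have dF : ∀ r ∈ Ioi rp, HasDerivAt (fun t => (t - rp) * g t / t ^ 2)
      ((1 - Q r ^ 2 / r ^ 2 + 3 * L * r ^ 2 - ε ^ 2 * (L * α * r ^ 2 * u r ^ 2) -
        ε ^ 2 * ((r - rp) * g r * N r)) / r - (r - rp) * g r / r / r ^ 2) r := fun r hr =>
    h.hasDerivAt_potential hrp hr
  have dφ : ∀ r ∈ Ioi rp, deriv (fun t => ε * u t) r = ε * w r := fun r hr =>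
    ((h.du r hr).const_mul ε).deriv
  have hΩ : ∀ r, κ r ^ 2 * ((r - rp) * g r / r ^ 2) / κ r ^ 2 = (r - rp) * g r / r ^ 2 := fun r =>
    mul_div_cancel_left₀ _ (pow_ne_zero 2 (hκ r).ne')
  refine ⟨hκ2, (hκ2.pow 2).mul hF, ?_, hQ, hκ2.mul (by fun_prop), by fun_prop, fun r _ => hκ r,
    ?_, ?_, ?_, ?_, ?_, ?_, ?_⟩
  · have hQr : ContDiffOn ℝ 2 (fun r => Q r ^ 2 / r ^ 2) (Ioi rp) :=
      (hQ.pow 2).div (by fun_prop) r2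
    fun_prop
  · intro r hr
    have := hκ r
    have := r0 r hr
    have := x0 r hr
    have := g0 r hr
    positivity
  · intro r hr
    have := (hκ r).ne'
    have := (r0 r hr).ne'
    have := (x0 r hr).ne'
    have := (g0 r hr).ne'
    rw [dφ r hr, (dκ r hr).deriv, h.N_eq r (le_of_lt hr)]
    field_simp
  · intro r hr
    have := (r0 r hr).ne'
    rw [hΩ]
    field_simp
    ring
  · intro r hr
    have := (hκ r).ne'
    have := (r0 r hr).ne'
    have := (x0 r hr).ne'
    have := (g0 r hr).ne'
    have d1 : HasDerivAt (fun t => Q t ^ 2 / t ^ 2) (2 * Q r * (ε ^ 2 * (q0 ^ 2 * r ^ 4 *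
        (b r / g r) * u r ^ 2)) / r ^ 2 - 2 * Q r ^ 2 / r ^ 3) r := by
      refine (((h.dQ r hr).fun_pow 2).fun_div (hasDerivAt_pow 2 r) (r2 r hr)).congr_deriv ?_
      field_simp
      ring
    have d2 := ((hasDerivAt_id' r).div_const 2).mul (((d1.const_add 1).add
      ((hasDerivAt_pow 2 r).const_mul L)).sub (dF r hr))
    rw [show deriv (fun r => r / 2 * (1 + Q r ^ 2 / r ^ 2 + L * r ^ 2 - (r - rp) * g r / r ^ 2)) r =
      _ from d2.deriv, dφ r hr, hΩ, h.N_eq r (le_of_lt hr)]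
    simp only [Pi.add_apply, Pi.sub_apply]
    push_cast
    field_simp
    ring
  · intro r hr
    have := (hκ r).ne'
    have := (r0 r hr).ne'
    have := (x0 r hr).ne'
    have := (g0 r hr).ne'
    rw [(h.dQ r hr).deriv]
    field_simp
  · intro r hr
    have := (r0 r hr).ne'
    rw [show deriv (fun t => κ t * ((t - rp) * b t)) r = _ from ((dκ r hr).mul (h.db r hr)).deriv]
    ring
  · intro r hr
    have := (hκ r).ne'
    have := (r0 r hr).ne'
    have := (x0 r hr).ne'
    have := (g0 r hr).ne'
    have d1 : HasDerivAt (fun t => t ^ 2 * (κ t ^ 2 * ((t - rp) * g t / t ^ 2) / κ t ^ 2) *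
        deriv (fun t => ε * u t) t) (ε * ((L * α * r ^ 2 - q0 ^ 2 * (r - rp) * r ^ 4 * b r ^ 2 / g
          r)
          * u r - ε ^ 2 * (r * N r * ((r - rp) * g r * w r)))) r := by
      refine ((h.dp r hr).const_mul ε).congr_of_eventuallyEq ?_
      filter_upwards [lt_mem_nhds hr] with t ht
      have := (r0 t ht).ne'
      rw [hΩ, dφ t ht]
      field_simp
    rw [d1.deriv, (dκ r hr).deriv, hΩ, dφ r hr]
    field_simp
    ring

lemma continuousOn_dg (h : IsHairySol L α c rp s e Q b g u w N) (hrp : 0 < rp) :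
    ContinuousOn (fun r => 1 - Q r ^ 2 / r ^ 2 + 3 * L * r ^ 2 - s * (L * α * r ^ 2 * u r ^ 2) -
      s * ((r - rp) * g r * N r)) (Ici rp) := by
  have r2 : ∀ r ∈ Ici rp, r ^ 2 ≠ 0 := fun r hr => pow_ne_zero 2 (hrp.trans_le hr).ne'
  have hu := h.contu
  have hg := h.contg
  have hN := h.continuousOn_N
  have hQ : ContinuousOn (fun r => Q r ^ 2 / r ^ 2) (Ici rp) := (h.contQ.pow 2).div (by fun_prop) r2
  fun_prop

lemma g_div_horizon (h : IsHairySol L α c rp s e Q b g u w N) (hrp : 0 < rp) :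
    g rp / rp = 1 - e ^ 2 / rp ^ 2 + 3 * L * rp ^ 2 - s * (L * α * rp ^ 2) := by
  have h1 := eq_of_hasDerivAt_sub_mul (k := fun t => g t / t)
    (h.contg.div continuousOn_id fun r hr => (hrp.trans_le hr).ne')
    (fun r hr => by simpa only [mul_div_assoc] using h.dg r hr)
    (by simpa only [mul_div_assoc] using h.continuousOn_dg hrp)
  rw [h1]
  simp only [h.Q_horizon, h.u_horizon]
  ring

lemma b_horizon (h : IsHairySol L α c rp s e Q b g u w N) (hrp : 0 < rp) : b rp = e / rp ^ 2 := by
  have r2 : ∀ r ∈ Ici rp, r ^ 2 ≠ 0 := fun r hr => pow_ne_zero 2 (hrp.trans_le hr).ne'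
  have hb := h.contb
  have hN := h.continuousOn_N
  have h1 := eq_of_hasDerivAt_sub_mul h.contb h.db
    ((h.contQ.div (by fun_prop) r2).sub (by fun_prop))
  rw [h1]
  simp only [h.Q_horizon]
  ring

lemma g_mul_w_horizon (h : IsHairySol L α c rp s e Q b g u w N) :
    g rp * w rp = L * α * rp ^ 2 := by
  have hb := h.contb
  have hu := h.contu
  have hg := h.contg
  have hw := h.contw
  have hN := h.continuousOn_N
  have h1 := eq_of_hasDerivAt_sub_mul (k := fun t => g t * w t) (by fun_prop)
    (fun r hr => by simpa only [mul_assoc] using h.dp r hr)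
    (by
      simp only [← mul_assoc]
      exact ((((by fun_prop : ContinuousOn (fun r => L * α * r ^ 2) (Ici rp)).sub
        (ContinuousOn.div (by fun_prop) hg fun r hr => (h.g_pos r hr).ne')).mul hu)).sub
        (by fun_prop))
  rw [h1]
  simp only [h.u_horizon]
  ring

theorem horizonData {Λ ε : ℝ} {κ : ℝ → ℝ} {Kp : ℝ}
    (h : IsHairySol (-Λ / 3) α c rp (ε ^ 2) e Q b g u w N) (hrp : 0 < rp)
    (hKp : Kp = (rp ^ 2 - e ^ 2 + 3 * (-Λ / 3) * rp ^ 4) / (2 * rp ^ 3)) (hKp0 : 0 < Kp)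
    (hκ : ∀ r, 0 < κ r) (cκ : Continuous κ) (dκ : ∀ r, rp < r → HasDerivAt κ (κ r * (ε ^ 2 * (r * N
      r))) r)
    (hκp : κ rp = (1 - -Λ / 3 * α * rp * ε ^ 2 / (2 * Kp))⁻¹) :
    HorizonData Λ α rp ((e ^ 2 + rp ^ 2 + (-Λ / 3) * rp ^ 4) / (2 * rp)) e ε κ
      (fun r => κ r ^ 2 * ((r - rp) * g r / r ^ 2))
      (fun r => r / 2 * (1 + Q r ^ 2 / r ^ 2 + -Λ / 3 * r ^ 2 - (r - rp) * g r / r ^ 2)) Q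
      (fun r => κ r * ((r - rp) * b r)) (fun r => ε * u r) := by
  unfold HorizonData
  generalize -Λ / 3 = L at *
  have hb := h.contb
  have hu := h.contu
  have hg := h.contg
  have hw := h.contw
  have hQ := h.contQ
  have hN := h.continuousOn_N
  have cκ' := cκ.continuousOn (s := Ici rp)
  have r0 : ∀ r ∈ Ici rp, 0 < r := fun r hr => hrp.trans_le hr
  have r2 : ∀ r ∈ Ici rp, r ^ 2 ≠ 0 := fun r hr => pow_ne_zero 2 (r0 r hr).ne'
  have hκg : κ rp * g rp = 2 * Kp * rp ^ 2 := by
    have h1 := h.g_div_horizon hrp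
    have h2 : (1 - L * α * rp * ε ^ 2 / (2 * Kp)) ≠ 0 := by
      intro h0
      rw [h0, inv_zero] at hκp
      exact (hκ rp).ne' hκp
    rw [hκp, inv_mul_eq_iff_eq_mul₀ h2]
    rw [div_eq_iff hrp.ne'] at h1
    rw [h1]
    have h3 : (1 - L * α * rp * ε ^ 2 / (2 * Kp)) * (2 * Kp * rp ^ 2) =
      2 * Kp * rp ^ 2 - L * α * rp ^ 3 * ε ^ 2 := by
      field_simp
    rw [h3, hKp]
    field_simp
  have hF : ContinuousOn (fun r => (r - rp) * g r / r ^ 2) (Ici rp) :=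
    ContinuousOn.div (by fun_prop) (by fun_prop) r2
  have hκ0 := (hκ rp).ne'
  have hg0 := (h.g_pos rp le_rfl).ne'
  have tend : ∀ {f k : ℝ → ℝ} {l : ℝ}, ContinuousOn k (Ici rp) → k rp = l →
      (∀ r, rp < r → f r = k r) → Tendsto f (𝓝[>] rp) (𝓝 l) := fun hk hl hfk => by
    subst hl
    refine hk.tendsto_nhdsGT.congr' ?_
    filter_upwards [self_mem_nhdsWithin] with t ht
    exact (hfk t ht).symm
  refine ⟨Kp, κ rp, ?_, hKp0, hκp, ?_, ?_, ?_, ?_, ?_, ?_, ?_⟩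
  · rw [hKp]
    field_simp
    ring
  · have hQr : ContinuousOn (fun r => Q r ^ 2 / r ^ 2) (Ici rp) := (hQ.pow 2).div (by fun_prop) r2
    refine tend (by fun_prop) ?_ fun r hr => rfl
    rw [h.Q_horizon]
    field_simp
    ring
  · exact tend hQ h.Q_horizon fun r hr => rfl
  · refine tend (by fun_prop) ?_ fun r hr => rfl
    rw [h.u_horizon, mul_one]
  · exact tend cκ' rfl fun r hr => rfl
  · refine tend (k := fun r => ε * w r) (by fun_prop) ?_ fun r hr => ((h.du r hr).const_mul ε).deriv
    have h1 := h.g_mul_w_horizon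
    rw [eq_div_iff (by positivity)]
    refine mul_right_cancel₀ (pow_ne_zero 2 hrp.ne') ?_
    linear_combination ε * κ rp * h1 - ε * w rp * hκg
  · refine tend (k := fun r => b r * r ^ 2 / (κ r * g r)) (ContinuousOn.div (by fun_prop)
      (by fun_prop) fun r hr => mul_ne_zero (hκ r).ne' (h.g_pos r hr).ne') ?_ fun r hr => ?_
    · rw [hκg, h.b_horizon hrp]
      field_simp
    · have := (hκ r).ne'
      have := (r0 r (le_of_lt hr)).ne'
      have := (sub_pos.2 hr).ne'
      have := (h.g_pos r (le_of_lt hr)).ne'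
      field_simp
  · have d1 : ∀ r, rp < r → _ := fun r hr =>
      (((dκ r hr).fun_pow 2).mul (h.hasDerivAt_potential hrp hr)).deriv
    have c1 : ContinuousOn (fun r => (r - rp) * g r / r / r ^ 2) (Ici rp) :=
      ContinuousOn.div (ContinuousOn.div (by fun_prop) (by fun_prop) fun r hr => (r0 r hr).ne')
        (by fun_prop) r2
    have c2 := ((h.continuousOn_dg hrp).div continuousOn_id fun r hr => (r0 r hr).ne').sub c1
    refine tend ?_ ?_ d1
    · exact (ContinuousOn.mul (by fun_prop) hF).add ((cκ'.pow 2).mul c2)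
    · have h1 := h.g_div_horizon hrp
      simp only [h.Q_horizon, h.u_horizon, sub_self, zero_mul, zero_div, mul_zero, sub_zero,
        zero_add,
        one_pow, mul_one]
      rw [← h1]
      field_simp
      linear_combination hκg

end IsHairySol

lemma RNpot_eq_gRN {Λ rp e r : ℝ} (hrp : rp ≠ 0) (hr : r ≠ 0) :
    RNpot Λ ((e ^ 2 + rp ^ 2 + (-Λ / 3) * rp ^ 4) / (2 * rp)) e r =
      (r - rp) * gRN (-Λ / 3) rp e r / r / r := by
  unfold RNpot gRN
  field_simp
  ring

theorem exists_hairy_black_holes {Λ q0 rp α : ℝ} (hΛ : Λ < 0) (hrp : 0 < rp) (hα1 : -9 / 4 < α)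
    (hα : α < 0)
    (hH : -Λ / 3 * α * rp ^ 2 - q0 ^ 2 * (rp ^ 2 + 3 * (-Λ / 3) * rp ^ 4) /
      (6 * (-Λ / 3) * rp ^ 2 + 1) + (6 * (-Λ / 3) * rp ^ 2 + 1) / 4 < 0) :
    ∃ e0 > 0, e0 ^ 2 < rp ^ 2 + 3 * (-Λ / 3) * rp ^ 4 ∧ ∃ ε₀ > 0, ∃ C > 0, ∀ ε, 0 ≤ ε → ε < ε₀ →
      ∃ (e : ℝ) (κ Ω2 ϖ Q A φ : ℝ → ℝ), 0 < e ∧ e ^ 2 < rp ^ 2 + 3 * (-Λ / 3) * rp ^ 4 ∧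
        |e - e0| ≤ C * ε ^ 2 ∧ StaticSystem Λ α q0 rp κ Ω2 ϖ Q A φ ∧
        HorizonData Λ α rp ((e ^ 2 + rp ^ 2 + (-Λ / 3) * rp ^ 4) / (2 * rp)) e ε κ Ω2 ϖ Q A φ ∧
        (∀ r, rp < r → r ^ 3 * φ r ^ 2 ≤ C * ε ^ 2) ∧ ∀ r ∈ Ioi rp,
          |Ω2 r / κ r ^ 2 - RNpot Λ ((e0 ^ 2 + rp ^ 2 + (-Λ / 3) * rp ^ 4) / (2 * rp)) e0 r| ≤
            C * ε ^ 2 ∧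
          |deriv (fun t => Ω2 t / κ t ^ 2) r -
            deriv (RNpot Λ ((e0 ^ 2 + rp ^ 2 + (-Λ / 3) * rp ^ 4) / (2 * rp)) e0) r| ≤
            C * ε ^ 2 := by
  have hL : 0 < -Λ / 3 := by linarith
  obtain ⟨e0, he0, he0B, s0, hs0, K, hK⟩ :=
    exists_hairy_family hL hα1 hα (sq_nonneg q0) hrp hH
  set B := rp ^ 2 + 3 * (-Λ / 3) * rp ^ 4 with hB
  have hm : 0 < min e0 (√B - e0) := lt_min he0 (sub_pos.2 (Real.lt_sqrt_of_sq_lt he0B))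
  have hKC : K ≤ |K| + 2 * |K| / rp + 1 := by
    have : 0 ≤ 2 * |K| / rp := by positivity
    linarith [le_abs_self K]
  refine ⟨e0, he0, he0B, √(min s0 (min e0 (√B - e0) / (|K| + 1))),
    Real.sqrt_pos.2 (lt_min hs0 (by positivity)), |K| + 2 * |K| / rp + 1, by positivity, ?_⟩
  intro ε hε hεε
  rw [Real.lt_sqrt hε, lt_min_iff, lt_div_iff₀ (by positivity)] at hεε
  obtain ⟨e, Q, b, g, u, w, N, y, hee, h, huK, hclose⟩ := hK (ε ^ 2) (sq_nonneg ε) hεε.1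
  have hKε : K * ε ^ 2 ≤ (|K| + 2 * |K| / rp + 1) * ε ^ 2 := by gcongr
  have hem : |e - e0| < min e0 (√B - e0) := by
    have h1 : K * ε ^ 2 ≤ |K| * ε ^ 2 := by
      gcongr
      exact le_abs_self K
    linarith [sq_nonneg ε, hεε.2]
  have hem' := lt_min_iff.1 hem
  have he : 0 < e := by linarith [(abs_lt.1 hem'.1).1]
  have heB : e ^ 2 < B := (Real.lt_sqrt he.le).1 (by linarith [(abs_lt.1 hem'.2).2])
  obtain ⟨Kp, hKp⟩ : ∃ Kp, Kp = (rp ^ 2 - e ^ 2 + 3 * (-Λ / 3) * rp ^ 4) / (2 * rp ^ 3) := ⟨_, rfl⟩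
  have hKp0 : 0 < Kp := by
    rw [hKp]
    have : 0 < rp ^ 2 - e ^ 2 + 3 * (-Λ / 3) * rp ^ 4 := by linarith
    positivity
  have hκp : 0 < (1 - -Λ / 3 * α * rp * ε ^ 2 / (2 * Kp))⁻¹ := by
    have h1 : 0 ≤ -Λ / 3 * -α * rp * ε ^ 2 / (2 * Kp) := by
      have : 0 < -α := by linarith
      positivity
    have h2 : -Λ / 3 * α * rp * ε ^ 2 / (2 * Kp) = -(-Λ / 3 * -α * rp * ε ^ 2 / (2 * Kp)) := by ring
    rw [h2]
    exact inv_pos.2 (by linarith)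
  obtain ⟨κ, cκ, hκrp, hκ, dκ⟩ := h.exists_lapse hκp
  refine ⟨e, κ, _, _, Q, _, _, he, heB, hee.trans hKε, h.staticSystem hrp hκ dκ,
    h.horizonData hrp hKp hKp0 hκ cκ dκ hκrp, fun r hr => ?_, fun r hr => ?_⟩
  · calc r ^ 3 * (ε * u r) ^ 2 = r ^ 3 * u r ^ 2 * ε ^ 2 := by ring
      _ ≤ K * ε ^ 2 := by
        gcongr
        exact huK r (le_of_lt hr)
      _ ≤ _ := hKε
  · have hr0 : 0 < r := hrp.trans hr
    obtain ⟨h1, h2, h3⟩ := hclose r hr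
    have hΩ : ∀ r, κ r ^ 2 * ((r - rp) * g r / r ^ 2) / κ r ^ 2 = (r - rp) * g r / r ^ 2 :=
      fun r => mul_div_cancel_left₀ _ (pow_ne_zero 2 (hκ r).ne')
    simp only [hΩ]
    have hdiff : |(r - rp) * g r / r - (r - rp) * gRN (-Λ / 3) rp e0 r / r| / r ≤ K * ε ^ 2 := by
      rwa [div_le_iff₀ hr0]
    constructor
    · refine le_trans ?_ (hdiff.trans hKε)
      rw [RNpot_eq_gRN hrp.ne' hr0.ne', ← abs_of_pos hr0, ← abs_div, abs_of_pos hr0, sub_div]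
      exact le_of_eq (by rw [div_div ((r - rp) * g r), ← sq])
    · have d0 : HasDerivAt (RNpot Λ ((e0 ^ 2 + rp ^ 2 + (-Λ / 3) * rp ^ 4) / (2 * rp)) e0) _ r :=
        ((hasDerivAt_mul_gRN_div (L := -Λ / 3) (e := e0) hrp hr0.ne').fun_div (hasDerivAt_id' r)
          hr0.ne').congr_of_eventuallyEq (by
            filter_upwards [lt_mem_nhds hr0] with t ht using RNpot_eq_gRN hrp.ne' (ne_of_gt ht))
      have d1 := h.hasDerivAt_potential hrp hr
      have d2 := d1.fun_sub d0
      have d3 : HasDerivAt (fun t => (t - rp) * g t / t ^ 2 -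
          RNpot Λ ((e0 ^ 2 + rp ^ 2 + (-Λ / 3) * rp ^ 4) / (2 * rp)) e0 t) _ r :=
        (h2.fun_div (hasDerivAt_id' r) hr0.ne').congr_of_eventuallyEq (by
          filter_upwards [lt_mem_nhds hr0] with t ht
          rw [RNpot_eq_gRN hrp.ne' (ne_of_gt ht), sub_div, div_div ((t - rp) * g t), ← sq])
      rw [d1.deriv, d0.deriv, d2.unique d3]
      have h4 : (y r * r - ((r - rp) * g r / r - (r - rp) * gRN (-Λ / 3) rp e0 r / r) * 1) / r ^ 2 =
          y r / r - ((r - rp) * g r / r - (r - rp) * gRN (-Λ / 3) rp e0 r / r) / r / r := by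
        field_simp
      have h0 : 0 ≤ K * ε ^ 2 := (abs_nonneg _).trans h3
      have h5 : ∀ z, |z| ≤ K * ε ^ 2 → |z / r| ≤ |K| * ε ^ 2 / rp := fun z hz => by
        rw [abs_div, abs_of_pos hr0]
        gcongr
        · exact hz.trans (by gcongr; exact le_abs_self K)
        · exact le_of_lt hr
      rw [h4]
      refine (abs_sub _ _).trans ((add_le_add (h5 _ h3) (h5 _ ?_)).trans ?_)
      · rwa [abs_div, abs_of_pos hr0]
      · have : 0 ≤ (|K| + 1) * ε ^ 2 := by positivity
        have e1 : (|K| + 2 * |K| / rp + 1) * ε ^ 2 = (|K| + 1) * ε ^ 2 +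
          (|K| * ε ^ 2 / rp + |K| * ε ^ 2 / rp) := by ring
        linarith

lemma tendsto_rpow_mul_of_pow_three_mul_sq_le {φ : ℝ → ℝ} {rp C Δ : ℝ} (hΔ : 0 < Δ)
    (h : ∀ r, rp < r → r ^ 3 * φ r ^ 2 ≤ C) :
    Tendsto (fun r => r ^ ((3 : ℝ) / 2 - Δ) * φ r) atTop (𝓝 0) := by
  have h1 : Tendsto (fun r : ℝ => √C * r ^ (-Δ)) atTop (𝓝 0) := by
    simpa using (tendsto_rpow_neg_atTop hΔ).const_mul √C
  refine squeeze_zero_norm' ?_ h1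
  filter_upwards [eventually_gt_atTop rp, eventually_gt_atTop 0] with r hr hr0
  have h2 : r ^ ((3 : ℝ) / 2) * |φ r| ≤ √C := by
    refine Real.le_sqrt_of_sq_le ?_
    rw [mul_pow, sq_abs, ← Real.rpow_natCast, ← Real.rpow_mul hr0.le]
    norm_num
    exact_mod_cast h r hr
  rw [norm_mul, Real.norm_of_nonneg (by positivity), Real.norm_eq_abs, sub_eq_add_neg,
    Real.rpow_add hr0]
  calc _ = r ^ ((3 : ℝ) / 2) * |φ r| * r ^ (-Δ) := by ring
    _ ≤ _ := by gcongr

theorem stmt_10 (Λ q0 rp α Δ a R0 Me0 M0 : ℝ) (hΛ : Λ < 0) (hrp : 0 < rp)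
    (hα₁ : -9/4 < α) (hα₂ : α < 0) (hα₃ : α < -3/2 + q0^2/(2*(-Λ/3)))
    (ha : a = α + 3/2 - q0^2/(2*(-Λ/3)))
    (hR0pos : 0 < R0)
    (hR0root : 24*a*R0^2 + (4*a - 2*q0^2/(-Λ/3) + 6)*R0 + 1 = 0)
    (hR0unique : ∀ x : ℝ, 0 < x →
      24*a*x^2 + (4*a - 2*q0^2/(-Λ/3) + 6)*x + 1 = 0 → x = R0)
    (hlarge : (-Λ/3)*rp^2 > R0)
    (hΔ : Δ = Real.sqrt (9/4 + α))
    (hMe0 : Me0 = rp/2 * (1 + (-Λ/3)*rp^2))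
    (hM0 : M0 = rp * (1 + 2*(-Λ/3)*rp^2))
    (eM : ℝ → ℝ) (heM : ∀ M, eM M = Real.sqrt (2*M*rp - rp^2 - (-Λ/3)*rp^4)) :
    ∃ ε₀ > (0:ℝ), ∃ Mc : ℝ → ℝ, ∃ κ Ω2 ϖ Q A φ : ℝ → ℝ → ℝ, ∃ C > (0:ℝ),
      ∀ ε : ℝ, 0 ≤ ε → ε < ε₀ →
        Mc ε ∈ Ioo Me0 M0 ∧
        StaticSystem Λ α q0 rp (κ ε) (Ω2 ε) (ϖ ε) (Q ε) (A ε) (φ ε) ∧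
        HorizonData Λ α rp (Mc ε) (eM (Mc ε)) ε
          (κ ε) (Ω2 ε) (ϖ ε) (Q ε) (A ε) (φ ε) ∧
        -- Dirichlet boundary condition
        Tendsto (fun r => r ^ ((3:ℝ)/2 - Δ) * φ ε r) atTop (nhds 0) ∧
        -- the scalar hair is nontrivial for ε > 0
        (0 < ε → ¬ ∀ r ∈ Ioi rp, φ ε r = 0) ∧
        -- quantitative closeness to the Reissner–Nordström–AdS with mass Mc 0
        (∀ r ∈ Ioi rp,
          |Ω2 ε r/(κ ε r)^2 - RNpot Λ (Mc 0) (eM (Mc 0)) r| ≤ C*ε^2 ∧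
          |deriv (fun s => Ω2 ε s/(κ ε s)^2) r
            - deriv (fun s => RNpot Λ (Mc 0) (eM (Mc 0)) s) r| ≤ C*ε^2) := by
  have hL : 0 < -Λ / 3 := by linarith
  have hH := near_horizon_bound hL hα₃ hrp ha hR0pos hR0root hlarge
  obtain ⟨e0, he0, -, ε₀, hε₀, C, hC, hfam⟩ := exists_hairy_black_holes hΛ hrp hα₁ hα₂ hH
  choose! e κ Ω2 ϖ Q A φ he heB hee hsys hdata hφ hclose using hfam
  have heM' : ∀ t, 0 < t → eM ((t ^ 2 + rp ^ 2 + (-Λ / 3) * rp ^ 4) / (2 * rp)) = t :=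
    fun t ht => by
      rw [heM, ← Real.sqrt_sq ht.le]
      congr 1
      rw [Real.sqrt_sq ht.le]
      field_simp
      ring
  have he00 : e 0 = e0 := by
    have := hee 0 le_rfl hε₀
    rw [zero_pow two_ne_zero, mul_zero] at this
    exact sub_eq_zero.1 (abs_nonpos_iff.1 this)
  refine ⟨ε₀, hε₀, fun ε => (e ε ^ 2 + rp ^ 2 + (-Λ / 3) * rp ^ 4) / (2 * rp), κ, Ω2, ϖ, Q, A, φ,
    C, hC, fun ε h0 h1 => ⟨⟨?_, ?_⟩, hsys ε h0 h1, ?_, ?_, fun hε hφ0 => ?_, ?_⟩⟩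
  · rw [hMe0, lt_div_iff₀ (by positivity)]
    have := he ε h0 h1
    have : 0 < e ε ^ 2 := by positivity
    linarith
  · rw [hM0, div_lt_iff₀ (by positivity)]
    linarith [heB ε h0 h1]
  · rw [heM' _ (he ε h0 h1)]
    exact hdata ε h0 h1
  · refine tendsto_rpow_mul_of_pow_three_mul_sq_le ?_ (hφ ε h0 h1)
    rw [hΔ]
    exact Real.sqrt_pos.2 (by linarith)
  · obtain ⟨-, -, -, -, -, -, -, hlim, -⟩ := hdata ε h0 h1
    have h2 : Tendsto (φ ε) (𝓝[>] rp) (𝓝 0) := tendsto_const_nhds.congr' (by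
      filter_upwards [self_mem_nhdsWithin] with t ht using (hφ0 t ht).symm)
    exact hε.ne' (tendsto_nhds_unique hlim h2)
  · simp only [he00]
    rw [heM' _ he0]
    exact hclose ε h0 h1
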